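/- For each fixed N ≥ 1 there exists a constant A > 0, depending only on N, B_0 and the polynomials G_{i,r}, such that for all positive integers q and all coprime residues (w_1,…,w_K) ∈ U_q^K: #Ṽ_{N,K}(q;(w_i)) / φ(q)^N ≤ (∏_{ℓ^e ∥ q} e)^{ε_N} · q^{−min{K, N/D_0}} · e^{A·ω(q)}, where ε_N := 1 if N = K·D_0 and ε_N := 0 otherwise, ω(q) is the number of distinct prime factors of q, and the product runs over prime powers ℓ^e exactly dividing q. -/

import Mathlib

open Polynomial
open scoped Classical

noncomputable section

/-- `f : ℕ → ℤ` is a multiplicative arithmetic function. -/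
def IsMultFn (f : ℕ → ℤ) : Prop :=
  f 1 = 1 ∧ ∀ m n : ℕ, Nat.Coprime m n → f (m * n) = f m * f n

/-- The polynomials `F i` are multiplicatively independent over `ℤ`:
no nonzero integer tuple `c` makes `∏ i, (F i) ^ (c i)` identically constant in `ℚ(T)`. -/
def MultIndep {m : ℕ} (F : Fin m → Polynomial ℤ) : Prop :=
  ¬ ∃ c : Fin m → ℤ, c ≠ 0 ∧ ∃ r : ℚ,
      (∏ i, (algebraMap (Polynomial ℚ) (RatFunc ℚ) ((F i).map (Int.castRingHom ℚ))) ^ (c i))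
        = algebraMap ℚ (RatFunc ℚ) r

/-- `β` is the last invariant factor of the exponent matrix of the family `F`
(for some factorization of the `F i` into pairwise non-associated primitive irreducibles,
via a Smith normal form of the exponent matrix). -/
def IsLastInvFactor {m : ℕ} (F : Fin m → Polynomial ℤ) (β : ℤ) : Prop :=
  ∃ (M : ℕ) (G : Fin M → Polynomial ℤ) (c : Fin m → ℤ) (μ : Fin M → Fin m → ℕ),
    (∀ j, Irreducible (G j)) ∧
    (∀ j, (G j).IsPrimitive) ∧
    (∀ j j', j ≠ j' → ¬ Associated (G j) (G j')) ∧
    (∀ i, F i = Polynomial.C (c i) * ∏ j, G j ^ μ j i) ∧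
    (∀ j, ∃ i, 0 < μ j i) ∧
    ∃ (P : Matrix (Fin M) (Fin M) ℤ) (Q : Matrix (Fin m) (Fin m) ℤ),
      IsUnit P.det ∧ IsUnit Q.det ∧
      (∀ (s : Fin M) (t : Fin m), (s : ℕ) ≠ (t : ℕ) →
        (P * (Matrix.of fun u v => (μ u v : ℤ)) * Q) s t = 0) ∧
      (∀ (s s' : Fin M) (t t' : Fin m), (s : ℕ) = (t : ℕ) → (s' : ℕ) = (t' : ℕ) →
        (s : ℕ) + 1 = (s' : ℕ) →
        (P * (Matrix.of fun u v => (μ u v : ℤ)) * Q) s t ∣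
          (P * (Matrix.of fun u v => (μ u v : ℤ)) * Q) s' t') ∧
      (∀ (s : Fin M) (t : Fin m), (s : ℕ) = (t : ℕ) → (s : ℕ) + 1 = min M m →
        β = (P * (Matrix.of fun u v => (μ u v : ℤ)) * Q) s t)

/-- Invariant Factor Hypothesis `IFH(F; B₀)` for the modulus `q`. -/
def IFH {m : ℕ} (F : Fin m → Polynomial ℤ) (B₀ : ℝ) (q : ℕ) : Prop :=
  ∀ β : ℤ, IsLastInvFactor F β →
    ∀ ℓ : ℕ, ℓ.Prime → ℓ ∣ q → B₀ < (ℓ : ℝ) → Int.gcd ((ℓ : ℤ) - 1) β = 1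

/-- `alphaRatio q P`: the proportion of units `u` mod `q` with `P(u)` a unit mod `q`. -/
def alphaRatio (q : ℕ) (P : Polynomial ℤ) : ℝ :=
  (Nat.card {u : (ZMod q)ˣ // IsUnit (Polynomial.aeval ((u : ZMod q)) P)} : ℝ)
    / (Nat.totient q : ℝ)

/-- `q` is `k`-admissible with respect to the family of products `Wprod v`. -/
def KAdmissible (Wprod : ℕ → Polynomial ℤ) (k q : ℕ) : Prop :=
  (∃ u : (ZMod q)ˣ, IsUnit (Polynomial.aeval ((u : ZMod q)) (Wprod k))) ∧
  ∀ v, 1 ≤ v → v < k → ¬ ∃ u : (ZMod q)ˣ, IsUnit (Polynomial.aeval ((u : ZMod q)) (Wprod v))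

/-- Narkiewicz's set `Q(k; f_1, …, f_K)`. -/
def NarkSet {K : ℕ} (k : ℕ) (f : Fin K → ℕ → ℤ) (W : Fin K → ℕ → Polynomial ℤ) : Set ℕ :=
  {q | KAdmissible (fun v => ∏ i, W i v) k q ∧
    ∀ χ : Fin K → DirichletCharacter ℂ q, χ ≠ (fun _ => 1) →
      (∀ u : (ZMod q)ˣ, IsUnit (Polynomial.aeval ((u : ZMod q)) (∏ i, W i k)) →
          (∏ i, (χ i) (Polynomial.aeval ((u : ZMod q)) (W i k))) = 1) →
      ∃ p : ℕ, p.Prime ∧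
        (∑' j : ℕ, (∏ i, (χ i) ((f i (p ^ j) : ZMod q))) *
            ((((p : ℝ) ^ (-(j : ℝ) / (k : ℝ))) : ℝ) : ℂ)) = 0}

/-- `Pj j n`: the `j`-th largest prime factor of `n` counted with multiplicity,
equal to `1` if `Ω(n) < j`. -/
def Pj (j n : ℕ) : ℕ := (n.primeFactorsList.reverse).getD (j - 1) 1

/-- `nPart k n` is `n_k`, the largest positive integer whose `k`-th power is a
unitary divisor of `n`. -/
def nPart (k n : ℕ) : ℕ :=
  ∏ p ∈ n.primeFactors, if k ∣ n.factorization p then p ^ (n.factorization p / k) else 1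

/-- A polynomial is squarefull in `ℤ[T]` iff every complex root has multiplicity at least 2. -/
def SquarefullPoly (F : Polynomial ℤ) : Prop :=
  ∀ z : ℂ, (F.map (Int.castRingHom ℂ)).IsRoot z →
    2 ≤ (F.map (Int.castRingHom ℂ)).rootMultiplicity z

/-- `n` is convenient (with respect to exponent `k`, threshold `y` and length `J`). -/
def Convenient (k : ℕ) (y : ℝ) (J : ℕ) (n : ℕ) : Prop :=
  ∃ (m : ℕ) (P : Fin J → ℕ), 0 < m ∧ (∀ t, (P t).Prime) ∧
    (∀ s t : Fin J, s < t → P t < P s) ∧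
    (∀ t, y < (P t : ℝ) ∧ Pj 1 m < P t) ∧
    n = m * (∏ t, P t) ^ k

/-- The solution count `Ṽ_{N,K}(q; (w_i))`. -/
def VNK {K N : ℕ} (F : Fin K → Fin N → Polynomial ℤ) (q : ℕ) (w : Fin K → ZMod q) : ℕ :=
  Nat.card {v : Fin N → (ZMod q)ˣ //
    ∀ i, (∏ j, Polynomial.aeval ((v j : ZMod q)) (F i j)) = w i}

/-- `α*_N(q) = ∏_j α̃_j(q)`. -/
def alphaStarN {K N : ℕ} (F : Fin K → Fin N → Polynomial ℤ) (q : ℕ) : ℝ :=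
  ∏ j, alphaRatio q (∏ i, F i j)

/-- `n` is `r`-full: every prime dividing `n` divides it to the `r`-th power. -/
def IsRFull (r n : ℕ) : Prop := ∀ p : ℕ, p.Prime → p ∣ n → p ^ r ∣ n

/-- The `k`-free part of `n`. -/
def kfreePart (k n : ℕ) : ℕ :=
  ∏ p ∈ n.primeFactors, if n.factorization p < k then p ^ n.factorization p else 1

/-- Among the monomials of degree `< B` in each of `x_j, f_1, …, f_n` there is a linear relation. -/
lemma exists_bounded_algebraic_relation (n d : ℕ) : ∃ B : ℕ, ∀ (k : Type) [Field k]
    (f : Fin n → MvPolynomial (Fin n) k), (∀ i, (f i).totalDegree ≤ d) → ∀ j : Fin n,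
    ∃ c : Fin B × (Fin n → Fin B) → k, c ≠ 0 ∧
      ∑ s, MvPolynomial.C (c s) * (MvPolynomial.X j ^ (s.1 : ℕ) * ∏ i, f i ^ (s.2 i : ℕ)) = 0 := by
  set B := (1 + n * d) ^ n + 1 with hB
  refine ⟨B, fun k _ f hf j => ?_⟩
  let P : (Fin B × (Fin n → Fin B) → k) →ₗ[k] MvPolynomial (Fin n) k :=
    ∑ s, (LinearMap.proj (R := k) (φ := fun _ => k) s).smulRight
      (MvPolynomial.X j ^ (s.1 : ℕ) * ∏ i, f i ^ (s.2 i : ℕ))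
  have hP : ∀ c, P c = ∑ s, MvPolynomial.C (c s) *
      (MvPolynomial.X j ^ (s.1 : ℕ) * ∏ i, f i ^ (s.2 i : ℕ)) := by
    intro c
    simp [P, LinearMap.sum_apply, MvPolynomial.smul_eq_C_mul]
  set B' := (1 + n * d) * B with hB'
  let Q : MvPolynomial (Fin n) k →ₗ[k] ((Fin n → Fin B') → k) :=
    LinearMap.pi fun e => MvPolynomial.lcoeff k (Finsupp.equivFunOnFinite.symm fun i => (e i : ℕ))
  have hker : LinearMap.ker (Q ∘ₗ P) ≠ ⊥ := by
    apply LinearMap.ker_ne_bot_of_finrank_lt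
    simp only [Module.finrank_fintype_fun_eq_card, Fintype.card_fun, Fintype.card_fin,
      Fintype.card_prod, hB']
    rw [mul_pow]
    apply Nat.mul_lt_mul_of_pos_right
    · omega
    · positivity
  obtain ⟨c, hc, hc0⟩ := Submodule.exists_mem_ne_zero_of_ne_bot hker
  refine ⟨c, hc0, ?_⟩
  rw [← hP]
  have hdeg : (P c).totalDegree < B' := by
    rw [hP]
    refine lt_of_le_of_lt (b := (1 + n * d) * (B - 1)) ?_ ?_
    · refine MvPolynomial.totalDegree_finsetSum_le fun s _ => ?_
      refine (MvPolynomial.totalDegree_mul _ _).trans ?_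
      rw [MvPolynomial.totalDegree_C, zero_add]
      refine (MvPolynomial.totalDegree_mul _ _).trans ?_
      rw [add_mul]
      refine add_le_add ?_ ?_
      · rw [MvPolynomial.totalDegree_X_pow, one_mul]; omega
      · refine (MvPolynomial.totalDegree_finsetProd _ _).trans ?_
        refine (Finset.sum_le_card_nsmul _ _ (d * (B - 1)) fun i _ => ?_).trans ?_
        · refine (MvPolynomial.totalDegree_pow _ _).trans ?_
          rw [mul_comm]
          exact Nat.mul_le_mul (hf i) (by omega)
        · simp [mul_assoc]
    · rw [hB']
      exact Nat.mul_lt_mul_of_pos_left (by omega) (by omega)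
  ext m
  rw [MvPolynomial.coeff_zero]
  by_contra hm
  have hmd : ∀ i, m i < B' := fun i => by
    refine lt_of_le_of_lt ?_ hdeg
    refine le_trans ?_ (MvPolynomial.le_totalDegree (MvPolynomial.mem_support_iff.2 hm))
    by_cases h : m i = 0
    · omega
    · exact Finset.single_le_sum (f := fun i => m i) (fun _ _ => Nat.zero_le _)
        (Finsupp.mem_support_iff.2 h)
  apply hm
  have h1 : Q (P c) (fun i => ⟨m i, hmd i⟩) = 0 := by
    have : Q (P c) = 0 := hc
    rw [this]; rfl
  have h2 : (Finsupp.equivFunOnFinite.symm fun i => m i) = m := by ext; simp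
  simpa [Q, h2, MvPolynomial.lcoeff_apply] using h1

/-- First order Taylor expansion along a line through `p` with direction `u`. -/
lemma coeff_one_aeval_line {n : ℕ} {k S : Type} [Field k] [CommRing S] [Algebra k S]
    (p : Fin n → k) (u : Fin n → S) (f : MvPolynomial (Fin n) k) :
    (MvPolynomial.aeval (fun i => Polynomial.C (algebraMap k S (p i)) + Polynomial.X *
      Polynomial.C (u i)) f).coeff 0 = algebraMap k S (MvPolynomial.eval p f) ∧
    (MvPolynomial.aeval (fun i => Polynomial.C (algebraMap k S (p i)) + Polynomial.X *
      Polynomial.C (u i)) f).coeff 1 =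
        ∑ j, algebraMap k S (MvPolynomial.eval p (MvPolynomial.pderiv j f)) * u j := by
  induction f using MvPolynomial.induction_on with
  | C a =>
    simp [Polynomial.algebraMap_apply, Polynomial.coeff_C]
  | add f g hf hg =>
    simp only [map_add, Polynomial.coeff_add, hf, hg, add_mul, Finset.sum_add_distrib, and_self]
  | mul_X f i hf =>
    obtain ⟨h0, h1⟩ := hf
    constructor
    · rw [map_mul, MvPolynomial.aeval_X, Polynomial.mul_coeff_zero, h0]
      simp
    · rw [map_mul, MvPolynomial.aeval_X, Polynomial.mul_coeff_one, h0, h1]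
      simp only [Derivation.leibniz, MvPolynomial.pderiv_X, map_add, smul_eq_mul, map_mul,
        MvPolynomial.eval_X, add_mul, Finset.sum_add_distrib]
      rw [add_comm]
      simp [Polynomial.coeff_C, Pi.single_apply, Finset.sum_mul, apply_ite, ite_mul]
      rw [add_comm]
      congr 1
      refine Finset.sum_congr rfl fun _ _ => by ring

lemma card_nonsingular_zeros_le (n d : ℕ) : ∃ C : ℕ, ∀ (k : Type) [Field k]
    (f : Fin n → MvPolynomial (Fin n) k), (∀ i, (f i).totalDegree ≤ d) →
    ∀ S : Finset (Fin n → k), (∀ p ∈ S, ∀ i, MvPolynomial.eval p (f i) = 0) →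
    (∀ p ∈ S, (Matrix.of fun i j => MvPolynomial.eval p (MvPolynomial.pderiv j (f i))).det ≠ 0) →
    S.card ≤ C := by
  obtain ⟨B, hB⟩ := exists_bounded_algebraic_relation n d
  refine ⟨B ^ n, fun k _ f hf S hS0 hSd => ?_⟩
  have key : ∀ j : Fin n, ∃ T : Finset k, T.card ≤ B ∧ ∀ p ∈ S, p j ∈ T := by
    intro j
    obtain ⟨c, hc0, hc⟩ := hB k f hf j
    -- choose a nonzero coefficient of minimal total order in the `f i`
    have hne : (Finset.univ.filter fun s => c s ≠ 0).Nonempty := by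
      obtain ⟨s, hs⟩ := Function.ne_iff.1 hc0
      exact ⟨s, by simpa using hs⟩
    obtain ⟨s₀, hs₀, hmin⟩ := Finset.exists_min_image _
      (fun s : Fin B × (Fin n → Fin B) => ∑ i, (s.2 i : ℕ)) hne
    simp only [Finset.mem_filter, Finset.mem_univ, true_and] at hs₀ hmin
    set m := ∑ i, (s₀.2 i : ℕ) with hm
    let A : Polynomial k := ∑ a : Fin B, Polynomial.C (c (a, s₀.2)) * Polynomial.X ^ (a : ℕ)
    have hAc : ∀ a : Fin B, A.coeff a = c (a, s₀.2) := by
      intro a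
      simp [A, Polynomial.finsetSum_coeff, Polynomial.coeff_X_pow, Fin.val_inj]
    have hA0 : A ≠ 0 := by
      intro h
      apply hs₀
      have := hAc s₀.1
      rw [h, Polynomial.coeff_zero] at this
      exact this.symm
    have hAd : A.natDegree ≤ B - 1 := by
      refine Polynomial.natDegree_sum_le_of_forall_le _ _ fun a _ => ?_
      refine (Polynomial.natDegree_C_mul_X_pow_le _ _).trans (by omega)
    refine ⟨A.roots.toFinset, ?_, fun p hp => ?_⟩
    · exact (Multiset.toFinset_card_le _).trans ((Polynomial.card_roots' _).trans (by omega))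
    rw [Multiset.mem_toFinset, Polynomial.mem_roots hA0, Polynomial.IsRoot.def]
    -- local analysis at `p`
    set J : Matrix (Fin n) (Fin n) k :=
      Matrix.of fun i j => MvPolynomial.eval p (MvPolynomial.pderiv j (f i)) with hJ
    have hJd : IsUnit J.det := (hSd p hp).isUnit
    let u : Fin n → MvPolynomial (Fin n) k := fun l => ∑ i, algebraMap k (MvPolynomial (Fin n) k) (J⁻¹ l i) * MvPolynomial.X i
    let φ : MvPolynomial (Fin n) k →ₐ[k] Polynomial (MvPolynomial (Fin n) k) :=
      MvPolynomial.aeval (fun i => Polynomial.C (algebraMap k (MvPolynomial (Fin n) k) (p i)) + Polynomial.X *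
        Polynomial.C (u i))
    have hφ : ∀ i, ∃ h : Polynomial (MvPolynomial (Fin n) k), φ (f i) = Polynomial.X * h ∧ h.coeff 0 = MvPolynomial.X i := by
      intro i
      obtain ⟨h0, h1⟩ := coeff_one_aeval_line p u (f i)
      rw [hS0 p hp i, map_zero] at h0
      obtain ⟨h, hh⟩ := Polynomial.X_dvd_iff.2 h0
      refine ⟨h, hh, ?_⟩
      have h2 : (φ (f i)).coeff 1 = h.coeff 0 := by
        rw [show φ (f i) = Polynomial.X * h from hh, ← zero_add 1, Polynomial.coeff_X_mul]
      rw [← h2]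
      refine h1.trans ?_
      have : ∀ l, algebraMap k (MvPolynomial (Fin n) k) (MvPolynomial.eval p (MvPolynomial.pderiv l (f i))) * u l =
          ∑ i', algebraMap k (MvPolynomial (Fin n) k) (J i l * J⁻¹ l i') * MvPolynomial.X i' := by
        intro l
        simp only [u, Finset.mul_sum, map_mul, hJ, Matrix.of_apply, mul_assoc]
      simp only [this]
      rw [Finset.sum_comm]
      simp only [← Finset.sum_mul, ← map_sum]
      have h3 : ∀ i', ∑ l, J i l * J⁻¹ l i' = (1 : Matrix (Fin n) (Fin n) k) i i' := by
        intro i'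
        rw [← Matrix.mul_nonsing_inv J hJd, Matrix.mul_apply]
      simp only [h3, Matrix.one_apply]
      simp [apply_ite, ite_mul]
    choose h hh1 hh2 using hφ
    have hXj : (φ (MvPolynomial.X j)).coeff 0 = algebraMap k (MvPolynomial (Fin n) k) (p j) := by
      simp [φ]
    have e1 : ∑ s : Fin B × (Fin n → Fin B), φ (MvPolynomial.C (c s)) *
        (φ (MvPolynomial.X j) ^ (s.1 : ℕ) *
          (Polynomial.X ^ ((∑ i, (s.2 i : ℕ)) - m) * ∏ i, h i ^ (s.2 i : ℕ))) = 0 := by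
      have hX : (Polynomial.X ^ m : Polynomial (MvPolynomial (Fin n) k)) ≠ 0 := pow_ne_zero _ Polynomial.X_ne_zero
      apply mul_left_cancel₀ hX
      rw [mul_zero, Finset.mul_sum, ← map_zero φ, ← hc, map_sum]
      refine Finset.sum_congr rfl fun s _ => ?_
      by_cases hs : c s = 0
      · simp [hs]
      have := hmin s hs
      simp only [map_mul, map_pow, map_prod, hh1, mul_pow, Finset.prod_mul_distrib,
        Finset.prod_pow_eq_pow_sum]
      rw [← Nat.sub_add_cancel this, pow_add, Nat.add_sub_cancel]
      ring
    have hφC : ∀ a, (φ (MvPolynomial.C a)).coeff 0 = MvPolynomial.C a := by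
      intro a
      simp [φ, Polynomial.algebraMap_apply, MvPolynomial.algebraMap_eq]
    have e2 := congrArg Polynomial.constantCoeff e1
    simp only [map_sum, map_mul, map_pow, map_prod, map_zero, Polynomial.constantCoeff_apply,
      Polynomial.coeff_X_zero, hh2, hXj] at e2
    simp only [hφC, MvPolynomial.algebraMap_eq, ← map_pow] at e2
    have e3 := congrArg (MvPolynomial.coeff (Finsupp.equivFunOnFinite.symm fun i => (s₀.2 i : ℕ))) e2
    simp only [MvPolynomial.coeff_sum, MvPolynomial.coeff_C_mul, MvPolynomial.coeff_zero] at e3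
    have hmon : ∀ s : Fin B × (Fin n → Fin B), MvPolynomial.coeff
        (Finsupp.equivFunOnFinite.symm fun i => (s₀.2 i : ℕ))
        ((0 : MvPolynomial (Fin n) k) ^ ((∑ i, (s.2 i : ℕ)) - m) * ∏ i, (MvPolynomial.X i : MvPolynomial (Fin n) k) ^ (s.2 i : ℕ)) * c s =
        if s.2 = s₀.2 then c s else 0 := by
      intro s
      have hprod : ∏ i, (MvPolynomial.X i : MvPolynomial (Fin n) k) ^ (s.2 i : ℕ) =
          MvPolynomial.monomial (Finsupp.equivFunOnFinite.symm fun i => (s.2 i : ℕ)) 1 := by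
        rw [MvPolynomial.monomial_eq]
        simp [Finsupp.prod_fintype]
      by_cases hcs : c s = 0
      · simp [hcs]
      have hle := hmin s hcs
      rw [hprod]
      by_cases hlt : (∑ i, (s.2 i : ℕ)) - m = 0
      · rw [hlt, pow_zero, one_mul, MvPolynomial.coeff_monomial]
        have : ((Finsupp.equivFunOnFinite.symm fun i => (s.2 i : ℕ)) =
          (Finsupp.equivFunOnFinite.symm fun i => (s₀.2 i : ℕ))) ↔ s.2 = s₀.2 := by
          rw [Equiv.apply_eq_iff_eq]
          constructor
          · intro h'; funext i; exact Fin.ext (congrFun h' i)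
          · intro h'; rw [h']
        by_cases hss : s.2 = s₀.2
        · rw [if_pos (this.2 hss), if_pos hss, one_mul]
        · rw [if_neg (fun h' => hss (this.1 h')), if_neg hss, zero_mul]
      · rw [zero_pow hlt]
        rw [if_neg, zero_mul, MvPolynomial.coeff_zero, zero_mul]
        intro hss
        apply hlt
        rw [hss]
        omega
    have e4 : ∑ s : Fin B × (Fin n → Fin B), p j ^ (s.1 : ℕ) * (if s.2 = s₀.2 then c s else 0) = 0 := by
      refine Eq.trans ?_ e3
      refine Finset.sum_congr rfl fun s _ => ?_
      rw [← hmon]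
      ring
    rw [Fintype.sum_prod_type] at e4
    simp only [mul_ite, mul_zero, Finset.sum_ite_eq', Finset.mem_univ, if_true] at e4
    simp only [A, Polynomial.eval_finsetSum, Polynomial.eval_mul, Polynomial.eval_C,
      Polynomial.eval_pow, Polynomial.eval_X]
    rw [← e4]
    exact Finset.sum_congr rfl fun _ _ => mul_comm _ _
  choose T hT1 hT2 using key
  calc S.card ≤ (Fintype.piFinset T).card :=
        Finset.card_le_card fun p hp => Fintype.mem_piFinset.2 fun j => hT2 j p hp
    _ = ∏ j, (T j).card := Fintype.card_piFinset _
    _ ≤ ∏ _j : Fin n, B := Finset.prod_le_prod' fun j _ => hT1 j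
    _ = B ^ n := by simp

/-- Tuples with equal power sums over a field in which `1, …, n` are invertible have equal
elementary symmetric functions. -/
theorem esymm_map_eq_of_psum_eq {F : Type*} [Field F] {g : ℕ}
    (hg : ∀ k : ℕ, 1 ≤ k → k ≤ g → (k : F) ≠ 0) (x y : Fin g → F)
    (h : ∀ k : Fin g, ∑ i, x i ^ ((k : ℕ) + 1) = ∑ i, y i ^ ((k : ℕ) + 1)) (k : ℕ) (hk : k ≤ g) :
    (Multiset.map x Finset.univ.val).esymm k = (Multiset.map y Finset.univ.val).esymm k := by
  induction k using Nat.strong_induction_on with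
  | _ k ih =>
  rcases Nat.eq_zero_or_pos k with rfl | hk0
  · simp [Multiset.esymm]
  have key : ∀ z : Fin g → F, (k : F) * (Multiset.map z Finset.univ.val).esymm k =
      (-1) ^ (k + 1) * ∑ a ∈ Finset.HasAntidiagonal.antidiagonal k with a.1 < k,
        (-1) ^ a.1 * (Multiset.map z Finset.univ.val).esymm a.1 * ∑ i, z i ^ a.2 := by
    intro z
    have := congrArg (MvPolynomial.aeval z) (MvPolynomial.mul_esymm_eq_sum (Fin g) F k)
    simpa only [map_mul, map_natCast, map_pow, map_neg, map_one, map_sum,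
      MvPolynomial.aeval_esymm_eq_multiset_esymm, MvPolynomial.psum, MvPolynomial.aeval_X] using this
  apply mul_left_cancel₀ (hg k hk0 hk)
  rw [key x, key y]
  congr 1
  refine Finset.sum_congr rfl fun a ha => ?_
  simp only [Finset.mem_filter, Finset.HasAntidiagonal.mem_antidiagonal] at ha
  rw [ih a.1 ha.2 (by omega)]
  have h2 := h ⟨a.2 - 1, by omega⟩
  simp only [Nat.sub_add_cancel (show 1 ≤ a.2 by omega)] at h2
  rw [h2]

theorem mem_range_of_psum_eq {F : Type*} [Field F] {g : ℕ}
    (hg : ∀ k : ℕ, 1 ≤ k → k ≤ g → (k : F) ≠ 0) (x y : Fin g → F)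
    (h : ∀ k : Fin g, ∑ i, x i ^ ((k : ℕ) + 1) = ∑ i, y i ^ ((k : ℕ) + 1)) (i : Fin g) :
    ∃ j, x j = y i := by
  have e : (Multiset.map (fun t => X - C t) (Multiset.map x Finset.univ.val)).prod =
      (Multiset.map (fun t => X - C t) (Multiset.map y Finset.univ.val)).prod := by
    rw [Multiset.prod_X_sub_X_eq_sum_esymm, Multiset.prod_X_sub_X_eq_sum_esymm]
    simp only [Multiset.card_map, Finset.card_val, Finset.card_univ, Fintype.card_fin]
    refine Finset.sum_congr rfl fun k hk => ?_
    rw [esymm_map_eq_of_psum_eq hg x y h k (by simpa [Nat.lt_succ_iff] using hk)]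
  have e2 := congrArg Polynomial.roots e
  rw [roots_multiset_prod_X_sub_C, roots_multiset_prod_X_sub_C] at e2
  have : y i ∈ Multiset.map y Finset.univ.val := Multiset.mem_map_of_mem _ (by simp)
  rw [← e2] at this
  obtain ⟨j, -, hj⟩ := Multiset.mem_map.1 this
  exact ⟨j, hj⟩

theorem card_psum_eq_le {F : Type*} [Field F] [Fintype F] {g : ℕ}
    (hg : ∀ k : ℕ, 1 ≤ k → k ≤ g → (k : F) ≠ 0) :
    (Finset.univ.filter fun p : (Fin g → F) × (Fin g → F) => ∀ k : Fin g,
      ∑ i, p.1 i ^ ((k : ℕ) + 1) = ∑ i, p.2 i ^ ((k : ℕ) + 1)).card ≤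
      g ^ g * Fintype.card F ^ g := by
  have h1 : ∀ x : Fin g → F, (Finset.univ.filter fun y : Fin g → F => ∀ k : Fin g,
      ∑ i, x i ^ ((k : ℕ) + 1) = ∑ i, y i ^ ((k : ℕ) + 1)).card ≤ g ^ g := by
    intro x
    calc _ ≤ (Fintype.piFinset fun _ : Fin g => Finset.univ.image x).card := by
          refine Finset.card_le_card fun y hy => ?_
          rw [Finset.mem_filter] at hy
          rw [Fintype.mem_piFinset]
          intro i
          obtain ⟨j, hj⟩ := mem_range_of_psum_eq hg x y hy.2 i
          exact Finset.mem_image.2 ⟨j, Finset.mem_univ _, hj⟩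
      _ = (Finset.univ.image x).card ^ g := by simp
      _ ≤ g ^ g := Nat.pow_le_pow_left (Finset.card_image_le.trans (by simp)) _
  calc _ = ∑ x : Fin g → F, (Finset.univ.filter fun y : Fin g → F => ∀ k : Fin g,
      ∑ i, x i ^ ((k : ℕ) + 1) = ∑ i, y i ^ ((k : ℕ) + 1)).card := by
        simp only [Finset.card_filter]
        rw [Fintype.sum_prod_type]
    _ ≤ ∑ _x : Fin g → F, g ^ g := Finset.sum_le_sum fun x _ => h1 x
    _ = _ := by simp [mul_comm]

/-- The mean value of the power moments of polynomial exponential sums. -/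
theorem sum_norm_expSum_pow_le {F : Type*} [Field F] [Fintype F] {ψ : AddChar F ℂ}
    (hψ : ψ.IsPrimitive) {g : ℕ} (hg : ∀ k : ℕ, 1 ≤ k → k ≤ g → (k : F) ≠ 0) :
    ∑ b : Fin g → F, ‖∑ y, ψ (∑ k, b k * y ^ ((k : ℕ) + 1))‖ ^ (2 * g) ≤
      (g ^ g * Fintype.card F ^ (2 * g) : ℝ) := by
  have h1 : ∀ b : Fin g → F, ((‖∑ y, ψ (∑ k, b k * y ^ ((k : ℕ) + 1))‖ ^ (2 * g) : ℝ) : ℂ) =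
      ∑ p : (Fin g → F) × (Fin g → F), ∏ k, ψ (b k *
        (∑ i, p.1 i ^ ((k : ℕ) + 1) - ∑ i, p.2 i ^ ((k : ℕ) + 1))) := by
    intro b
    have e1 : ∀ z : ℂ, ((‖z‖ ^ (2 * g) : ℝ) : ℂ) = z ^ g * (starRingEnd ℂ z) ^ g := by
      intro z
      rw [← mul_pow, Complex.mul_conj, Complex.normSq_eq_norm_sq, pow_mul]
      push_cast
      rfl
    have hsum : ∀ {ι : Type} (s : Finset ι) (f : ι → F), ψ (∑ i ∈ s, f i) = ∏ i ∈ s, ψ (f i) := by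
      intro ι s f
      induction s using Finset.induction_on with
      | empty => simp
      | insert a s ha ih => rw [Finset.sum_insert ha, Finset.prod_insert ha, AddChar.map_add_eq_mul, ih]
    rw [e1, map_sum]
    simp only [← AddChar.map_neg_eq_conj]
    rw [Finset.sum_pow', Finset.sum_pow', Fintype.piFinset_univ, Fintype.sum_prod_type]
    rw [Finset.sum_mul_sum]
    refine Finset.sum_congr rfl fun x _ => Finset.sum_congr rfl fun y _ => ?_
    rw [← hsum, ← hsum, ← hsum, ← AddChar.map_add_eq_mul]
    congr 1
    rw [Finset.sum_neg_distrib, ← sub_eq_add_neg]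
    rw [Finset.sum_comm, Finset.sum_comm (f := fun (i k : Fin g) => b k * y i ^ ((k : ℕ) + 1)), ← Finset.sum_sub_distrib]
    refine Finset.sum_congr rfl fun k _ => ?_
    rw [mul_sub, Finset.mul_sum, Finset.mul_sum]
  have h2 : ((∑ b : Fin g → F, ‖∑ y, ψ (∑ k, b k * y ^ ((k : ℕ) + 1))‖ ^ (2 * g) : ℝ) : ℂ) =
      ((Fintype.card F ^ g * (Finset.univ.filter fun p : (Fin g → F) × (Fin g → F) => ∀ k : Fin g,
      ∑ i, p.1 i ^ ((k : ℕ) + 1) = ∑ i, p.2 i ^ ((k : ℕ) + 1)).card : ℝ) : ℂ) := by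
    rw [Complex.ofReal_sum]
    simp only [h1]
    rw [Finset.sum_comm, Finset.card_filter]
    push_cast
    rw [Finset.mul_sum]
    refine Finset.sum_congr rfl fun p _ => ?_
    rw [← Fintype.piFinset_univ, Finset.sum_prod_piFinset Finset.univ (fun (k : Fin g) (b : F) => ψ (b *
        (∑ i, p.1 i ^ ((k : ℕ) + 1) - ∑ i, p.2 i ^ ((k : ℕ) + 1))))]
    simp only [AddChar.sum_mulShift _ hψ, sub_eq_zero]
    split_ifs with h
    · simp [h]
    · obtain ⟨k, hk⟩ := not_forall.1 h
      exact (Finset.prod_eq_zero (Finset.mem_univ k) (by rw [if_neg hk]; simp)).trans (by simp)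
  rw [Complex.ofReal_inj] at h2
  rw [h2]
  have h3 : ((Finset.univ.filter fun p : (Fin g → F) × (Fin g → F) => ∀ k : Fin g,
      ∑ i, p.1 i ^ ((k : ℕ) + 1) = ∑ i, p.2 i ^ ((k : ℕ) + 1)).card : ℝ) ≤
      g ^ g * Fintype.card F ^ g := by exact_mod_cast card_psum_eq_le hg
  calc _ ≤ (Fintype.card F : ℝ) ^ g * (g ^ g * Fintype.card F ^ g) := by gcongr
    _ = _ := by ring

/-- Mordell's bound for complete exponential sums over a finite field. -/
theorem norm_expSum_pow_le {F : Type*} [Field F] [Fintype F] {ψ : AddChar F ℂ}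
    (hψ : ψ.IsPrimitive) {g : ℕ} (h2 : 2 ≤ g) (hg : ∀ k : ℕ, 1 ≤ k → k ≤ g → (k : F) ≠ 0)
    (Q : F[X]) (hQ : Q.natDegree = g) :
    ‖∑ y, ψ (Q.eval y)‖ ^ (2 * g) ≤ 2 * g ^ (g + 1) * (Fintype.card F : ℝ) ^ (2 * g - 2) := by
  set S := ‖∑ y, ψ (Q.eval y)‖ with hS
  let B : F × F → Fin g → F := fun p k => (Q.comp (C p.1 * X + C p.2)).coeff ((k : ℕ) + 1)
  have hcomp : ∀ u t : F, ∀ k, (Q.comp (C u * X + C t)).coeff k =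
      (taylor t Q).coeff k * u ^ k := by
    intro u t k
    rw [← comp_C_mul_X_coeff, taylor_apply, comp_assoc]
    simp
  have hinv : ∀ p : F × F, p.1 ≠ 0 → ‖∑ y, ψ (∑ k, B p k * y ^ ((k : ℕ) + 1))‖ = S := by
    rintro ⟨u, t⟩ hu
    have e1 : ∑ y, ψ (Q.eval y) = ∑ y, ψ ((Q.comp (C u * X + C t)).eval y) := by
      refine (Fintype.sum_bijective (fun y : F => u * y + t) ?_ _ _ fun y => ?_).symm
      · exact ((Equiv.mulLeft₀ u hu).trans (Equiv.addRight t)).bijective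
      · simp
    have e2 : ∀ y, (Q.comp (C u * X + C t)).eval y =
        (Q.comp (C u * X + C t)).coeff 0 + ∑ k, B (u, t) k * y ^ ((k : ℕ) + 1) := by
      intro y
      have hd : (Q.comp (C u * X + C t)).natDegree < g + 1 := by
        refine Nat.lt_succ_of_le ?_
        rw [natDegree_comp, hQ, natDegree_linear hu, mul_one]
      rw [eval_eq_sum_range' hd, Finset.sum_range_succ', add_comm, pow_zero, mul_one,
        Finset.sum_range]
    rw [hS, e1]
    simp only [e2, AddChar.map_add_eq_mul]
    rw [← Finset.mul_sum, norm_mul, AddChar.norm_apply, one_mul]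
  have hfib : ∀ b : Fin g → F, ((Finset.univ.filter fun p : F × F => p.1 ≠ 0).filter
      fun p => B p = b).card ≤ g := by
    intro b
    have hlc : Q.leadingCoeff ≠ 0 := by
      rw [leadingCoeff_ne_zero]; rintro rfl; simp at hQ; omega
    have hgF : (g : F) ≠ 0 := hg g (by omega) le_rfl
    have b1 : ∀ p : F × F, B p = b → p.1 ^ g = b ⟨g - 1, by omega⟩ / Q.leadingCoeff := by
      rintro ⟨u, t⟩ h
      rw [← h]
      simp only [B, Nat.sub_add_cancel (show 1 ≤ g by omega)]
      rw [hcomp, ← hQ, coeff_taylor_natDegree]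
      field_simp
    have b2 : ∀ p : F × F, B p = b → (Q.coeff (g - 1) + (g : F) * Q.leadingCoeff * p.2) *
        p.1 ^ (g - 1) = b ⟨g - 2, by omega⟩ := by
      rintro ⟨u, t⟩ h
      rw [← h]
      simp only [B, show g - 2 + 1 = g - 1 by omega]
      rw [hcomp, taylor_coeff, eval_eq_sum_range' (n := 2)]
      · simp only [Finset.sum_range_succ, Finset.sum_range_zero, hasseDeriv_coeff, zero_add,
          Nat.choose_self, pow_zero, mul_one, pow_one, show 1 + (g - 1) = g by omega,
          leadingCoeff, hQ]
        rw [Nat.choose_symm_of_eq_add (show g = g - 1 + 1 by omega), Nat.choose_one_right]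
        simp
      · have := natDegree_hasseDeriv_le Q (g - 1)
        omega
    refine le_trans (Finset.card_le_card_of_injOn (t := (nthRoots g
      (b ⟨g - 1, by omega⟩ / Q.leadingCoeff)).toFinset) Prod.fst ?_ ?_) ?_
    · intro p hp
      simp only [Finset.coe_filter, Finset.mem_filter, Set.mem_ofPred_eq] at hp
      simp only [Finset.mem_coe, Multiset.mem_toFinset]
      rw [mem_nthRoots (by omega)]
      exact b1 p hp.2
    · rintro ⟨u, t⟩ hp ⟨u', t'⟩ hp' (rfl : u = u')
      simp only [Finset.coe_filter, Finset.mem_filter, Set.mem_ofPred_eq] at hp hp'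
      have e := (b2 _ hp.2).trans (b2 _ hp'.2).symm
      have e' := mul_right_cancel₀ (pow_ne_zero _ hp.1.2) e
      have e'' := mul_left_cancel₀ (mul_ne_zero hgF hlc) (add_left_cancel e')
      exact Prod.ext rfl e''
    · exact (Multiset.toFinset_card_le _).trans (card_nthRoots _ _)
  have hcardA : (Finset.univ.filter fun p : F × F => p.1 ≠ 0).card =
      (Fintype.card F - 1) * Fintype.card F := by
    have : (Finset.univ.filter fun p : F × F => p.1 ≠ 0) =
        (Finset.univ.filter fun u : F => u ≠ 0) ×ˢ Finset.univ := by
      ext ⟨u, t⟩; simp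
    rw [this, Finset.card_product, Finset.filter_ne', Finset.card_erase_of_mem (Finset.mem_univ _)]
    rfl
  have main : ((Fintype.card F - 1) * Fintype.card F : ℕ) * S ^ (2 * g) ≤
      g * (g ^ g * (Fintype.card F : ℝ) ^ (2 * g)) := by
    calc (((Fintype.card F - 1) * Fintype.card F : ℕ) : ℝ) * S ^ (2 * g)
        = ∑ p ∈ Finset.univ.filter (fun p : F × F => p.1 ≠ 0),
          ‖∑ y, ψ (∑ k, B p k * y ^ ((k : ℕ) + 1))‖ ^ (2 * g) := by
          rw [← hcardA, ← nsmul_eq_mul, ← Finset.sum_const]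
          refine Finset.sum_congr rfl fun p hp => ?_
          rw [hinv p (Finset.mem_filter.1 hp).2]
      _ = ∑ b ∈ (Finset.univ.filter (fun p : F × F => p.1 ≠ 0)).image B,
          ((Finset.univ.filter fun p : F × F => p.1 ≠ 0).filter fun p => B p = b).card •
          ‖∑ y, ψ (∑ k, b k * y ^ ((k : ℕ) + 1))‖ ^ (2 * g) :=
          Finset.sum_comp (fun b : Fin g → F => ‖∑ y, ψ (∑ k, b k * y ^ ((k : ℕ) + 1))‖ ^ (2 * g)) B
      _ ≤ ∑ b ∈ (Finset.univ.filter (fun p : F × F => p.1 ≠ 0)).image B,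
          g * ‖∑ y, ψ (∑ k, b k * y ^ ((k : ℕ) + 1))‖ ^ (2 * g) := by
          refine Finset.sum_le_sum fun b _ => ?_
          rw [nsmul_eq_mul]
          gcongr
          exact hfib b
      _ ≤ ∑ b : Fin g → F, g * ‖∑ y, ψ (∑ k, b k * y ^ ((k : ℕ) + 1))‖ ^ (2 * g) :=
          Finset.sum_le_sum_of_subset_of_nonneg (Finset.subset_univ _) fun _ _ _ => by positivity
      _ ≤ _ := by
          rw [← Finset.mul_sum]
          gcongr
          exact sum_norm_expSum_pow_le hψ hg
  have hq2 : 2 ≤ Fintype.card F := Fintype.one_lt_card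
  have hq : (Fintype.card F : ℝ) / 2 * Fintype.card F ≤ ((Fintype.card F - 1) * Fintype.card F : ℕ) := by
    push_cast [Nat.cast_sub (show 1 ≤ Fintype.card F by omega)]
    have : (2 : ℝ) ≤ Fintype.card F := by exact_mod_cast hq2
    gcongr
    linarith
  have hq0 : (0 : ℝ) < Fintype.card F := by exact_mod_cast (show 0 < Fintype.card F by omega)
  have hS0 : 0 ≤ S ^ (2 * g) := by positivity
  have fin := (mul_le_mul_of_nonneg_right hq hS0).trans main
  have e : (Fintype.card F : ℝ) ^ (2 * g) = (Fintype.card F : ℝ) ^ (2 * g - 2) * Fintype.card F ^ 2 := by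
    rw [← pow_add]; congr 1; omega
  rw [e] at fin
  have h0 : (0:ℝ) < Fintype.card F ^ 2 / 2 := by positivity
  refine le_of_mul_le_mul_left ?_ h0
  calc _ = (Fintype.card F : ℝ) / 2 * Fintype.card F * S ^ (2 * g) := by ring
    _ ≤ _ := fin
    _ = _ := by rw [pow_succ (g : ℝ) g]; ring

/-- The additive character `x ↦ exp (2 * π * i * x / q)` on the integers. -/
def addExp (q : ℕ) (x : ℤ) : ℂ := Complex.exp (2 * Real.pi * Complex.I * x / q)

theorem addExp_eq_stdAddChar (q : ℕ) [NeZero q] (x : ℤ) :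
    addExp q x = ZMod.stdAddChar (x : ZMod q) := (ZMod.stdAddChar_coe x).symm

theorem addExp_add (q : ℕ) (x y : ℤ) : addExp q (x + y) = addExp q x * addExp q y := by
  rw [addExp, addExp, addExp, ← Complex.exp_add]
  congr 1
  push_cast
  ring

theorem norm_addExp (q : ℕ) (x : ℤ) : ‖addExp q x‖ = 1 := by
  rw [addExp, show (2 * Real.pi * Complex.I * x / q : ℂ) = ((2 * Real.pi * x / q : ℝ) : ℂ) * Complex.I by
    push_cast; ring, Complex.norm_exp_ofReal_mul_I]

theorem addExp_congr {q : ℕ} [NeZero q] {x y : ℤ} (h : (q : ℤ) ∣ x - y) : addExp q x = addExp q y := by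
  rw [addExp_eq_stdAddChar, addExp_eq_stdAddChar]
  congr 1
  rw [← sub_eq_zero, ← Int.cast_sub]
  exact (ZMod.intCast_zmod_eq_zero_iff_dvd _ _).2 h

theorem addExp_mul_left {q m : ℕ} (hm : m ≠ 0) (x : ℤ) : addExp (m * q) (m * x) = addExp q x := by
  have : (m : ℂ) ≠ 0 := by exact_mod_cast hm
  rw [addExp, addExp]
  congr 1
  push_cast
  rw [mul_left_comm, mul_div_mul_left _ _ this]

theorem sum_range_eq_sum_zmod {M : Type*} [AddCommMonoid M] (q : ℕ) [NeZero q] (f : ZMod q → M) :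
    ∑ y ∈ Finset.range q, f y = ∑ x : ZMod q, f x := by
  refine Finset.sum_nbij' (fun y => (y : ZMod q)) ZMod.val ?_ ?_ ?_ ?_ ?_
  · simp
  · intro x _; exact Finset.mem_range.2 (ZMod.val_lt x)
  · intro y hy; exact ZMod.val_cast_of_lt (Finset.mem_range.1 hy)
  · intro x _; exact ZMod.natCast_zmod_val x
  · simp

theorem sum_range_mul_eq {M : Type*} [AddCommMonoid M] (a b : ℕ) (f : ℕ → M) :
    ∑ y ∈ Finset.range (a * b), f y =
      ∑ x ∈ Finset.range a, ∑ z ∈ Finset.range b, f (x + a * z) := by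
  induction b with
  | zero => simp
  | succ b ih =>
    simp only [Finset.sum_range_succ, Finset.sum_add_distrib]
    rw [Nat.mul_succ, Finset.sum_range_add, ih]
    simp only [add_comm]

/-- The complete exponential sum of an integer polynomial modulo `q`. -/
def polyExpSum (q : ℕ) (P : ℤ[X]) : ℂ := ∑ y ∈ Finset.range q, addExp q (P.eval (y : ℤ))

theorem polyExpSum_eq_sum_zmod (q : ℕ) [NeZero q] (P : ℤ[X]) :
    polyExpSum q P = ∑ x : ZMod q, ZMod.stdAddChar ((P.map (Int.castRingHom (ZMod q))).eval x) := by
  rw [polyExpSum, ← sum_range_eq_sum_zmod]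
  refine Finset.sum_congr rfl fun y _ => ?_
  rw [addExp_eq_stdAddChar]
  congr 1
  have := Polynomial.eval_intCast_map (Int.castRingHom (ZMod q)) P (y : ℤ)
  simpa using this.symm

theorem norm_polyExpSum_le (q : ℕ) (P : ℤ[X]) : ‖polyExpSum q P‖ ≤ q := by
  refine (norm_sum_le _ _).trans ?_
  simp [norm_addExp]

/-- An exponential sum whose phase is constant up to a multiple of `ℓ ^ σ` reduces to a
complete sum of smaller modulus. -/
theorem norm_sum_addExp_scaled {ℓ : ℕ} (hℓ : 0 < ℓ) {E σ m : ℕ} (hσ : σ ≤ E) (hm : E ≤ m + σ)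
    (p : ℤ) (Q : ℤ[X]) (f : ℕ → ℤ)
    (hf : ∀ y, (ℓ ^ E : ℤ) ∣ f y - (p + ℓ ^ σ * Q.eval (y : ℤ))) :
    ‖∑ y ∈ Finset.range (ℓ ^ m), addExp (ℓ ^ E) (f y)‖ =
      ℓ ^ (m + σ - E) * ‖polyExpSum (ℓ ^ (E - σ)) Q‖ := by
  have : NeZero (ℓ ^ E) := ⟨by positivity⟩
  have : NeZero (ℓ ^ (E - σ)) := ⟨by positivity⟩
  have h1 : ∀ y : ℕ, addExp (ℓ ^ E) (f y) = addExp (ℓ ^ E) p * addExp (ℓ ^ (E - σ)) (Q.eval (y : ℤ)) := by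
    intro y
    rw [addExp_congr (y := p + ℓ ^ σ * Q.eval (y : ℤ)) (by exact_mod_cast hf y), addExp_add]
    congr 1
    have := addExp_mul_left (q := ℓ ^ (E - σ)) (m := ℓ ^ σ) (by positivity) (Q.eval (y : ℤ))
    rw [← this, ← pow_add, Nat.add_sub_cancel' hσ]
    push_cast
    rfl
  simp only [h1]
  rw [← Finset.mul_sum, norm_mul, norm_addExp, one_mul,
    show m = (E - σ) + (m + σ - E) by omega, pow_add, sum_range_mul_eq]
  have h2 : ∀ x z : ℕ, addExp (ℓ ^ (E - σ)) (Q.eval ((x + ℓ ^ (E - σ) * z : ℕ) : ℤ)) =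
      addExp (ℓ ^ (E - σ)) (Q.eval (x : ℤ)) := by
    intro x z
    apply addExp_congr
    refine dvd_trans ?_ (Polynomial.sub_dvd_eval_sub _ _ Q)
    exact ⟨z, by push_cast; ring⟩
  simp only [h2, Finset.sum_const, Finset.card_range, nsmul_eq_mul]
  rw [← Finset.mul_sum, norm_mul]
  congr 2
  · simp
    congr 1
    omega

/-- Complete sums of permutation polynomials vanish. -/
theorem polyExpSum_eq_zero_of_isCoprime {ℓ m : ℕ} (hℓ : ℓ.Prime) (hm : 0 < m) (u : ℤ)
    (hu : IsCoprime u (ℓ : ℤ)) (H : ℤ[X]) :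
    polyExpSum (ℓ ^ m) (C u * X + C (ℓ : ℤ) * H) = 0 := by
  have : NeZero (ℓ ^ m) := ⟨pow_ne_zero _ hℓ.ne_zero⟩
  have : Fact (1 < ℓ ^ m) := ⟨Nat.one_lt_pow hm.ne' hℓ.one_lt⟩
  rw [polyExpSum_eq_sum_zmod]
  set P := (C u * X + C (ℓ : ℤ) * H).map (Int.castRingHom (ZMod (ℓ ^ m))) with hP
  have hinj : Function.Injective fun x : ZMod (ℓ ^ m) => P.eval x := by
    intro x y hxy
    obtain ⟨t, ht⟩ := Polynomial.sub_dvd_eval_sub x y (H.map (Int.castRingHom (ZMod (ℓ ^ m))))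
    have e : (x - y) * ((u : ZMod (ℓ ^ m)) + (ℓ : ZMod (ℓ ^ m)) * t) = 0 := by
      have : P.eval x - P.eval y = 0 := sub_eq_zero.2 hxy
      rw [← this, hP]
      simp only [Polynomial.map_add, Polynomial.map_mul, map_C, map_X, eval_add, eval_mul, eval_C, eval_X]
      simp only [eq_intCast, Int.cast_natCast]
      linear_combination (-(ℓ : ZMod (ℓ ^ m))) * ht
    have hunit : IsUnit ((u : ZMod (ℓ ^ m)) + (ℓ : ZMod (ℓ ^ m)) * t) := by
      have h1 : IsUnit (u : ZMod (ℓ ^ m)) := by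
        obtain ⟨a, b, hab⟩ := hu.pow_right (n := m)
        refine IsUnit.of_mul_eq_one (a : ZMod (ℓ ^ m)) ?_
        have := congrArg (Int.cast : ℤ → ZMod (ℓ ^ m)) hab
        have h0 : ((ℓ : ZMod (ℓ ^ m)) ^ m) = 0 := by exact_mod_cast ZMod.natCast_self (ℓ ^ m)
        push_cast at this
        rw [h0, mul_zero, add_zero] at this
        rw [mul_comm]; exact this
      have h2 : IsNilpotent ((ℓ : ZMod (ℓ ^ m)) * t) := by
        refine ⟨m, ?_⟩
        have h0 : ((ℓ : ZMod (ℓ ^ m)) ^ m) = 0 := by exact_mod_cast ZMod.natCast_self (ℓ ^ m)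
        rw [mul_pow, h0, zero_mul]
      exact h2.isUnit_add_left_of_commute h1 (Commute.all _ _)
    exact sub_eq_zero.1 ((hunit.mul_left_eq_zero).1 e)
  have hbij := Finite.injective_iff_bijective.1 hinj
  rw [Fintype.sum_bijective _ hbij _ (fun x => ZMod.stdAddChar x) fun _ => rfl]
  apply AddChar.sum_eq_zero_of_ne_one
  have := (ZMod.isPrimitive_stdAddChar (ℓ ^ m)) (one_ne_zero)
  rwa [AddChar.mulShift_one] at this

/-- Extraction of the content at `ℓ` of an integer polynomial. -/
theorem exists_eq_pow_mul_map_ne_zero {ℓ : ℕ} (hℓ : ℓ.Prime) (P : ℤ[X])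
    {k₀ k₁ s : ℕ} (hk₀ : ¬ (ℓ : ℤ) ^ (s + 1) ∣ P.coeff k₀)
    (hk₁ : ∀ k, k₁ < k → (ℓ : ℤ) ^ (s + 1) ∣ P.coeff k) :
    ∃ (σ : ℕ) (Q : ℤ[X]), σ ≤ s ∧ P = C ((ℓ : ℤ) ^ σ) * Q ∧
      Q.map (Int.castRingHom (ZMod ℓ)) ≠ 0 ∧
      (Q.map (Int.castRingHom (ZMod ℓ))).natDegree ≤ k₁ := by
  have hex : ∃ n, ¬ C ((ℓ : ℤ) ^ (n + 1)) ∣ P := ⟨s, fun h => hk₀ (by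
    rw [C_dvd_iff_dvd_coeff] at h; exact h k₀)⟩
  set σ := Nat.find hex with hσ
  have hσs : σ ≤ s := Nat.find_min' hex fun h => hk₀ (by
    rw [C_dvd_iff_dvd_coeff] at h; exact h k₀)
  have hdvd : C ((ℓ : ℤ) ^ σ) ∣ P := by
    rcases Nat.eq_zero_or_pos σ with h | h
    · rw [h]; simp
    · have := Nat.find_min hex (m := σ - 1) (by omega)
      rw [not_not] at this
      rwa [Nat.sub_add_cancel h] at this
  obtain ⟨Q, hQ⟩ := hdvd
  have hℓ0 : (ℓ : ℤ) ≠ 0 := by exact_mod_cast hℓ.ne_zero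
  have hcoeff : ∀ k, P.coeff k = (ℓ : ℤ) ^ σ * Q.coeff k := fun k => by rw [hQ, coeff_C_mul]
  refine ⟨σ, Q, hσs, hQ, fun h => ?_, ?_⟩
  · apply Nat.find_spec hex
    rw [C_dvd_iff_dvd_coeff]
    intro k
    rw [hcoeff, pow_succ]
    refine mul_dvd_mul_left _ ?_
    rw [← ZMod.intCast_zmod_eq_zero_iff_dvd, ← eq_intCast (Int.castRingHom (ZMod ℓ)), ← coeff_map, h,
      coeff_zero]
  · rw [natDegree_le_iff_coeff_eq_zero]
    intro k hk
    rw [coeff_map, eq_intCast, ZMod.intCast_zmod_eq_zero_iff_dvd]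
    have h1 := (pow_dvd_pow (ℓ : ℤ) (Nat.succ_le_succ hσs)).trans (hk₁ k hk)
    rw [hcoeff, pow_succ] at h1
    exact (mul_dvd_mul_iff_left (pow_ne_zero _ hℓ0)).1 h1

/-- Extraction of the content at `ℓ` of a polynomial without constant term. -/
theorem exists_eq_pow_mul_of_not_dvd {ℓ : ℕ} (hℓ : ℓ.Prime) (P : ℤ[X]) (h0 : P.coeff 0 = 0)
    {k₀ k₁ s : ℕ} (hk₀ : ¬ (ℓ : ℤ) ^ (s + 1) ∣ P.coeff k₀)
    (hk₁ : ∀ k, k₁ < k → (ℓ : ℤ) ^ (s + 1) ∣ P.coeff k) :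
    ∃ (σ : ℕ) (Q : ℤ[X]), σ ≤ s ∧ P = C ((ℓ : ℤ) ^ σ) * Q ∧
      1 ≤ (Q.map (Int.castRingHom (ZMod ℓ))).natDegree ∧
      (Q.map (Int.castRingHom (ZMod ℓ))).natDegree ≤ k₁ := by
  obtain ⟨σ, Q, hσ, hQ, hQ0, hQk⟩ := exists_eq_pow_mul_map_ne_zero hℓ P hk₀ hk₁
  refine ⟨σ, Q, hσ, hQ, ?_, hQk⟩
  by_contra h
  apply hQ0
  rw [eq_C_of_natDegree_eq_zero (by omega : (Q.map (Int.castRingHom (ZMod ℓ))).natDegree = 0),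
    coeff_map]
  have hℓ0 : (ℓ : ℤ) ≠ 0 := by exact_mod_cast hℓ.ne_zero
  rw [hQ, coeff_C_mul] at h0
  rw [(mul_eq_zero.1 h0).resolve_left (pow_ne_zero _ hℓ0), map_zero, map_zero]

theorem intCast_eq_zero_iff_dvd (ℓ : ℕ) (x : ℤ) : (x : ZMod ℓ) = 0 ↔ (ℓ : ℤ) ∣ x :=
  ZMod.intCast_zmod_eq_zero_iff_dvd x ℓ

theorem polyExpSum_eq_zero_of_natDegree_eq_one {ℓ m : ℕ} (hℓ : ℓ.Prime) (hm : 0 < m) (Q : ℤ[X])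
    (hQ : (Q.map (Int.castRingHom (ZMod ℓ))).natDegree = 1) : polyExpSum (ℓ ^ m) Q = 0 := by
  have hu : ¬ (ℓ : ℤ) ∣ Q.coeff 1 := by
    rw [← intCast_eq_zero_iff_dvd, ← eq_intCast (Int.castRingHom (ZMod ℓ)), ← coeff_map, ← hQ]
    change leadingCoeff _ ≠ 0
    rw [Ne, leadingCoeff_eq_zero]
    intro h
    rw [h] at hQ
    simp at hQ
  have hH : C (ℓ : ℤ) ∣ Q - C (Q.coeff 1) * X - C (Q.coeff 0) := by
    rw [C_dvd_iff_dvd_coeff]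
    intro k
    match k with
    | 0 => simp
    | 1 => simp [coeff_C, -eq_intCast]
    | k + 2 =>
      have h1 : (Q.map (Int.castRingHom (ZMod ℓ))).coeff (k + 2) = 0 :=
        coeff_eq_zero_of_natDegree_lt (by omega)
      rw [coeff_map, eq_intCast, intCast_eq_zero_iff_dvd] at h1
      simpa [coeff_C, coeff_X, -eq_intCast, coeff_C_mul] using h1
  obtain ⟨H, hH⟩ := hH
  have e : ∀ y : ℕ, Q.eval (y : ℤ) = Q.coeff 0 + (ℓ : ℤ) ^ 0 * (C (Q.coeff 1) * X + C (ℓ : ℤ) * H).eval (y : ℤ) := by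
    intro y
    rw [← hH]
    simp only [eval_add, eval_sub, eval_mul, eval_C, eval_X]
    ring
  have := norm_sum_addExp_scaled hℓ.pos (E := m) (σ := 0) (m := m) (Nat.zero_le _) le_rfl (Q.coeff 0)
    (C (Q.coeff 1) * X + C (ℓ : ℤ) * H) (fun y => Q.eval (y : ℤ)) (fun y => by rw [e]; simp)
  rw [Nat.sub_zero, polyExpSum_eq_zero_of_isCoprime hℓ hm, norm_zero, mul_zero, norm_eq_zero] at this
  · exact this
  · exact ((Nat.prime_iff_prime_int.1 hℓ).coprime_iff_not_dvd.2 hu).symm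

theorem sum_rootMultiplicity_le {F : Type*} [Field F] [Fintype F] (R : F[X]) :
    ∑ a, R.rootMultiplicity a ≤ R.natDegree := by
  simp only [← count_roots]
  rw [Multiset.sum_count_eq_card fun a _ => Finset.mem_univ a]
  exact card_roots' R

theorem coeff_taylor_rootMultiplicity_ne_zero {F : Type*} [Field F] {R : F[X]} (hR : R ≠ 0) (a : F) :
    (taylor a R).coeff (R.rootMultiplicity a) ≠ 0 := by
  rw [rootMultiplicity_eq_natTrailingDegree, ← taylor_apply]
  change trailingCoeff _ ≠ 0
  rw [Ne, trailingCoeff_eq_zero]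
  intro h
  exact hR (taylor_injective a (by rw [h, map_zero]))

theorem coeff_taylor_derivative {R : Type*} [CommRing R] (f : R[X]) (a : R) (k : ℕ) :
    (taylor a (derivative f)).coeff k = (taylor a f).coeff (k + 1) * (k + 1) := by
  rw [← coeff_derivative, taylor_apply, taylor_apply, derivative_comp]
  simp

theorem map_taylor_intCast (ℓ : ℕ) (a : ℤ) (f : ℤ[X]) (k : ℕ) :
    (((taylor a f).coeff k : ℤ) : ZMod ℓ) =
      (taylor (a : ZMod ℓ) (f.map (Int.castRingHom (ZMod ℓ)))).coeff k := by
  rw [← eq_intCast (Int.castRingHom (ZMod ℓ)), ← coeff_map, taylor_apply, taylor_apply, Polynomial.map_comp]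
  simp

theorem coeff_comp_add_mul {R : Type*} [CommRing R] (f : R[X]) (a b : R) (k : ℕ) :
    (f.comp (C a + C b * X)).coeff k = (taylor a f).coeff k * b ^ k := by
  rw [← comp_C_mul_X_coeff, taylor_apply, comp_assoc]
  simp [add_comm]

theorem polyExpSum_pow_split (ℓ E : ℕ) (P : ℤ[X]) :
    polyExpSum (ℓ ^ (E + 1)) P = ∑ a ∈ Finset.range ℓ, ∑ y ∈ Finset.range (ℓ ^ E),
      addExp (ℓ ^ (E + 1)) (P.eval ((a : ℤ) + ℓ * y)) := by
  rw [polyExpSum, pow_succ', sum_range_mul_eq]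
  simp

/-- Bound of Hua type for complete exponential sums modulo prime powers, with the degree
measured modulo the prime. -/
theorem norm_polyExpSum_prime_pow_le {ℓ D : ℕ} (hℓ : ℓ.Prime) (hD : D < ℓ) (E : ℕ) :
    ∀ (Λ : ℤ[X]) (g : ℕ), (Λ.map (Int.castRingHom (ZMod ℓ))).natDegree = g → 1 ≤ g → g ≤ D →
    ‖polyExpSum (ℓ ^ E) Λ‖ ≤ 2 * (D : ℝ) ^ (D + 1) * (max 1 ((g : ℝ) - 1)) *
      (ℓ : ℝ) ^ ((E : ℝ) * (1 - 1 / g)) := by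
  have : Fact ℓ.Prime := ⟨hℓ⟩
  induction E using Nat.strong_induction_on with
  | _ E ih =>
  intro Λ g hg hg1 hgD
  have hℓ1 : (1 : ℝ) ≤ ℓ := by exact_mod_cast hℓ.one_le
  have hℓ0 : (0 : ℝ) < ℓ := by linarith
  have hD1 : (1 : ℝ) ≤ D := by exact_mod_cast hg1.trans hgD
  have hC1 : (1 : ℝ) ≤ 2 * (D : ℝ) ^ (D + 1) := by
    have := one_le_pow₀ hD1 (n := D + 1)
    linarith
  have hg1' : (1 : ℝ) ≤ g := by exact_mod_cast hg1
  have hexp : (0 : ℝ) ≤ 1 - 1 / g := by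
    rw [sub_nonneg, div_le_one (by linarith)]; exact hg1'
  set K := 2 * (D : ℝ) ^ (D + 1) with hK
  rcases Nat.eq_zero_or_pos E with rfl | hE
  · refine (norm_polyExpSum_le _ _).trans ?_
    simp only [pow_zero, Nat.cast_one, Nat.cast_zero, zero_mul, Real.rpow_zero, mul_one]
    exact one_le_mul_of_one_le_of_one_le hC1 (le_max_left _ _)
  rcases Nat.lt_or_ge 1 g with hg2 | hg2
  swap
  · rw [polyExpSum_eq_zero_of_natDegree_eq_one hℓ hE Λ (by omega), norm_zero]
    positivity
  have hgk : ∀ k : ℕ, 1 ≤ k → k ≤ g → ((k : ℕ) : ZMod ℓ) ≠ 0 := by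
    intro k hk1 hk2 h
    rw [ZMod.natCast_eq_zero_iff] at h
    have := Nat.le_of_dvd (by omega) h
    omega
  obtain ⟨E, rfl⟩ : ∃ E', E = E' + 1 := ⟨E - 1, by omega⟩
  rcases Nat.eq_zero_or_pos E with rfl | hE0
  · have h1 := norm_expSum_pow_le (ZMod.isPrimitive_stdAddChar ℓ) hg2 hgk _ hg
    rw [zero_add, pow_one, polyExpSum_eq_sum_zmod]
    rw [ZMod.card] at h1
    have hgD' : (g : ℝ) ≤ D := by exact_mod_cast hgD
    have h2 : 2 * (g : ℝ) ^ (g + 1) ≤ K := by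
      rw [hK]
      gcongr
      calc (g : ℝ) ^ (g + 1) ≤ (D : ℝ) ^ (g + 1) := by gcongr
        _ ≤ _ := pow_le_pow_right₀ hD1 (by omega)
    have h3 : ‖∑ x : ZMod ℓ, ZMod.stdAddChar ((Λ.map (Int.castRingHom (ZMod ℓ))).eval x)‖ ≤
        K * (ℓ : ℝ) ^ (1 - 1 / (g : ℝ)) := by
      refine le_of_pow_le_pow_left₀ (n := 2 * g) (by omega) (by positivity) ?_
      refine h1.trans ?_
      rw [mul_pow, ← Real.rpow_natCast ((ℓ : ℝ) ^ (1 - 1 / (g : ℝ))), ← Real.rpow_mul hℓ0.le,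
        ← Real.rpow_natCast (ℓ : ℝ) (2 * g - 2)]
      have e : (1 - 1 / (g : ℝ)) * ((2 * g : ℕ) : ℝ) = ((2 * g - 2 : ℕ) : ℝ) := by
        rw [Nat.cast_sub (by omega)]
        push_cast
        field_simp
      rw [e]
      gcongr
      exact h2.trans (le_self_pow₀ hC1 (by omega))
    refine h3.trans ?_
    simp only [Nat.cast_one, one_mul]
    gcongr
    exact le_mul_of_one_le_right (by linarith) (le_max_left _ _)
  set Λb := Λ.map (Int.castRingHom (ZMod ℓ)) with hΛb
  set R := derivative Λb with hR
  have hRd : R.natDegree ≤ g - 1 := by rw [← hg]; exact natDegree_derivative_le _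
  have hR0 : R ≠ 0 := by
    intro h
    have : R.coeff (g - 1) = 0 := by rw [h, coeff_zero]
    rw [hR, coeff_derivative, Nat.sub_add_cancel hg1] at this
    rcases mul_eq_zero.1 this with h | h
    · rw [← hg] at h
      have : Λb = 0 := leadingCoeff_eq_zero.1 h
      rw [this] at hg
      simp at hg
      omega
    · apply hgk g hg1 le_rfl
      rw [← h, ← Nat.cast_succ]
      congr 1
      omega
  have hpiece : ∀ a : ℕ, ‖∑ y ∈ Finset.range (ℓ ^ E),
      addExp (ℓ ^ (E + 1)) (Λ.eval ((a : ℤ) + ℓ * y))‖ ≤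
      K * R.rootMultiplicity (a : ZMod ℓ) * (ℓ : ℝ) ^ (((E + 1 : ℕ) : ℝ) * (1 - 1 / g)) := by
    intro a
    set μ := R.rootMultiplicity (a : ZMod ℓ) with hμ
    have hμg : μ + 1 ≤ g := by
      have := (Finset.single_le_sum (f := fun a => R.rootMultiplicity a) (fun _ _ => Nat.zero_le _)
        (Finset.mem_univ (a : ZMod ℓ))).trans (sum_rootMultiplicity_le R)
      simp only [← hμ] at this
      omega
    set P := Λ.comp (C (a : ℤ) + C (ℓ : ℤ) * X) - C (Λ.eval (a : ℤ)) with hP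
    have hP0 : P.coeff 0 = 0 := by
      rw [hP, coeff_sub, coeff_comp_add_mul]
      simp
    have hPk : ∀ k, 1 ≤ k → P.coeff k = (taylor (a : ℤ) Λ).coeff k * (ℓ : ℤ) ^ k := by
      intro k hk
      rw [hP, coeff_sub, coeff_comp_add_mul, coeff_C, if_neg (by omega), sub_zero]
    have hℓZ : (ℓ : ℤ) ≠ 0 := by exact_mod_cast hℓ.ne_zero
    have hμ1 : ¬ (ℓ : ℤ) ^ (μ + 1 + 1) ∣ P.coeff (μ + 1) := by
      rw [hPk _ (by omega), mul_comm, pow_succ]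
      rw [mul_dvd_mul_iff_left (pow_ne_zero _ hℓZ), ← intCast_eq_zero_iff_dvd, map_taylor_intCast]
      intro h
      apply coeff_taylor_rootMultiplicity_ne_zero hR0 (a : ZMod ℓ)
      rw [hR, coeff_taylor_derivative, ← hμ]
      push_cast at h
      rw [h, zero_mul]
    obtain ⟨σ, Q, hσ, hPQ, hQ1, hQμ⟩ := exists_eq_pow_mul_of_not_dvd hℓ P hP0 (k₁ := μ + 1) hμ1
      (fun k hk => by rw [hPk k (by omega)]; exact dvd_mul_of_dvd_right (pow_dvd_pow _ hk) _)
    have hσ1 : 1 ≤ σ := by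
      by_contra hσ0
      rw [show σ = 0 by omega, pow_zero, map_one, one_mul] at hPQ
      have : Q.map (Int.castRingHom (ZMod ℓ)) = 0 := by
        ext k
        rw [coeff_map, eq_intCast, coeff_zero, intCast_eq_zero_iff_dvd, ← hPQ]
        rcases Nat.eq_zero_or_pos k with rfl | hk
        · rw [hP0]; exact dvd_zero _
        · rw [hPk k hk]; exact dvd_mul_of_dvd_right (dvd_pow_self _ (by omega)) _
      rw [this] at hQ1
      simp at hQ1
    have hev : ∀ y : ℕ, Λ.eval ((a : ℤ) + ℓ * y) = Λ.eval (a : ℤ) + (ℓ : ℤ) ^ σ * Q.eval (y : ℤ) := by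
      intro y
      have := congrArg (eval (y : ℤ)) hPQ
      rw [hP] at this
      simp only [eval_sub, eval_comp, eval_add, eval_C, eval_mul, eval_X] at this
      rw [← this]; ring
    have hσg : (σ : ℝ) ≤ g := by exact_mod_cast hσ.trans hμg
    have hdiv : (σ : ℝ) / g ≤ 1 := (div_le_one (by linarith)).2 hσg
    rcases Nat.lt_or_ge σ (E + 1) with hlt | hge
    · rw [norm_sum_addExp_scaled hℓ.pos hlt.le (by omega) (Λ.eval (a : ℤ)) Q
        (fun y => Λ.eval ((a : ℤ) + ℓ * y)) (fun y => by rw [hev]; simp)]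
      rw [show E + σ - (E + 1) = σ - 1 by omega]
      rcases Nat.lt_or_ge 1 (Q.map (Int.castRingHom (ZMod ℓ))).natDegree with h1 | h1
      · have hI := ih (E + 1 - σ) (by omega) Q _ rfl hQ1 (hQμ.trans (hμg.trans hgD))
        set g' := (Q.map (Int.castRingHom (ZMod ℓ))).natDegree
        have hg'2 : (2 : ℝ) ≤ g' := by exact_mod_cast h1
        have hg'μ : (g' : ℝ) ≤ μ + 1 := by exact_mod_cast hQμ
        have hg'g : (g' : ℝ) ≤ g := by exact_mod_cast hQμ.trans hμg
        rw [max_eq_right (by linarith)] at hI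
        calc (ℓ : ℝ) ^ (σ - 1) * ‖polyExpSum (ℓ ^ (E + 1 - σ)) Q‖
            ≤ (ℓ : ℝ) ^ (σ - 1) * (K * (g' - 1) * (ℓ : ℝ) ^ (((E + 1 - σ : ℕ) : ℝ) * (1 - 1 / g'))) := by
              gcongr
          _ = K * (g' - 1) * ((ℓ : ℝ) ^ (((σ - 1 : ℕ) : ℝ) + ((E + 1 - σ : ℕ) : ℝ) * (1 - 1 / g'))) := by
              rw [Real.rpow_add hℓ0, Real.rpow_natCast]; ring
          _ ≤ K * μ * (ℓ : ℝ) ^ (((E + 1 : ℕ) : ℝ) * (1 - 1 / g)) := by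
              have hx : ((σ - 1 : ℕ) : ℝ) + ((E + 1 - σ : ℕ) : ℝ) * (1 - 1 / g') ≤
                  ((E + 1 : ℕ) : ℝ) * (1 - 1 / g) := by
                rw [Nat.cast_sub hσ1, Nat.cast_sub hlt.le]
                have h5 : (1 : ℝ) / g ≤ 1 / g' := by
                  apply one_div_le_one_div_of_le <;> linarith
                have h6 : (0 : ℝ) ≤ ((E + 1 : ℕ) : ℝ) - σ := by
                  rw [sub_nonneg]; exact_mod_cast hlt.le
                have h7 : (((E + 1 : ℕ) : ℝ) - σ) * (1 - 1 / g') ≤ (((E + 1 : ℕ) : ℝ) - σ) * (1 - 1 / g) := by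
                  gcongr
                have h8 : (σ : ℝ) / g = σ * (1 / g) := by ring
                rw [h8] at hdiv
                push_cast at h7 ⊢
                nlinarith
              gcongr
              linarith
      · rw [polyExpSum_eq_zero_of_natDegree_eq_one hℓ (by omega) Q (by omega), norm_zero, mul_zero]
        positivity
    · have hμ1 : (1 : ℝ) ≤ μ := by
        have : 1 ≤ μ := by omega
        exact_mod_cast this
      have h1 : ‖∑ y ∈ Finset.range (ℓ ^ E), addExp (ℓ ^ (E + 1)) (Λ.eval ((a : ℤ) + ℓ * y))‖ ≤
          (ℓ : ℝ) ^ (E : ℝ) := by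
        refine (norm_sum_le _ _).trans ?_
        simp [norm_addExp]
      refine h1.trans ?_
      have hx : (E : ℝ) ≤ ((E + 1 : ℕ) : ℝ) * (1 - 1 / g) := by
        have : ((E + 1 : ℕ) : ℝ) ≤ σ := by exact_mod_cast hge
        have h9 : ((E + 1 : ℕ) : ℝ) / g ≤ 1 := le_trans (by gcongr) hdiv
        rw [mul_sub, mul_one, mul_one_div]
        push_cast at h9 ⊢
        linarith
      calc (ℓ : ℝ) ^ (E : ℝ) ≤ 1 * (ℓ : ℝ) ^ (((E + 1 : ℕ) : ℝ) * (1 - 1 / g)) := by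
            rw [one_mul]
            exact Real.rpow_le_rpow_of_exponent_le hℓ1 hx
        _ ≤ _ := by
            gcongr
            exact one_le_mul_of_one_le_of_one_le hC1 hμ1
  rw [polyExpSum_pow_split]
  refine (norm_sum_le _ _).trans ((Finset.sum_le_sum fun a _ => hpiece a).trans ?_)
  rw [← Finset.sum_mul, ← Finset.mul_sum]
  gcongr
  rw [← Nat.cast_sum, sum_range_eq_sum_zmod ℓ (fun a => R.rootMultiplicity a)]
  refine le_trans ?_ (le_max_right _ _)
  rw [le_sub_iff_add_le]
  have := (sum_rootMultiplicity_le R).trans hRd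
  exact_mod_cast (show _ + 1 ≤ g by omega)

/-- The numerator of the logarithmic derivative of `∏ i, F i ^ c i`. -/
def logDerivNum {K : ℕ} (F : Fin K → ℤ[X]) (c : Fin K → ℤ) : ℤ[X] :=
  ∑ i, C (c i) * (derivative (F i) * ∏ j ∈ Finset.univ.erase i, F j)

theorem natDegree_logDerivNum_le {K : ℕ} {F : Fin K → ℤ[X]} (hF : ∀ i, 0 < (F i).natDegree)
    (c : Fin K → ℤ) : (logDerivNum F c).natDegree ≤ (∑ i, (F i).natDegree) - 1 := by
  refine natDegree_sum_le_of_forall_le _ _ fun i _ => ?_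
  refine (natDegree_C_mul_le _ _).trans (natDegree_mul_le.trans ?_)
  have h1 := natDegree_derivative_le (F i)
  have h2 := natDegree_prod_le (Finset.univ.erase i) F
  have h3 := Finset.add_sum_erase Finset.univ (fun i => (F i).natDegree) (Finset.mem_univ i)
  have h4 := hF i
  omega

theorem natDegree_eq_of_derivative_mul_eq {P B : ℤ[X]} (hP : P ≠ 0) (hB : B ≠ 0)
    (h : derivative P * B = P * derivative B) : P.natDegree = B.natDegree := by
  rcases Nat.eq_zero_or_pos B.natDegree with hb | hb
  · rw [hb]
    rw [eq_C_of_natDegree_eq_zero hb, derivative_C, mul_zero, ← eq_C_of_natDegree_eq_zero hb] at h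
    exact derivative_eq_zero.1 ((mul_eq_zero.1 h).resolve_right hB)
  rcases Nat.eq_zero_or_pos P.natDegree with hp | hp
  · rw [hp]
    rw [eq_C_of_natDegree_eq_zero hp, derivative_C, zero_mul, ← eq_C_of_natDegree_eq_zero hp] at h
    exact (derivative_eq_zero.1 ((mul_eq_zero.1 h.symm).resolve_left hP)).symm
  have h1 := congrArg (fun Q => coeff Q (P.natDegree - 1 + B.natDegree)) h
  rw [coeff_mul_add_eq_of_natDegree_le (natDegree_derivative_le P) le_rfl,
    show P.natDegree - 1 + B.natDegree = P.natDegree + (B.natDegree - 1) by omega,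
    coeff_mul_add_eq_of_natDegree_le le_rfl (natDegree_derivative_le B), coeff_derivative,
    coeff_derivative, Nat.sub_add_cancel hp, Nat.sub_add_cancel hb] at h1
  have hl : P.coeff P.natDegree * B.coeff B.natDegree ≠ 0 :=
    mul_ne_zero (leadingCoeff_ne_zero.2 hP) (leadingCoeff_ne_zero.2 hB)
  rw [← Nat.cast_succ, ← Nat.cast_succ] at h1
  have h2 : (P.natDegree : ℤ) = B.natDegree := by
    apply mul_left_cancel₀ hl
    have e1 : ((P.natDegree - 1).succ : ℤ) = P.natDegree := by congr 1; omega
    have e2 : ((B.natDegree - 1).succ : ℤ) = B.natDegree := by congr 1; omega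
    rw [e1, e2] at h1
    linear_combination h1
  exact_mod_cast h2

theorem C_mul_eq_C_mul_of_derivative_mul_eq {A B : ℤ[X]} (hA : A ≠ 0) (hB : B ≠ 0)
    (h : derivative A * B = A * derivative B) :
    C B.leadingCoeff * A = C A.leadingCoeff * B := by
  rw [← sub_eq_zero]
  by_contra hP
  set P := C B.leadingCoeff * A - C A.leadingCoeff * B with hPd
  have hd := natDegree_eq_of_derivative_mul_eq hA hB h
  have h1 : derivative P * B = P * derivative B := by
    rw [hPd]
    simp only [derivative_sub, derivative_C_mul]
    linear_combination C B.leadingCoeff * h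
  have h2 := natDegree_eq_of_derivative_mul_eq hP hB h1
  apply hP
  rw [← leadingCoeff_eq_zero, leadingCoeff, h2, hPd, coeff_sub, coeff_C_mul, coeff_C_mul]
  conv_lhs => rw [← hd]
  simp only [coeff_natDegree]
  rw [hd, coeff_natDegree]
  ring

theorem derivative_prod_pow_mul_prod {K : ℕ} (F : Fin K → ℤ[X]) (n : Fin K → ℕ) :
    derivative (∏ i, F i ^ n i) * ∏ i, F i =
      (∏ i, F i ^ n i) * logDerivNum F (fun i => n i) := by
  have aux : ∀ s : Finset (Fin K), derivative (∏ i ∈ s, F i ^ n i) * ∏ i, F i =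
      (∏ i ∈ s, F i ^ n i) * ∑ i ∈ s, C (n i : ℤ) * (derivative (F i) * ∏ j ∈ Finset.univ.erase i, F j) := by
    intro s
    induction s using Finset.induction_on with
    | empty => simp
    | insert a s ha ih =>
      rw [Finset.prod_insert ha, Finset.sum_insert ha, derivative_mul, add_mul, mul_assoc _ _ (∏ i, F i), mul_assoc (F a ^ n a), ih,
        derivative_pow]
      rw [← Finset.mul_prod_erase Finset.univ F (Finset.mem_univ a)]
      rcases Nat.eq_zero_or_pos (n a) with h0 | h0
      · rw [h0]; simp
      · have : F a ^ n a = F a ^ (n a - 1) * F a := by rw [← pow_succ, Nat.sub_add_cancel h0]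
        rw [this]
        simp only [map_natCast]
        ring
  exact aux Finset.univ

theorem logDerivNum_ne_zero {K : ℕ} {F : Fin K → ℤ[X]} (hF : ∀ i, 0 < (F i).natDegree)
    (hind : MultIndep F) {c : Fin K → ℤ} (hc : c ≠ 0) : logDerivNum F c ≠ 0 := by
  intro h0
  apply hind
  refine ⟨c, hc, ?_⟩
  have hF0 : ∀ i, F i ≠ 0 := fun i h => by have := hF i; rw [h] at this; simp at this
  set A := ∏ i, F i ^ (c i).toNat with hA
  set B := ∏ i, F i ^ (-c i).toNat with hB
  have hA0 : A ≠ 0 := Finset.prod_ne_zero_iff.2 fun i _ => pow_ne_zero _ (hF0 i)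
  have hB0 : B ≠ 0 := Finset.prod_ne_zero_iff.2 fun i _ => pow_ne_zero _ (hF0 i)
  have hP0 : ∏ i, F i ≠ 0 := Finset.prod_ne_zero_iff.2 fun i _ => hF0 i
  have e1 := derivative_prod_pow_mul_prod F fun i => (c i).toNat
  have e2 := derivative_prod_pow_mul_prod F fun i => (-c i).toNat
  have e3 : logDerivNum F c = logDerivNum F (fun i => ((c i).toNat : ℤ)) -
      logDerivNum F (fun i => ((-c i).toNat : ℤ)) := by
    rw [logDerivNum, logDerivNum, logDerivNum, ← Finset.sum_sub_distrib]
    refine Finset.sum_congr rfl fun i _ => ?_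
    rw [← sub_mul, ← C_sub, Int.toNat_sub_toNat_neg]
  rw [← hA] at e1
  rw [← hB] at e2
  have e4 : derivative A * B = A * derivative B := by
    apply mul_right_cancel₀ hP0
    rw [h0] at e3
    linear_combination B * e1 - A * e2 - A * B * e3
  have e5 := C_mul_eq_C_mul_of_derivative_mul_eq hA0 hB0 e4
  refine ⟨(A.leadingCoeff : ℚ) / B.leadingCoeff, ?_⟩
  let τ : ℤ[X] →+* RatFunc ℚ := (algebraMap ℚ[X] (RatFunc ℚ)).comp (mapRingHom (Int.castRingHom ℚ))
  have hτ : Function.Injective τ := by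
    refine (FaithfulSMul.algebraMap_injective ℚ[X] (RatFunc ℚ)).comp ?_
    exact map_injective _ (Int.cast_injective)
  have hτ0 : ∀ i, τ (F i) ≠ 0 := fun i h => hF0 i (hτ (by rw [h, map_zero]))
  have e6 : ∏ i, (τ (F i)) ^ (c i) = τ A / τ B := by
    rw [hA, hB, map_prod, map_prod, ← Finset.prod_div_distrib]
    refine Finset.prod_congr rfl fun i _ => ?_
    rw [map_pow, map_pow, ← zpow_natCast, ← zpow_natCast, ← zpow_sub₀ (hτ0 i), Int.toNat_sub_toNat_neg]
  refine Eq.trans e6 ?_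
  have e7 := congrArg τ e5
  rw [map_mul, map_mul] at e7
  have hτC : ∀ a : ℤ, τ (C a) = algebraMap ℚ (RatFunc ℚ) a := by
    intro a
    simp [τ]
  rw [hτC, hτC] at e7
  have hτB : τ B ≠ 0 := fun h => hB0 (hτ (by rw [h, map_zero]))
  have hb : algebraMap ℚ (RatFunc ℚ) (B.leadingCoeff : ℚ) ≠ 0 := by
    rw [Ne, FaithfulSMul.algebraMap_eq_zero_iff]
    exact_mod_cast leadingCoeff_ne_zero.2 hB0
  rw [map_div₀, div_eq_div_iff hτB hb]
  linear_combination e7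

theorem coeff_logDerivNum {K : ℕ} (F : Fin K → ℤ[X]) (c : Fin K → ℤ) (k : ℕ) :
    (logDerivNum F c).coeff k = ∑ i, c i * (derivative (F i) * ∏ j ∈ Finset.univ.erase i, F j).coeff k := by
  simp [logDerivNum, -eq_intCast, coeff_C_mul]

/-- An integral form of the linear independence of the logarithmic derivatives of a
multiplicatively independent family. -/
theorem exists_dvd_mul_of_dvd_coeff_logDerivNum {K : ℕ} {F : Fin K → ℤ[X]}
    (hF : ∀ i, 0 < (F i).natDegree) (hind : MultIndep F) :
    ∃ Δ : ℕ, Δ ≠ 0 ∧ ∀ (c : Fin K → ℤ) (m : ℤ), (∀ k, m ∣ (logDerivNum F c).coeff k) →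
      ∀ j, m ∣ Δ * c j := by
  set n := (∑ i, (F i).natDegree) - 1 + 1 with hn
  let a : Fin n → Fin K → ℤ := fun k i => (derivative (F i) * ∏ j ∈ Finset.univ.erase i, F j).coeff k
  let f : (Fin K → ℚ) →ₗ[ℚ] (Fin n → ℚ) := Matrix.toLin' (Matrix.of fun k i => (a k i : ℚ))
  have hf : ∀ c k, f c k = ∑ i, (a k i : ℚ) * c i := fun c k => rfl
  have hker : LinearMap.ker f = ⊥ := by
    rw [LinearMap.ker_eq_bot']
    intro c hc
    by_contra hc0
    set d := ∏ i, (c i).den with hd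
    have hd0 : (d : ℚ) ≠ 0 := by
      exact_mod_cast Finset.prod_ne_zero_iff.2 fun i _ => (c i).den_ne_zero
    have : ∀ i, ∃ z : ℤ, (z : ℚ) = d * c i := by
      intro i
      obtain ⟨w, hw⟩ := Finset.dvd_prod_of_mem (fun i => (c i).den) (Finset.mem_univ i)
      refine ⟨w * (c i).num, ?_⟩
      rw [hd, hw]
      push_cast
      have := Rat.mul_den_eq_num (c i)
      linear_combination -(w : ℚ) * this
    choose z hz using this
    have hz0 : z ≠ 0 := by
      intro h
      apply hc0
      funext i
      have := hz i
      rw [h] at this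
      simp only [Pi.zero_apply, Int.cast_zero] at this
      exact (mul_eq_zero.1 this.symm).resolve_left hd0
    apply logDerivNum_ne_zero hF hind hz0
    ext k
    rw [coeff_zero]
    rcases Nat.lt_or_ge k n with hk | hk
    · rw [coeff_logDerivNum]
      have h1 := hf c ⟨k, hk⟩
      rw [hc] at h1
      simp only [Pi.zero_apply] at h1
      have : ((∑ i, z i * a ⟨k, hk⟩ i : ℤ) : ℚ) = 0 := by
        push_cast
        simp only [hz]
        calc _ = (d : ℚ) * ∑ i, (a ⟨k, hk⟩ i : ℚ) * c i := by
              rw [Finset.mul_sum]; exact Finset.sum_congr rfl fun _ _ => by ring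
          _ = 0 := by rw [← h1, mul_zero]
      exact_mod_cast this
    · exact coeff_eq_zero_of_natDegree_lt ((natDegree_logDerivNum_le hF z).trans_lt (by omega))
  obtain ⟨g, hg⟩ := LinearMap.exists_leftInverse_of_injective f hker
  let w : Fin n → Fin K → ℚ := fun k => g (Pi.single k 1)
  have hgw : ∀ c : Fin K → ℚ, ∀ j, c j = ∑ k, f c k * w k j := by
    intro c j
    have h1 : g (f c) = c := by rw [← LinearMap.comp_apply, hg, LinearMap.id_apply]
    have h2 : f c = ∑ k, f c k • (Pi.single k 1 : Fin n → ℚ) := by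
      funext k
      simp [Finset.sum_apply, Pi.single_apply]
    conv_lhs => rw [← h1, h2, map_sum]
    simp [Finset.sum_apply, w]
  set Δ := ∏ p : Fin n × Fin K, (w p.1 p.2).den with hΔ
  refine ⟨Δ, Finset.prod_ne_zero_iff.2 fun p _ => (w p.1 p.2).den_ne_zero, ?_⟩
  have : ∀ k j, ∃ z : ℤ, (z : ℚ) = Δ * w k j := by
    intro k j
    obtain ⟨v, hv⟩ := Finset.dvd_prod_of_mem (fun p : Fin n × Fin K => (w p.1 p.2).den)
      (Finset.mem_univ (k, j))
    refine ⟨v * (w k j).num, ?_⟩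
    rw [hΔ, hv]
    push_cast
    have := Rat.mul_den_eq_num (w k j)
    linear_combination -(v : ℚ) * this
  choose z hz using this
  intro c m hm j
  have e : Δ * c j = ∑ k : Fin n, (logDerivNum F c).coeff k * z k j := by
    have h1 := hgw (fun i => (c i : ℚ)) j
    have h2 : ∀ k : Fin n, f (fun i => (c i : ℚ)) k = ((logDerivNum F c).coeff k : ℤ) := by
      intro k
      rw [hf, coeff_logDerivNum]
      push_cast
      exact Finset.sum_congr rfl fun _ _ => mul_comm _ _
    have : ((Δ * c j : ℤ) : ℚ) = ((∑ k : Fin n, (logDerivNum F c).coeff k * z k j : ℤ) : ℚ) := by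
      push_cast
      rw [h1, Finset.mul_sum]
      refine Finset.sum_congr rfl fun k _ => ?_
      rw [h2, hz]
      ring
    exact_mod_cast this
  rw [e]
  exact Finset.dvd_sum fun k _ => dvd_mul_of_dvd_left (hm k) _

/-- The discrete logarithm modulo `ℓ ^ M` of `∏ i, F i ^ c i` on integers where all the values
are prime to `ℓ`. -/
def unitLog {K : ℕ} (ℓ M : ℕ) (F : Fin K → ℤ[X]) (c : Fin K → ℤ) (v : ℤ) : ℤ :=
  ∑ i, c i * (((F i).eval v ^ (ℓ ^ M).totient - 1) / (ℓ : ℤ) ^ M)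

/-- The polynomial governing the derivative of `unitLog`. -/
def unitLogDeriv {K : ℕ} (ℓ M : ℕ) (F : Fin K → ℤ[X]) (c : Fin K → ℤ) : ℤ[X] :=
  ∑ i, C (c i) * (derivative (F i) * F i ^ ((ℓ ^ M).totient - 1))

theorem C_pow_dvd_pow_totient_sub_one {ℓ M : ℕ} (hℓ : ℓ.Prime) (hM : 1 ≤ M) {G : ℤ[X]} {g : ℤ}
    (hG : C (ℓ : ℤ) ∣ G - C g) (hg : ¬ (ℓ : ℤ) ∣ g) :
    C ((ℓ : ℤ) ^ M) ∣ G ^ (ℓ ^ M).totient - 1 := by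
  have h1 : C (ℓ : ℤ) ∣ G ^ (ℓ - 1) - 1 := by
    have e1 : C (ℓ : ℤ) ∣ G ^ (ℓ - 1) - C g ^ (ℓ - 1) := hG.trans (sub_dvd_pow_sub_pow _ _ _)
    have e2 : C (ℓ : ℤ) ∣ C g ^ (ℓ - 1) - 1 := by
      rw [← C_pow, ← C_1, ← C_sub]
      refine _root_.map_dvd C ?_
      have := Int.ModEq.pow_card_sub_one_eq_one hℓ
        (((Nat.prime_iff_prime_int.1 hℓ).coprime_iff_not_dvd.2 hg).symm)
      exact this.symm.dvd
    have := dvd_add e1 e2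
    simpa using this
  have h2 := dvd_sub_pow_of_dvd_sub (R := ℤ[X]) (p := ℓ) (a := G ^ (ℓ - 1)) (b := 1)
    (by simpa using h1) (M - 1)
  rw [Nat.sub_add_cancel hM, one_pow, ← pow_mul] at h2
  rw [Nat.totient_prime_pow hℓ hM, mul_comm]
  simpa using h2

theorem C_dvd_comp_sub_C {ℓ s : ℕ} (hs : 1 ≤ s) (f : ℤ[X]) (v : ℤ) :
    C (ℓ : ℤ) ∣ f.comp (C v + C ((ℓ : ℤ) ^ s) * X) - C (f.eval v) := by
  rw [C_dvd_iff_dvd_coeff]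
  intro k
  rw [coeff_sub, coeff_comp_add_mul]
  rcases Nat.eq_zero_or_pos k with rfl | hk
  · simp
  · rw [coeff_C, if_neg (by omega), sub_zero, ← pow_mul]
    exact dvd_mul_of_dvd_right (dvd_pow_self _ (by positivity)) _

/-- Locally `unitLog` is a polynomial, with derivative given by `unitLogDeriv`. -/
theorem exists_unitLog_eq_eval {K ℓ M s : ℕ} (hℓ : ℓ.Prime) (hM : 1 ≤ M) (hs : 1 ≤ s)
    (F : Fin K → ℤ[X]) (v : ℤ) (hv : ∀ i, ¬ (ℓ : ℤ) ∣ (F i).eval v) (c : Fin K → ℤ) :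
    ∃ Λ : ℤ[X], (∀ y : ℤ, unitLog ℓ M F c (v + (ℓ : ℤ) ^ s * y) = Λ.eval y) ∧
      derivative Λ = C ((ℓ : ℤ) ^ (s - 1) * (ℓ - 1)) *
        (unitLogDeriv ℓ M F c).comp (C v + C ((ℓ : ℤ) ^ s) * X) := by
  have hℓ0 : (ℓ : ℤ) ≠ 0 := by exact_mod_cast hℓ.ne_zero
  have h : ∀ i, ∃ L : ℤ[X], (F i).comp (C v + C ((ℓ : ℤ) ^ s) * X) ^ (ℓ ^ M).totient - 1 =
      C ((ℓ : ℤ) ^ M) * L := fun i =>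
    C_pow_dvd_pow_totient_sub_one hℓ hM (C_dvd_comp_sub_C hs (F i) v) (hv i)
  choose L hL using h
  refine ⟨∑ i, C (c i) * L i, fun y => ?_, ?_⟩
  · rw [unitLog, eval_finsetSum]
    refine Finset.sum_congr rfl fun i _ => ?_
    have := congrArg (eval y) (hL i)
    simp only [eval_sub, eval_pow, eval_comp, eval_add, eval_mul, eval_C, eval_X, eval_one] at this
    rw [this, Int.mul_ediv_cancel_left _ (pow_ne_zero _ hℓ0), eval_mul, eval_C]
  · rw [derivative_sum, unitLogDeriv]
    simp only [Polynomial.sum_comp, mul_comp, C_comp, pow_comp]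
    rw [Finset.mul_sum]
    refine Finset.sum_congr rfl fun i _ => ?_
    rw [derivative_C_mul, mul_left_comm (C _) (C (c i))]
    congr 1
    have hC : C ((ℓ : ℤ) ^ M) ≠ 0 := C_ne_zero.2 (pow_ne_zero _ hℓ0)
    apply mul_left_cancel₀ hC
    have := congrArg derivative (hL i)
    rw [derivative_C_mul] at this
    rw [← this, derivative_sub, derivative_one, sub_zero, derivative_pow, derivative_comp]
    rw [Nat.totient_prime_pow hℓ hM]
    have e : ((ℓ ^ (M - 1) * (ℓ - 1) : ℕ) : ℤ) * (ℓ : ℤ) ^ s = (ℓ : ℤ) ^ M * ((ℓ : ℤ) ^ (s - 1) * (ℓ - 1)) := by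
      obtain ⟨m, rfl⟩ : ∃ m, M = m + 1 := ⟨M - 1, by omega⟩
      obtain ⟨t, rfl⟩ : ∃ t, s = t + 1 := ⟨s - 1, by omega⟩
      push_cast [Nat.cast_sub hℓ.one_le]
      ring
    have e' := congrArg (C : ℤ → ℤ[X]) e
    simp only [C_mul] at e' ⊢
    simp only [derivative_add, derivative_C, derivative_mul, derivative_X, zero_add, zero_mul, mul_one]
    linear_combination ((derivative (F i)).comp (C v + C ((ℓ : ℤ) ^ s) * X)) *
      (F i).comp (C v + C ((ℓ : ℤ) ^ s) * X) ^ (ℓ ^ (M - 1) * (ℓ - 1) - 1) * e'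

theorem unitLogDeriv_mul_prod {K ℓ M : ℕ} (hℓ : ℓ.Prime) (F : Fin K → ℤ[X]) (c : Fin K → ℤ) :
    unitLogDeriv ℓ M F c * ∏ i, F i = ∑ i, C (c i) *
      (derivative (F i) * ∏ j ∈ Finset.univ.erase i, F j) * F i ^ (ℓ ^ M).totient := by
  rw [unitLogDeriv, Finset.sum_mul]
  refine Finset.sum_congr rfl fun i _ => ?_
  rw [← Finset.mul_prod_erase Finset.univ F (Finset.mem_univ i)]
  have : F i ^ (ℓ ^ M).totient = F i ^ ((ℓ ^ M).totient - 1) * F i := by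
    rw [← pow_succ, Nat.sub_add_cancel (Nat.totient_pos.2 (pow_pos hℓ.pos M))]
  rw [this]
  ring

theorem pow_dvd_of_pow_dvd_pow_mul {ℓ v n : ℕ} (hℓ : ℓ.Prime) {k' : ℕ} (hk' : ¬ ℓ ∣ k') {x : ℤ}
    (h : (ℓ : ℤ) ^ n ∣ ((ℓ ^ v * k' : ℕ) : ℤ) * x) : (ℓ : ℤ) ^ (n - v) ∣ x := by
  rcases Nat.lt_or_ge n v with hnv | hnv
  · rw [Nat.sub_eq_zero_of_le hnv.le, pow_zero]; exact one_dvd _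
  have hℓ0 : (ℓ : ℤ) ≠ 0 := by exact_mod_cast hℓ.ne_zero
  have e : (ℓ : ℤ) ^ n = (ℓ : ℤ) ^ v * (ℓ : ℤ) ^ (n - v) := by rw [← pow_add, Nat.add_sub_cancel' hnv]
  rw [e, Nat.cast_mul, Nat.cast_pow, mul_assoc, mul_dvd_mul_iff_left (pow_ne_zero _ hℓ0)] at h
  have hc : IsCoprime ((ℓ : ℤ) ^ (n - v)) (k' : ℤ) := by
    refine IsCoprime.pow_left ?_
    rw [Nat.isCoprime_iff_coprime]
    exact hℓ.coprime_iff_not_dvd.2 hk'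
  exact hc.dvd_of_dvd_mul_left h

theorem X_pow_dvd_pow_totient_sub_one {ℓ M : ℕ} (hℓ : ℓ.Prime) (hM : 2 ≤ M) {g : (ZMod ℓ)[X]}
    (hg : g.coeff 0 ≠ 0) : X ^ ℓ ∣ g ^ (ℓ ^ M).totient - 1 := by
  have : Fact ℓ.Prime := ⟨hℓ⟩
  have e : (ℓ ^ M).totient = (ℓ ^ (M - 2) * (ℓ - 1)) * ℓ := by
    rw [Nat.totient_prime_pow hℓ (by omega), show M - 1 = M - 2 + 1 by omega, pow_succ]
    ring
  set m := ℓ ^ (M - 2) * (ℓ - 1) with hm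
  have h1 : X ∣ g ^ m - C (g.coeff 0 ^ m) := by
    rw [X_dvd_iff, coeff_sub, coeff_C_zero, coeff_zero_eq_eval_zero, coeff_zero_eq_eval_zero, eval_pow,
      sub_self]
  have h2 := pow_dvd_pow_of_dvd h1 ℓ
  rw [sub_pow_char, ← pow_mul, ← C_pow, ← pow_mul] at h2
  have h3 : g.coeff 0 ^ (m * ℓ) = 1 := by
    rw [hm, mul_assoc, mul_comm (ℓ - 1), ← mul_assoc, mul_comm, pow_mul, ZMod.pow_card_sub_one_eq_one hg, one_pow]
  rwa [h3, C_1, ← e] at h2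

theorem exists_coeff_taylor_unitLogDeriv_ne_zero {K ℓ M : ℕ} (hℓ : ℓ.Prime) (hM : 2 ≤ M)
    (F : Fin K → ℤ[X]) (c : Fin K → ℤ) (a : ℤ) (ha : ∀ i, ¬ (ℓ : ℤ) ∣ (F i).eval a)
    (hR : (logDerivNum F c).map (Int.castRingHom (ZMod ℓ)) ≠ 0) {μ : ℕ}
    (hμ : ((logDerivNum F c).map (Int.castRingHom (ZMod ℓ))).rootMultiplicity (a : ZMod ℓ) = μ)
    (hμℓ : μ < ℓ) :
    ∃ j ≤ μ, ¬ (ℓ : ℤ) ∣ (taylor a (unitLogDeriv ℓ M F c)).coeff j := by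
  have : Fact ℓ.Prime := ⟨hℓ⟩
  by_contra! hcon
  let τ : ℤ[X] →+* (ZMod ℓ)[X] :=
    (taylorAlgHom (a : ZMod ℓ)).toRingHom.comp (mapRingHom (Int.castRingHom (ZMod ℓ)))
  have hτ : ∀ f, τ f = taylor (a : ZMod ℓ) (f.map (Int.castRingHom (ZMod ℓ))) := fun f => rfl
  have hT : X ^ (μ + 1) ∣ τ (unitLogDeriv ℓ M F c) := by
    rw [X_pow_dvd_iff]
    intro d hd
    rw [hτ, ← map_taylor_intCast, intCast_eq_zero_iff_dvd]
    exact hcon d (by omega)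
  have h1 : X ^ ℓ ∣ τ (unitLogDeriv ℓ M F c * ∏ i, F i) - τ (logDerivNum F c) := by
    rw [unitLogDeriv_mul_prod hℓ, logDerivNum, ← map_sub, ← Finset.sum_sub_distrib, map_sum]
    refine Finset.dvd_sum fun i _ => ?_
    have e : C (c i) * (derivative (F i) * ∏ j ∈ Finset.univ.erase i, F j) * F i ^ (ℓ ^ M).totient -
        C (c i) * (derivative (F i) * ∏ j ∈ Finset.univ.erase i, F j) =
        C (c i) * (derivative (F i) * ∏ j ∈ Finset.univ.erase i, F j) * (F i ^ (ℓ ^ M).totient - 1) := by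
      ring
    rw [e, map_mul, map_sub, map_pow, map_one]
    refine dvd_mul_of_dvd_right (X_pow_dvd_pow_totient_sub_one hℓ hM ?_) _
    rw [hτ, ← map_taylor_intCast, taylor_coeff_zero, Ne, intCast_eq_zero_iff_dvd]
    exact ha i
  have h2 : X ^ (μ + 1) ∣ τ (logDerivNum F c) := by
    have h3 := dvd_sub (dvd_mul_of_dvd_left hT (τ (∏ i, F i))) ((pow_dvd_pow X hμℓ).trans h1)
    rwa [map_mul, sub_sub_cancel] at h3
  rw [X_pow_dvd_iff] at h2
  have h4 := coeff_taylor_rootMultiplicity_ne_zero hR (a : ZMod ℓ)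
  rw [hμ] at h4
  exact h4 (h2 μ (by omega))

theorem norm_sum_unitLog_le {K ℓ M E D : ℕ} (hℓ : ℓ.Prime) (hM : 2 ≤ M) (hE : 1 ≤ E)
    (F : Fin K → ℤ[X]) (c : Fin K → ℤ) (a : ℤ) (ha : ∀ i, ¬ (ℓ : ℤ) ∣ (F i).eval a)
    (hR : (logDerivNum F c).map (Int.castRingHom (ZMod ℓ)) ≠ 0) {μ : ℕ}
    (hμ : ((logDerivNum F c).map (Int.castRingHom (ZMod ℓ))).rootMultiplicity (a : ZMod ℓ) = μ)
    (hμD : μ + 1 ≤ D) (hD : 2 * D + 2 ≤ ℓ) :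
    ‖∑ y ∈ Finset.range (ℓ ^ E), addExp (ℓ ^ E) (unitLog ℓ M F c (a + ℓ * y))‖ ≤
      2 * (D : ℝ) ^ (D + 1) * μ * (ℓ : ℝ) ^ (((E : ℝ) + 1) * (1 - 1 / D)) := by
  have hℓ0 : (ℓ : ℤ) ≠ 0 := by exact_mod_cast hℓ.ne_zero
  have hℓp : Prime (ℓ : ℤ) := Nat.prime_iff_prime_int.1 hℓ
  have hℓ1 : ¬ (ℓ : ℤ) ∣ (ℓ : ℤ) - 1 := fun h => by
    have h1 := (dvd_sub_right (dvd_refl (ℓ : ℤ))).1 h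
    exact hℓp.not_isUnit (isUnit_of_dvd_one h1)
  obtain ⟨Λ, hΛ, hΛ'⟩ := exists_unitLog_eq_eval hℓ (M := M) (s := 1) (by omega) le_rfl F a ha c
  have hco : ∀ k : ℕ, ((k + 1 : ℕ) : ℤ) * Λ.coeff (k + 1) =
      ((ℓ : ℤ) - 1) * ((taylor a (unitLogDeriv ℓ M F c)).coeff k * (ℓ : ℤ) ^ k) := by
    intro k
    have h1 := congrArg (fun P => coeff P k) hΛ'
    simp only [coeff_C_mul, coeff_derivative, coeff_comp_add_mul] at h1
    rw [Nat.sub_self, pow_zero, pow_one, one_mul] at h1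
    rw [← h1]
    push_cast
    ring
  obtain ⟨j, hjμ, hj⟩ := exists_coeff_taylor_unitLogDeriv_ne_zero hℓ hM F c a ha hR hμ (by omega)
  set P := Λ - C (Λ.coeff 0) with hP
  have hPc : ∀ k, P.coeff (k + 1) = Λ.coeff (k + 1) := fun k => by
    rw [hP, coeff_sub, coeff_C, if_neg (by omega), sub_zero]
  obtain ⟨σ, Q, hσ, hQ, hg1, hgμ⟩ := exists_eq_pow_mul_of_not_dvd hℓ P (by rw [hP]; simp)
    (k₀ := j + 1) (k₁ := μ + 1) (s := j) (by
      intro h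
      rw [hPc] at h
      have h1 := dvd_mul_of_dvd_right h ((j + 1 : ℕ) : ℤ)
      rw [hco, mul_comm, mul_assoc, mul_comm _ ((ℓ : ℤ) ^ j * _), mul_comm, pow_succ, mul_comm ((ℓ : ℤ) ^ j),
        mul_comm ((ℓ : ℤ) ^ j), ← mul_assoc, mul_dvd_mul_iff_right (pow_ne_zero _ hℓ0)] at h1
      rcases hℓp.dvd_or_dvd h1 with h2 | h2
      · exact hj h2
      · exact hℓ1 h2) (by
      intro k hk
      obtain ⟨k, rfl⟩ : ∃ k', k = k' + 1 := ⟨k - 1, by omega⟩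
      rw [hPc]
      obtain ⟨v, k', hk', hkv⟩ := Nat.exists_eq_pow_mul_and_not_dvd (n := k + 1) (by omega) ℓ hℓ.ne_one
      have h1 : (ℓ : ℤ) ^ k ∣ ((ℓ ^ v * k' : ℕ) : ℤ) * Λ.coeff (k + 1) := by
        rw [← hkv, hco]
        exact dvd_mul_of_dvd_right (dvd_mul_left _ _) _
      refine (pow_dvd_pow _ ?_).trans (pow_dvd_of_pow_dvd_pow_mul hℓ hk' h1)
      rcases Nat.eq_zero_or_pos v with hv | hv
      · omega
      have e1 : ℓ ^ v ≤ k + 1 := Nat.le_of_dvd (by omega) ⟨k', hkv⟩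
      have e2 : v * ℓ ≤ ℓ ^ v := by
        obtain ⟨v, rfl⟩ : ∃ v', v = v' + 1 := ⟨v - 1, by omega⟩
        rw [pow_succ]
        exact Nat.mul_le_mul_right _ (Nat.lt_pow_self hℓ.one_lt)
      have e3 : ℓ + (v - 1) ≤ v * ℓ := by
        obtain ⟨v, rfl⟩ : ∃ v', v = v' + 1 := ⟨v - 1, by omega⟩
        have := Nat.mul_le_mul_left v hℓ.one_le
        simp only [Nat.add_sub_cancel]
        linarith
      omega)
  have hD1 : (1 : ℝ) ≤ D := by exact_mod_cast (by omega : 1 ≤ D)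
  have hℓr : (1 : ℝ) ≤ ℓ := by exact_mod_cast hℓ.one_le
  have hℓr0 : (0 : ℝ) < ℓ := by linarith
  have hC1 : (1 : ℝ) ≤ 2 * (D : ℝ) ^ (D + 1) := by
    have := one_le_pow₀ hD1 (n := D + 1)
    linarith
  rcases Nat.lt_or_ge σ E with hσE | hσE
  · have hsc := norm_sum_addExp_scaled hℓ.pos (σ := σ) (E := E) (m := E) hσE.le (by omega) (Λ.coeff 0) Q
      (fun y => unitLog ℓ M F c (a + ℓ * y)) (fun y => by
        have h1 := hΛ y
        rw [pow_one] at h1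
        have h2 : Λ = C (Λ.coeff 0) + C ((ℓ : ℤ) ^ σ) * Q := by rw [← hQ, hP]; ring
        have h3 := congrArg (eval (y : ℤ)) h2
        rw [eval_add, eval_C, eval_mul, eval_C] at h3
        rw [h1, ← h3, sub_self]
        exact dvd_zero _)
    rw [hsc, Nat.add_sub_cancel_left]
    rcases Nat.lt_or_ge 1 (Q.map (Int.castRingHom (ZMod ℓ))).natDegree with hg | hg
    · set g := (Q.map (Int.castRingHom (ZMod ℓ))).natDegree with hgd
      have hH := norm_polyExpSum_prime_pow_le hℓ (by omega : D < ℓ) (E - σ) Q g hgd.symm hg1 (by omega)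
      have hμ1 : max 1 ((g : ℝ) - 1) ≤ μ := by
        have : (g : ℝ) ≤ μ + 1 := by exact_mod_cast hgμ
        have : (2 : ℝ) ≤ g := by exact_mod_cast hg
        exact max_le (by linarith) (by linarith)
      have hgD : (g : ℝ) ≤ D := by exact_mod_cast (by omega : g ≤ D)
      have hg0 : (0 : ℝ) < g := by exact_mod_cast (by omega : 0 < g)
      have hσD : (σ : ℝ) + 1 ≤ D := by exact_mod_cast (by omega : σ + 1 ≤ D)
      have hσEr : (σ : ℝ) ≤ E := by exact_mod_cast hσE.le
      calc (ℓ : ℝ) ^ σ * ‖polyExpSum (ℓ ^ (E - σ)) Q‖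
          ≤ (ℓ : ℝ) ^ σ * (2 * (D : ℝ) ^ (D + 1) * μ * (ℓ : ℝ) ^ (((E - σ : ℕ) : ℝ) * (1 - 1 / g))) := by
            refine mul_le_mul_of_nonneg_left (hH.trans ?_) (by positivity)
            gcongr
        _ = 2 * (D : ℝ) ^ (D + 1) * μ * (ℓ : ℝ) ^ ((σ : ℝ) + ((E - σ : ℕ) : ℝ) * (1 - 1 / g)) := by
            rw [Real.rpow_add hℓr0, Real.rpow_natCast]; ring
        _ ≤ _ := by
            refine mul_le_mul_of_nonneg_left (Real.rpow_le_rpow_of_exponent_le hℓr ?_) (by positivity)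
            rw [Nat.cast_sub hσE.le]
            have h1 : ((E : ℝ) - σ) / D ≤ ((E : ℝ) - σ) / g :=
              div_le_div_of_nonneg_left (by linarith) hg0 hgD
            have h2 : ((σ : ℝ) + 1) / D ≤ 1 := by rw [div_le_one (by linarith)]; exact hσD
            have e1 : (σ : ℝ) + ((E : ℝ) - σ) * (1 - 1 / g) = E - ((E : ℝ) - σ) / g := by ring
            have e2 : ((E : ℝ) + 1) * (1 - 1 / D) = E + 1 - ((E : ℝ) - σ) / D - ((σ : ℝ) + 1) / D := by ring
            rw [e1, e2]
            linarith
    · rw [polyExpSum_eq_zero_of_natDegree_eq_one hℓ (by omega) Q (by omega), norm_zero, mul_zero]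
      positivity
  · have hμ1 : (1 : ℝ) ≤ μ := by exact_mod_cast (by omega : 1 ≤ μ)
    calc _ ≤ ∑ y ∈ Finset.range (ℓ ^ E), (1 : ℝ) := norm_sum_le_of_le _ fun y _ => (norm_addExp _ _).le
      _ = (ℓ : ℝ) ^ (E : ℝ) := by rw [Real.rpow_natCast]; simp
      _ ≤ (ℓ : ℝ) ^ (((E : ℝ) + 1) * (1 - 1 / D)) := by
        refine Real.rpow_le_rpow_of_exponent_le hℓr ?_
        have hED : (E : ℝ) + 1 ≤ D := by exact_mod_cast (by omega : E + 1 ≤ D)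
        have h2 : ((E : ℝ) + 1) / D ≤ 1 := by rw [div_le_one (by linarith)]; exact hED
        have e2 : ((E : ℝ) + 1) * (1 - 1 / D) = E + 1 - ((E : ℝ) + 1) / D := by ring
        linarith
      _ ≤ _ := le_mul_of_one_le_left (by positivity) (one_le_mul_of_one_le_of_one_le hC1 hμ1)

theorem sum_addExp_eval_eq_zero {ℓ s E m : ℕ} (hℓ : ℓ.Prime) (hs : s + 1 < E) (hm : E ≤ m + s)
    {u : ℤ} (hu : ¬ (ℓ : ℤ) ∣ u) {Λ H : ℤ[X]}
    (hΛ : derivative Λ = C ((ℓ : ℤ) ^ s) * (C u + C (ℓ : ℤ) * H)) :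
    ∑ z ∈ Finset.range (ℓ ^ m), addExp (ℓ ^ E) (Λ.eval (z : ℤ)) = 0 := by
  have hℓ0 : (ℓ : ℤ) ≠ 0 := by exact_mod_cast hℓ.ne_zero
  have hℓp : Prime (ℓ : ℤ) := Nat.prime_iff_prime_int.1 hℓ
  obtain ⟨m, rfl⟩ : ∃ m', m = m' + 1 := ⟨m - 1, by omega⟩
  rw [pow_succ', sum_range_mul_eq]
  refine Finset.sum_eq_zero fun t _ => ?_
  set P := Λ.comp (C (t : ℤ) + C (ℓ : ℤ) * X) with hP
  have hco : ∀ k : ℕ, ((k + 1 : ℕ) : ℤ) * P.coeff (k + 1) = (ℓ : ℤ) ^ (s + 1) * ((ℓ : ℤ) ^ k *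
      ((C u).coeff k + (ℓ : ℤ) * (taylor (t : ℤ) H).coeff k)) := by
    intro k
    have h1 := congrArg (fun Q => coeff (taylor (t : ℤ) Q) k) hΛ
    simp only [coeff_taylor_derivative] at h1
    rw [taylor_mul, taylor_C, coeff_C_mul, map_add, taylor_mul, taylor_C, taylor_C, coeff_add, coeff_C_mul] at h1
    rw [hP, coeff_comp_add_mul]
    push_cast
    linear_combination (ℓ : ℤ) ^ (k + 1) * h1
  have hdvd : C ((ℓ : ℤ) ^ (s + 2)) ∣ P - (C (Λ.eval (t : ℤ)) + C ((ℓ : ℤ) ^ (s + 1) * u) * X) := by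
    rw [C_dvd_iff_dvd_coeff]
    intro k
    rcases k with _ | _ | k
    · have : P.coeff 0 = Λ.eval (t : ℤ) := by
        rw [hP, coeff_comp_add_mul, taylor_coeff_zero, pow_zero, mul_one]
      simp [this]
    · have h1 := hco 0
      rw [coeff_C_zero] at h1
      simp only [zero_add, coeff_sub, coeff_add, coeff_C, coeff_C_mul, coeff_X_one]
      refine ⟨(taylor (t : ℤ) H).coeff 0, ?_⟩
      simp only [Nat.cast_one, zero_add, one_mul, pow_zero] at h1
      rw [h1]
      simp
      ring
    · have h1 := hco (k + 1)
      obtain ⟨v, k', hk', hkv⟩ := Nat.exists_eq_pow_mul_and_not_dvd (n := k + 2) (by omega) ℓ hℓ.ne_one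
      have h2 : (ℓ : ℤ) ^ (s + 2 + (k + 1)) ∣ ((ℓ ^ v * k' : ℕ) : ℤ) * P.coeff (k + 2) := by
        rw [← hkv]
        refine ⟨(taylor (t : ℤ) H).coeff (k + 1), ?_⟩
        rw [show k + 2 = k + 1 + 1 by rfl, h1, coeff_C, if_neg (by omega)]
        ring
      have e0 : (P - (C (Λ.eval (t : ℤ)) + C ((ℓ : ℤ) ^ (s + 1) * u) * X)).coeff (k + 1 + 1) = P.coeff (k + 2) := by
        rw [coeff_sub, coeff_add, coeff_C, coeff_C_mul, coeff_X]
        simp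
      rw [e0]
      refine (pow_dvd_pow _ ?_).trans (pow_dvd_of_pow_dvd_pow_mul hℓ hk' h2)
      have e1 : ℓ ^ v ≤ k + 2 := Nat.le_of_dvd (by omega) ⟨k', hkv⟩
      have e2 : v < ℓ ^ v := Nat.lt_pow_self hℓ.one_lt
      omega
  obtain ⟨H₂, hH₂⟩ := hdvd
  have hP2 : P = C (Λ.eval (t : ℤ)) + C ((ℓ : ℤ) ^ (s + 1)) * (C u * X + C (ℓ : ℤ) * H₂) := by
    rw [pow_succ (ℓ : ℤ) (s + 1)] at hH₂
    simp only [C_mul] at hH₂ ⊢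
    linear_combination hH₂
  have hsc := norm_sum_addExp_scaled hℓ.pos (σ := s + 1) (E := E) (m := m) hs.le (by omega)
    (Λ.eval (t : ℤ)) (C u * X + C (ℓ : ℤ) * H₂) (fun z => Λ.eval ((t + ℓ * z : ℕ) : ℤ)) (fun y => by
      have h3 := congrArg (eval (y : ℤ)) hP2
      rw [hP, eval_comp] at h3
      rw [eval_add, eval_mul, eval_C, eval_C, eval_X, eval_add, eval_C, eval_mul (p := C _), eval_C] at h3
      push_cast
      rw [h3, sub_self]
      exact dvd_zero _)
  rw [polyExpSum_eq_zero_of_isCoprime hℓ (by omega) u ((hℓp.coprime_iff_not_dvd.2 hu).symm), norm_zero,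
    mul_zero, norm_eq_zero] at hsc
  exact hsc

/-- On the residue class of `v` modulo `ℓ ^ n`, the polynomial `Q` is a power of `ℓ` times a unit
at `ℓ`. -/
def HasUnitContent (ℓ n : ℕ) (Q : ℤ[X]) (v : ℤ) : Prop :=
  ∃ (β : ℕ) (u : ℤ) (H : ℤ[X]), ¬ (ℓ : ℤ) ∣ u ∧
    Q.comp (C v + C ((ℓ : ℤ) ^ n) * X) = C ((ℓ : ℤ) ^ β) * (C u + C (ℓ : ℤ) * H)

theorem card_not_hasUnitContent_le {ℓ : ℕ} (hℓ : ℓ.Prime) (n : ℕ) : ∀ Q : ℤ[X],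
    Q.map (Int.castRingHom (ZMod ℓ)) ≠ 0 →
    ((Finset.range (ℓ ^ n)).filter fun v : ℕ => ¬ HasUnitContent ℓ n Q v).card ≤
      (Q.map (Int.castRingHom (ZMod ℓ))).natDegree := by
  have : Fact ℓ.Prime := ⟨hℓ⟩
  have hℓ0 : (ℓ : ℤ) ≠ 0 := by exact_mod_cast hℓ.ne_zero
  induction n with
  | zero =>
    intro Q hQ
    rcases Nat.eq_zero_or_pos (Q.map (Int.castRingHom (ZMod ℓ))).natDegree with h0 | h0
    · rw [h0, Nat.le_zero, Finset.card_eq_zero, Finset.filter_eq_empty_iff]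
      intro v hv
      rw [pow_zero, Finset.mem_range, Nat.lt_one_iff] at hv
      rw [not_not, hv]
      have h1 : C (ℓ : ℤ) ∣ Q - C (Q.coeff 0) := by
        rw [C_dvd_iff_dvd_coeff]
        intro k
        rcases Nat.eq_zero_or_pos k with rfl | hk
        · simp
        · rw [coeff_sub, coeff_C, if_neg (by omega), sub_zero, ← intCast_eq_zero_iff_dvd,
            ← eq_intCast (Int.castRingHom (ZMod ℓ)), ← coeff_map]
          exact coeff_eq_zero_of_natDegree_lt (by omega)
      obtain ⟨H, hH⟩ := h1
      refine ⟨0, Q.coeff 0, H, fun h => ?_, ?_⟩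
      · rw [← intCast_eq_zero_iff_dvd, ← eq_intCast (Int.castRingHom (ZMod ℓ)), ← coeff_map] at h
        apply hQ
        rw [eq_C_of_natDegree_eq_zero h0, h, C_0]
      · rw [← hH]
        simp
    · refine (Finset.card_filter_le _ _).trans ?_
      rw [Finset.card_range, pow_zero]
      exact h0
  | succ n ih =>
    intro Q hQ
    rw [Finset.card_filter, pow_succ', sum_range_mul_eq]
    refine le_trans ?_ (sum_rootMultiplicity_le (Q.map (Int.castRingHom (ZMod ℓ))))
    rw [← sum_range_eq_sum_zmod ℓ]
    refine Finset.sum_le_sum fun y _ => ?_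
    set μ := (Q.map (Int.castRingHom (ZMod ℓ))).rootMultiplicity (y : ZMod ℓ) with hμ
    obtain ⟨σ, Q', -, hσ, hQ', hdeg⟩ := exists_eq_pow_mul_map_ne_zero hℓ (Q.comp (C (y : ℤ) + C (ℓ : ℤ) * X))
      (k₀ := μ) (k₁ := μ) (s := μ) (by
        rw [coeff_comp_add_mul, pow_succ', mul_dvd_mul_iff_right (pow_ne_zero _ hℓ0),
          ← intCast_eq_zero_iff_dvd, map_taylor_intCast, Int.cast_natCast]
        exact coeff_taylor_rootMultiplicity_ne_zero hQ _) (by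
        intro k hk
        rw [coeff_comp_add_mul]
        exact dvd_mul_of_dvd_right (pow_dvd_pow _ hk) _)
    refine le_trans ?_ ((ih Q' hQ').trans hdeg)
    rw [Finset.card_filter]
    refine Finset.sum_le_sum fun z _ => ?_
    have himp : HasUnitContent ℓ n Q' z → HasUnitContent ℓ (n + 1) Q ((y + ℓ * z : ℕ) : ℤ) := by
      rintro ⟨β, u, H, hu, h⟩
      refine ⟨σ + β, u, H, hu, ?_⟩
      have h1 := congrArg (fun f => comp f (C (z : ℤ) + C ((ℓ : ℤ) ^ n) * X)) hσ
      simp only [mul_comp, C_comp] at h1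
      rw [h, comp_assoc] at h1
      rw [pow_add (ℓ : ℤ) σ β, C_mul (a := (ℓ : ℤ) ^ σ), mul_assoc (C ((ℓ : ℤ) ^ σ)), ← h1]
      congr 1
      simp
      ring
    by_cases hc : HasUnitContent ℓ n Q' z
    · rw [if_neg (not_not.2 (himp hc))]
      exact Nat.zero_le _
    · rw [if_pos hc]
      split_ifs <;> omega

theorem pow_dvd_coeff_of_comp_eq {ℓ n β D κ : ℕ} (hℓ : ℓ.Prime) {R H : ℤ[X]} {v : ℤ}
    (hR : R.natDegree ≤ D) (hβ : D * n + κ ≤ β)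
    (h : R.comp (C v + C ((ℓ : ℤ) ^ n) * X) = C ((ℓ : ℤ) ^ β) * H) (k : ℕ) :
    (ℓ : ℤ) ^ κ ∣ R.coeff k := by
  have hℓ0 : (ℓ : ℤ) ≠ 0 := by exact_mod_cast hℓ.ne_zero
  have h1 : C ((ℓ : ℤ) ^ κ) ∣ taylor v R := by
    rw [C_dvd_iff_dvd_coeff]
    intro k
    rcases Nat.lt_or_ge D k with hk | hk
    · rw [coeff_eq_zero_of_natDegree_lt (by rw [natDegree_taylor]; omega)]
      exact dvd_zero _
    · have h2 := congrArg (fun f => coeff f k) h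
      simp only [coeff_comp_add_mul, coeff_C_mul] at h2
      have h3 : (ℓ : ℤ) ^ κ * ((ℓ : ℤ) ^ n) ^ k ∣ (taylor v R).coeff k * ((ℓ : ℤ) ^ n) ^ k := by
        rw [h2, ← pow_mul, ← pow_add]
        refine dvd_mul_of_dvd_left (pow_dvd_pow _ ?_) _
        have := Nat.mul_le_mul_left n hk
        rw [mul_comm n D] at this
        omega
      exact (mul_dvd_mul_iff_right (pow_ne_zero _ (pow_ne_zero _ hℓ0))).1 h3
  obtain ⟨S, hS⟩ := h1
  have h2 : R = C ((ℓ : ℤ) ^ κ) * taylor (-v) S := by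
    have := congrArg (taylor (-v)) hS
    rw [taylor_taylor, neg_add_cancel, taylor_zero, taylor_mul, taylor_C] at this
    exact this
  rw [h2, coeff_C_mul]
  exact dvd_mul_right _ _

theorem sum_unitLog_eq_zero {K ℓ M E D κ n : ℕ} (hℓ : ℓ.Prime) (hn : 1 ≤ n)
    (hE : D * n + n + κ + 1 ≤ E) (hM : E ≤ M)
    (F : Fin K → ℤ[X]) (c : Fin K → ℤ) (v : ℤ) (hv : ∀ i, ¬ (ℓ : ℤ) ∣ (F i).eval v)
    (hD : (logDerivNum F c).natDegree ≤ D)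
    (hκ : ∃ k, ¬ (ℓ : ℤ) ^ (κ + 1) ∣ (logDerivNum F c).coeff k)
    (hgood : HasUnitContent ℓ n (logDerivNum F c) v) :
    ∑ z ∈ Finset.range (ℓ ^ (E + 1 - n)),
      addExp (ℓ ^ E) (unitLog ℓ M F c (v + (ℓ : ℤ) ^ n * z)) = 0 := by
  have hℓ0 : (ℓ : ℤ) ≠ 0 := by exact_mod_cast hℓ.ne_zero
  have hℓp : Prime (ℓ : ℤ) := Nat.prime_iff_prime_int.1 hℓ
  have hℓ1 : ¬ (ℓ : ℤ) ∣ (ℓ : ℤ) - 1 := fun h => by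
    have h1 := (dvd_sub_right (dvd_refl (ℓ : ℤ))).1 h
    exact hℓp.not_isUnit (isUnit_of_dvd_one h1)
  obtain ⟨β, u, H, hu, hR⟩ := hgood
  have hβ : β ≤ D * n + κ := by
    by_contra hcon
    obtain ⟨k, hk⟩ := hκ
    exact hk (pow_dvd_coeff_of_comp_eq hℓ hD (by omega) hR k)
  obtain ⟨Λ, hΛ, hΛ'⟩ := exists_unitLog_eq_eval hℓ (M := M) (s := n) (by omega) hn F v hv c
  set T := (unitLogDeriv ℓ M F c).comp (C v + C ((ℓ : ℤ) ^ n) * X) with hT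
  set P := (∏ i, F i).comp (C v + C ((ℓ : ℤ) ^ n) * X) with hP
  set g := (∏ i, F i).eval v with hg
  have hgd : ¬ (ℓ : ℤ) ∣ g := by
    rw [hg, eval_prod, hℓp.dvd_finsetProd_iff]
    rintro ⟨i, -, hi⟩
    exact hv i hi
  have h1 : C ((ℓ : ℤ) ^ M) ∣ T * P - (logDerivNum F c).comp (C v + C ((ℓ : ℤ) ^ n) * X) := by
    rw [hT, hP, ← mul_comp, unitLogDeriv_mul_prod hℓ, logDerivNum, ← sub_comp, ← Finset.sum_sub_distrib,
      Polynomial.sum_comp]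
    refine Finset.dvd_sum fun i _ => ?_
    rw [← mul_sub_one, mul_comp, sub_comp, pow_comp, one_comp]
    exact dvd_mul_of_dvd_right (C_pow_dvd_pow_totient_sub_one hℓ (by omega) (C_dvd_comp_sub_C hn _ _) (hv i)) _
  have h2 : C ((ℓ : ℤ) ^ M) ∣ P ^ (ℓ ^ M).totient - 1 :=
    C_pow_dvd_pow_totient_sub_one hℓ (by omega) (C_dvd_comp_sub_C hn _ _) hgd
  set φ := (ℓ ^ M).totient with hφ
  have hφ1 : 1 ≤ φ := Nat.totient_pos.2 (pow_pos hℓ.pos M)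
  have h3 : C (ℓ : ℤ) ∣ P ^ (φ - 1) - C (g ^ (φ - 1)) := by
    rw [C_pow]
    exact (C_dvd_comp_sub_C hn _ _).trans (sub_dvd_pow_sub_pow _ _ _)
  have h4 : C ((ℓ : ℤ) ^ (β + 1)) ∣ T - C ((ℓ : ℤ) ^ β * (u * g ^ (φ - 1))) := by
    have hMβ : C ((ℓ : ℤ) ^ (β + 1)) ∣ C ((ℓ : ℤ) ^ M) :=
      _root_.map_dvd C (pow_dvd_pow _ (by nlinarith))
    obtain ⟨A, hA⟩ := hMβ.trans h1
    obtain ⟨B, hB⟩ := hMβ.trans h2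
    obtain ⟨J, hJ⟩ := h3
    rw [hR] at hA
    have e : P ^ φ = P ^ (φ - 1) * P := by rw [← pow_succ, Nat.sub_add_cancel hφ1]
    rw [e] at hB
    refine ⟨-T * B + A * P ^ (φ - 1) + (H * P ^ (φ - 1)) + C u * J, ?_⟩
    rw [pow_succ] at hA hB ⊢
    simp only [C_mul] at hA hB ⊢
    linear_combination P ^ (φ - 1) * hA - T * hB + C ((ℓ : ℤ) ^ β) * C u * hJ
  obtain ⟨H', hH'⟩ := h4
  have hz := sum_addExp_eval_eq_zero (s := n - 1 + β) (E := E) (m := E + 1 - n) (Λ := Λ)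
    (u := (ℓ - 1) * (u * g ^ (φ - 1))) (H := C ((ℓ : ℤ) - 1) * H') hℓ (by omega) (by omega) (by
      intro h
      rcases hℓp.dvd_or_dvd h with h | h
      · exact hℓ1 h
      rcases hℓp.dvd_or_dvd h with h | h
      · exact hu h
      · exact hgd (hℓp.dvd_of_dvd_pow h)) (by
      rw [hΛ']
      rw [pow_succ] at hH'
      rw [pow_add]
      simp only [C_mul] at hH' ⊢
      linear_combination C ((ℓ : ℤ) ^ (n - 1)) * C ((ℓ : ℤ) - 1) * hH')
  simp only [hΛ]
  exact hz

theorem sum_norm_sum_unitLog_le {K ℓ M E D κ n : ℕ} (hℓ : ℓ.Prime) (hn : 1 ≤ n)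
    (hE : D * n + n + κ + 1 ≤ E) (hM : E ≤ M) (F : Fin K → ℤ[X]) (c : Fin K → ℤ)
    (hD : (logDerivNum F c).natDegree ≤ D)
    (hκ : ∃ k, ¬ (ℓ : ℤ) ^ (κ + 1) ∣ (logDerivNum F c).coeff k) :
    ∑ a ∈ Finset.range ℓ, (if ∀ i, ¬ (ℓ : ℤ) ∣ (F i).eval (a : ℤ) then
      ‖∑ y ∈ Finset.range (ℓ ^ E), addExp (ℓ ^ E) (unitLog ℓ M F c (a + ℓ * y))‖ else 0) ≤
      D * (ℓ : ℝ) ^ (E + 1 - n) := by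
  obtain ⟨k, hk⟩ := hκ
  obtain ⟨σ, Q, -, hQ, hQ0, hQD⟩ := exists_eq_pow_mul_map_ne_zero hℓ (logDerivNum F c) (k₁ := D) hk
    (fun k' hk' => by rw [coeff_eq_zero_of_natDegree_lt (by omega)]; exact dvd_zero _)
  have hcard := (card_not_hasUnitContent_le hℓ n Q hQ0).trans hQD
  have hgood : ∀ v : ℤ, HasUnitContent ℓ n Q v → HasUnitContent ℓ n (logDerivNum F c) v := by
    rintro v ⟨β, u, H, hu, h⟩
    refine ⟨σ + β, u, H, hu, ?_⟩
    rw [hQ, mul_comp, C_comp, h, pow_add, C_mul, mul_assoc]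
  let f : ℕ → ℝ := fun v => if ∀ i, ¬ (ℓ : ℤ) ∣ (F i).eval (v : ℤ) then
    ‖∑ z ∈ Finset.range (ℓ ^ (E + 1 - n)), addExp (ℓ ^ E) (unitLog ℓ M F c (v + (ℓ : ℤ) ^ n * z))‖ else 0
  have hf : ∀ v, f v ≤ if ¬ HasUnitContent ℓ n Q v then (ℓ : ℝ) ^ (E + 1 - n) else 0 := by
    intro v
    by_cases hv : ∀ i, ¬ (ℓ : ℤ) ∣ (F i).eval (v : ℤ)
    · by_cases hg : HasUnitContent ℓ n Q v
      · rw [if_neg (not_not.2 hg)]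
        simp only [f, if_pos hv]
        rw [sum_unitLog_eq_zero hℓ hn hE hM F c v hv hD ⟨k, hk⟩ (hgood v hg), norm_zero]
      · rw [if_pos hg]
        simp only [f, if_pos hv]
        refine (norm_sum_le_of_le _ fun y _ => (norm_addExp _ _).le).trans ?_
        simp
    · simp only [f, if_neg hv]
      split_ifs <;> positivity
  calc _ ≤ ∑ a ∈ Finset.range ℓ, ∑ y ∈ Finset.range (ℓ ^ (n - 1)), f (a + ℓ * y) := by
        refine Finset.sum_le_sum fun a _ => ?_
        have hiff : ∀ y : ℕ, (∀ i, ¬ (ℓ : ℤ) ∣ (F i).eval ((a + ℓ * y : ℕ) : ℤ)) ↔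
            (∀ i, ¬ (ℓ : ℤ) ∣ (F i).eval (a : ℤ)) := by
          intro y
          refine forall_congr' fun i => not_congr ?_
          have h1 : (ℓ : ℤ) ∣ (F i).eval ((a + ℓ * y : ℕ) : ℤ) - (F i).eval (a : ℤ) :=
            Dvd.dvd.trans ⟨y, by push_cast; ring⟩ (sub_dvd_eval_sub _ _ (F i))
          exact (dvd_iff_dvd_of_dvd_sub h1)
        split_ifs with ha
        · have e : ℓ ^ E = ℓ ^ (n - 1) * ℓ ^ (E + 1 - n) := by
            rw [← pow_add]; congr 1; nlinarith [Nat.sub_add_cancel hn, Nat.sub_add_cancel (by nlinarith : n ≤ E + 1)]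
          have e2 : ∑ y ∈ Finset.range (ℓ ^ E), addExp (ℓ ^ E) (unitLog ℓ M F c (a + ℓ * y)) =
              ∑ y ∈ Finset.range (ℓ ^ (n - 1) * ℓ ^ (E + 1 - n)), addExp (ℓ ^ E) (unitLog ℓ M F c (a + ℓ * y)) := by
            rw [← e]
          rw [e2, sum_range_mul_eq]
          refine (norm_sum_le _ _).trans (Finset.sum_le_sum fun y _ => ?_)
          simp only [f, if_pos ((hiff y).2 ha)]
          refine le_of_eq (congrArg _ (Finset.sum_congr rfl fun z _ => ?_))
          congr 2
          have : (ℓ : ℤ) ^ n = ℓ * (ℓ : ℤ) ^ (n - 1) := by rw [← pow_succ', Nat.sub_add_cancel hn]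
          rw [this]
          push_cast
          ring
        · refine Finset.sum_nonneg fun y _ => ?_
          simp only [f]
          split_ifs <;> positivity
    _ = ∑ v ∈ Finset.range (ℓ ^ n), f v := by
        rw [← sum_range_mul_eq, ← pow_succ', Nat.sub_add_cancel hn]
    _ ≤ ∑ v ∈ Finset.range (ℓ ^ n), if ¬ HasUnitContent ℓ n Q v then (ℓ : ℝ) ^ (E + 1 - n) else 0 :=
        Finset.sum_le_sum fun v _ => hf v
    _ = (((Finset.range (ℓ ^ n)).filter fun v : ℕ => ¬ HasUnitContent ℓ n Q v).card : ℝ) *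
          (ℓ : ℝ) ^ (E + 1 - n) := by
        rw [← Finset.sum_filter, Finset.sum_const, nsmul_eq_mul]
    _ ≤ _ := by
        refine mul_le_mul_of_nonneg_right ?_ (by positivity)
        exact_mod_cast hcard

/-- Square-root type cancellation, on average over the residue classes modulo `ℓ`, in the
exponential sums attached to a multiplicatively independent family. -/
theorem exists_sum_norm_sum_unitLog_le {K : ℕ} {F : Fin K → ℤ[X]} (hF : ∀ i, 0 < (F i).natDegree)
    (hind : MultIndep F) {D : ℕ} (hFD : ∑ i, (F i).natDegree ≤ D) :
    ∃ B : ℝ, 0 < B ∧ ∀ ℓ : ℕ, ℓ.Prime → ∀ E M : ℕ, 1 ≤ E → 2 ≤ M → E ≤ M → ∀ c : Fin K → ℤ,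
      (∃ j, ¬ (ℓ : ℤ) ∣ c j) →
      ∑ a ∈ Finset.range ℓ, (if ∀ i, ¬ (ℓ : ℤ) ∣ (F i).eval (a : ℤ) then
        ‖∑ y ∈ Finset.range (ℓ ^ E), addExp (ℓ ^ E) (unitLog ℓ M F c (a + ℓ * y))‖ else 0) ≤
      B * (ℓ : ℝ) ^ (((E : ℝ) + 1) * (1 - 1 / D)) := by
  rcases Nat.eq_zero_or_pos K with rfl | hK
  · exact ⟨1, one_pos, fun ℓ _ E M _ _ _ c ⟨j, _⟩ => j.elim0⟩
  have hD1 : 1 ≤ D := le_trans (hF ⟨0, hK⟩)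
    ((Finset.single_le_sum (f := fun i => (F i).natDegree) (fun _ _ => Nat.zero_le _)
      (Finset.mem_univ _)).trans hFD)
  obtain ⟨Δ, hΔ0, hΔ⟩ := exists_dvd_mul_of_dvd_coeff_logDerivNum hF hind
  have hRD : ∀ c, (logDerivNum F c).natDegree ≤ D - 1 := fun c =>
    (natDegree_logDerivNum_le hF c).trans (Nat.sub_le_sub_right hFD 1)
  set L := max Δ (2 * D + 2) with hL
  have hDr : (1 : ℝ) ≤ D := by exact_mod_cast hD1
  have hL0 : (0 : ℝ) ≤ L := Nat.cast_nonneg _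
  have hΔr : (0 : ℝ) ≤ Δ := Nat.cast_nonneg _
  refine ⟨2 * (D : ℝ) ^ (D + 1) * D + D * Δ * L ^ 2, by positivity, ?_⟩
  intro ℓ hℓ E M hE hM hEM c ⟨j, hj⟩
  have : Fact ℓ.Prime := ⟨hℓ⟩
  have hℓp : Prime (ℓ : ℤ) := Nat.prime_iff_prime_int.1 hℓ
  have hℓr : (1 : ℝ) ≤ ℓ := by exact_mod_cast hℓ.one_le
  have hℓr0 : (0 : ℝ) < ℓ := by linarith
  rw [add_mul]
  by_cases hbig : ¬ ℓ ∣ Δ ∧ 2 * D + 2 ≤ ℓ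
  · refine le_trans ?_ (le_add_of_nonneg_right (by positivity))
    have hR : (logDerivNum F c).map (Int.castRingHom (ZMod ℓ)) ≠ 0 := by
      intro h
      have h1 := hΔ c ℓ (fun k => by
        rw [← intCast_eq_zero_iff_dvd, ← eq_intCast (Int.castRingHom (ZMod ℓ)), ← coeff_map, h, coeff_zero]) j
      rcases hℓp.dvd_or_dvd h1 with h2 | h2
      · exact hbig.1 (Int.natCast_dvd_natCast.1 h2)
      · exact hj h2
    set R := (logDerivNum F c).map (Int.castRingHom (ZMod ℓ)) with hRdef
    have hRD' : R.natDegree ≤ D - 1 := natDegree_map_le.trans (hRD c)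
    have hsum := sum_rootMultiplicity_le R
    have hμ : ∀ a, R.rootMultiplicity a ≤ D - 1 := fun a =>
      (Finset.single_le_sum (f := fun a => R.rootMultiplicity a) (fun _ _ => Nat.zero_le _)
        (Finset.mem_univ a)).trans (hsum.trans hRD')
    calc _ ≤ ∑ a ∈ Finset.range ℓ, 2 * (D : ℝ) ^ (D + 1) * (R.rootMultiplicity (a : ZMod ℓ) : ℕ) *
          (ℓ : ℝ) ^ (((E : ℝ) + 1) * (1 - 1 / D)) := by
          refine Finset.sum_le_sum fun a _ => ?_
          split_ifs with ha
          · refine norm_sum_unitLog_le hℓ hM hE F c a ha hR ?_ ?_ hbig.2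
            · rw [Int.cast_natCast]
            · have := hμ a
              omega
          · positivity
      _ = 2 * (D : ℝ) ^ (D + 1) * ((∑ a : ZMod ℓ, R.rootMultiplicity a : ℕ) : ℝ) *
          (ℓ : ℝ) ^ (((E : ℝ) + 1) * (1 - 1 / D)) := by
          rw [← Finset.sum_mul, ← Finset.mul_sum, ← sum_range_eq_sum_zmod ℓ, Nat.cast_sum]
      _ ≤ _ := by
          have : ((∑ a : ZMod ℓ, R.rootMultiplicity a : ℕ) : ℝ) ≤ D := by
            exact_mod_cast (by omega : ∑ a : ZMod ℓ, R.rootMultiplicity a ≤ D)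
          gcongr
  · refine le_trans ?_ (le_add_of_nonneg_left (by positivity))
    have hℓL : ℓ ≤ L := by
      by_cases h : ℓ ∣ Δ
      · exact (Nat.le_of_dvd (Nat.pos_of_ne_zero hΔ0) h).trans (le_max_left _ _)
      · exact le_trans (by by_contra h'; exact hbig ⟨h, by omega⟩) (le_max_right _ _)
    obtain ⟨κ, k', hk', hκ⟩ := Nat.exists_eq_pow_mul_and_not_dvd hΔ0 ℓ hℓ.ne_one
    have hκΔ : ℓ ^ κ ≤ Δ := Nat.le_of_dvd (Nat.pos_of_ne_zero hΔ0) ⟨k', hκ⟩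
    have hex : ∃ k, ¬ (ℓ : ℤ) ^ (κ + 1) ∣ (logDerivNum F c).coeff k := by
      by_contra! hcon
      have h1 := hΔ c _ hcon j
      rw [hκ] at h1
      have h2 := pow_dvd_of_pow_dvd_pow_mul hℓ hk' h1
      rw [Nat.add_sub_cancel_left, pow_one] at h2
      exact hj h2
    set n := (E - κ - 1) / D with hn
    have hdiv := Nat.div_add_mod (E - κ - 1) D
    have hmod := Nat.mod_lt (E - κ - 1) hD1
    rw [← hn] at hdiv
    have hnE : n ≤ E := (Nat.div_le_self _ _).trans (by omega)
    have hmain : ∑ a ∈ Finset.range ℓ, (if ∀ i, ¬ (ℓ : ℤ) ∣ (F i).eval (a : ℤ) then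
        ‖∑ y ∈ Finset.range (ℓ ^ E), addExp (ℓ ^ E) (unitLog ℓ M F c (a + ℓ * y))‖ else 0) ≤
        D * (ℓ : ℝ) ^ (E + 1 - n) := by
      rcases Nat.eq_zero_or_pos n with h0 | h0
      · rw [h0, Nat.sub_zero]
        calc _ ≤ ∑ a ∈ Finset.range ℓ, (ℓ : ℝ) ^ E := by
              refine Finset.sum_le_sum fun a _ => ?_
              split_ifs
              · refine (norm_sum_le_of_le _ fun y _ => (norm_addExp _ _).le).trans ?_
                simp
              · positivity
          _ = 1 * (ℓ : ℝ) ^ (E + 1) := by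
              rw [Finset.sum_const, Finset.card_range, nsmul_eq_mul, pow_succ]; ring
          _ ≤ _ := by gcongr
      · have hE' : κ + 1 ≤ E := by
          by_contra h
          have : E - κ - 1 = 0 := by omega
          rw [this, Nat.zero_div] at hn
          omega
        have hD2 : (D - 1) * n + n = D * n := by
          obtain ⟨D', rfl⟩ : ∃ D', D = D' + 1 := ⟨D - 1, by omega⟩
          rw [Nat.add_sub_cancel]; ring
        refine (sum_norm_sum_unitLog_le (D := D - 1) (κ := κ) hℓ h0 (by omega) hEM F c (hRD c) hex).trans ?_
        gcongr
        exact Nat.sub_le _ _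
    refine hmain.trans ?_
    have hexp : ((E + 1 - n : ℕ) : ℝ) ≤ ((E : ℝ) + 1) * (1 - 1 / D) + (κ + 2 : ℕ) := by
      rw [Nat.cast_sub (by omega)]
      have h1 : E + 1 ≤ D * (n + κ + 2) := by
        have : E < D * n + D + κ + 1 := by omega
        nlinarith
      have h2 : ((E : ℝ) + 1) / D ≤ n + κ + 2 := by
        rw [div_le_iff₀ (by linarith)]
        have : ((E + 1 : ℕ) : ℝ) ≤ ((D * (n + κ + 2) : ℕ) : ℝ) := by exact_mod_cast h1
        push_cast at this
        linarith
      have e2 : ((E : ℝ) + 1) * (1 - 1 / D) = E + 1 - ((E : ℝ) + 1) / D := by ring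
      push_cast
      linarith
    calc (D : ℝ) * (ℓ : ℝ) ^ (E + 1 - n)
        = D * (ℓ : ℝ) ^ ((E + 1 - n : ℕ) : ℝ) := by rw [Real.rpow_natCast]
      _ ≤ D * (ℓ : ℝ) ^ (((E : ℝ) + 1) * (1 - 1 / D) + (κ + 2 : ℕ)) := by
          gcongr
      _ = D * ((ℓ : ℝ) ^ κ * (ℓ : ℝ) ^ 2) * (ℓ : ℝ) ^ (((E : ℝ) + 1) * (1 - 1 / D)) := by
          rw [Real.rpow_add hℓr0, Real.rpow_natCast, pow_add]; ring
      _ ≤ D * (Δ * L ^ 2) * (ℓ : ℝ) ^ (((E : ℝ) + 1) * (1 - 1 / D)) := by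
          have h1 : (ℓ : ℝ) ^ κ ≤ Δ := by exact_mod_cast hκΔ
          have h2 : (ℓ : ℝ) ≤ L := by exact_mod_cast hℓL
          gcongr
      _ = _ := by ring

/-- Every matrix over a field has a nonsingular square submatrix whose columns span all columns. -/
theorem exists_submatrix_det_ne_zero {k : Type*} [Field k] {K N : ℕ} (A : Matrix (Fin K) (Fin N) k) :
    ∃ (r : ℕ) (I : Fin r → Fin K) (J : Fin r → Fin N), (A.submatrix I J).det ≠ 0 ∧
      ∀ c : Fin K → k, (∀ t, ∑ i, c i * A i (J t) = 0) → ∀ j, ∑ i, c i * A i j = 0 := by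
  obtain ⟨r, g, hg, hspan, hli⟩ : ∃ (r : ℕ) (g : Fin r → Fin K → k), (∀ t, g t ∈ Set.range A.col) ∧
      Submodule.span k (Set.range g) = Submodule.span k (Set.range A.col) ∧ LinearIndependent k g :=
    ⟨_, Submodule.exists_fun_fin_finrank_span_eq k (Set.range A.col)⟩
  choose J hJ using hg
  set B : Matrix (Fin r) (Fin K) k := Matrix.of fun t i => A i (J t) with hB
  have hBg : B.row = g := by
    funext t
    rw [← hJ t]
    rfl
  have hBrank : B.rank = r := by
    have : LinearIndependent k B.row := by rw [hBg]; exact hli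
    rw [this.rank_matrix, Fintype.card_fin]
  have hB' := Submodule.exists_fun_fin_finrank_span_eq k (Set.range B.col)
  rw [← Matrix.rank_eq_finrank_span_cols, hBrank] at hB'
  obtain ⟨g', hg', -, hli'⟩ := hB'
  choose I hI using hg'
  refine ⟨r, I, J, ?_, ?_⟩
  · have h1 : LinearIndependent k (A.submatrix I J).row := by
      have : (A.submatrix I J).row = g' := by
        funext t
        rw [← hI t]
        rfl
      rw [this]
      exact hli'
    rw [Matrix.linearIndependent_rows_iff_isUnit, Matrix.isUnit_iff_isUnit_det] at h1
    exact h1.ne_zero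
  · intro c hc j
    let φ : (Fin K → k) →ₗ[k] k := ∑ i, c i • LinearMap.proj i
    have hφ : ∀ v, φ v = ∑ i, c i * v i := fun v => by simp [φ]
    have h1 : Submodule.span k (Set.range A.col) ≤ LinearMap.ker φ := by
      rw [← hspan, Submodule.span_le]
      rintro _ ⟨t, rfl⟩
      change φ (g t) = 0
      rw [hφ, ← hJ t]
      exact hc t
    have h2 : φ (A.col j) = 0 := h1 (Submodule.subset_span ⟨j, rfl⟩)
    rw [hφ] at h2
    exact h2

theorem eval_aeval_X {k : Type*} [Field k] {r : ℕ} (p : Fin r → k) (t : Fin r) (g : k[X]) :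
    MvPolynomial.eval p (aeval (MvPolynomial.X t : MvPolynomial (Fin r) k) g) = g.eval (p t) := by
  rw [← MvPolynomial.coe_aeval_eq_eval, RingHom.coe_coe, ← aeval_algHom_apply]
  simp

theorem totalDegree_aeval_X_le {k : Type*} [Field k] {r : ℕ} (t : Fin r) (g : k[X]) :
    (aeval (MvPolynomial.X t : MvPolynomial (Fin r) k) g).totalDegree ≤ g.natDegree := by
  rw [aeval_eq_sum_range]
  refine MvPolynomial.totalDegree_finsetSum_le fun i hi => ?_
  refine (MvPolynomial.totalDegree_smul_le _ _).trans ?_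
  rw [MvPolynomial.totalDegree_X_pow]
  exact Nat.lt_succ_iff.1 (Finset.mem_range.1 hi)

theorem pderiv_prod_aeval_X {k : Type*} [Field k] {r : ℕ} (g : Fin r → k[X]) (t : Fin r) :
    MvPolynomial.pderiv t (∏ s, aeval (MvPolynomial.X s : MvPolynomial (Fin r) k) (g s)) =
      aeval (MvPolynomial.X t) (derivative (g t)) *
        ∏ s ∈ Finset.univ.erase t, aeval (MvPolynomial.X s : MvPolynomial (Fin r) k) (g s) := by
  have h0 : ∀ T : Finset (Fin r), t ∉ T →
      MvPolynomial.pderiv t (∏ s ∈ T, aeval (MvPolynomial.X s : MvPolynomial (Fin r) k) (g s)) = 0 := by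
    intro T
    induction T using Finset.induction_on with
    | empty => intro _; simp
    | insert a T ha ih =>
      intro ht
      rw [Finset.mem_insert, not_or] at ht
      rw [Finset.prod_insert ha, Derivation.leibniz, ih ht.2, Derivation.map_aeval,
        MvPolynomial.pderiv_X_of_ne (Ne.symm ht.1)]
      simp
  rw [← Finset.mul_prod_erase Finset.univ _ (Finset.mem_univ t), Derivation.leibniz,
    h0 _ (Finset.notMem_erase _ _), Derivation.map_aeval, MvPolynomial.pderiv_X_self]
  simp [mul_comm]

theorem exists_card_le_of_det_ne_zero (N r d : ℕ) : ∃ B : ℕ, ∀ (k : Type) [Field k] [Fintype k]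
    (f : Fin r → Fin N → k[X]), (∀ s j, (f s j).natDegree ≤ d) → ∀ w : Fin r → k, (∀ s, w s ≠ 0) →
    ∀ J : Fin r → Fin N, Function.Injective J → ∀ S : Finset (Fin N → k),
    (∀ x ∈ S, ∀ s, ∏ j, (f s j).eval (x j) = w s) →
    (∀ x ∈ S, (Matrix.of fun s t => (derivative (f s (J t))).eval (x (J t)) /
      (f s (J t)).eval (x (J t))).det ≠ 0) →
    S.card ≤ B * Fintype.card k ^ (N - r) := by
  obtain ⟨B, hB⟩ := card_nonsingular_zeros_le r (r * d)
  refine ⟨B, fun k _ _ f hf w hw J hJ S hS hdet => ?_⟩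
  let π : (Fin N → k) → ({j // j ∉ Set.range J} → k) := fun x j => x j
  have hcard : Fintype.card ({j // j ∉ Set.range J} → k) = Fintype.card k ^ (N - r) := by
    rw [Fintype.card_fun, Fintype.card_subtype_compl, Set.card_range_of_injective hJ]
    simp
  refine (Finset.card_le_mul_card_image (f := π) S B ?_).trans
    (Nat.mul_le_mul_left _ ((Finset.card_le_univ _).trans hcard.le))
  intro b hb
  set T := S.filter fun a => π a = b with hT
  have hmem : ∀ x ∈ T, x ∈ S ∧ ∀ j (hj : j ∉ Set.range J), x j = b ⟨j, hj⟩ := by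
    intro x hx
    rw [hT, Finset.mem_filter] at hx
    exact ⟨hx.1, fun j hj => congrFun hx.2 ⟨j, hj⟩⟩
  let κ : Fin r → k := fun s => ∏ j : {j // j ∉ Set.range J}, (f s j).eval (b j)
  have hsplit : ∀ x ∈ T, ∀ s, ∏ j, (f s j).eval (x j) = κ s * ∏ t, (f s (J t)).eval (x (J t)) := by
    intro x hx s
    rw [← Fintype.prod_subtype_mul_prod_subtype (fun j => j ∉ Set.range J)]
    congr 1
    · exact Finset.prod_congr rfl fun j _ => by rw [(hmem x hx).2 j j.2]
    · let e : Fin r ≃ {j // ¬ j ∉ Set.range J} :=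
        (Equiv.ofInjective J hJ).trans (Equiv.subtypeEquivRight fun j => not_not.symm)
      exact (Equiv.prod_comp e (fun j : {j // ¬ j ∉ Set.range J} => (f s j).eval (x j))).symm
  let φ : Fin r → MvPolynomial (Fin r) k := fun s =>
    MvPolynomial.C (κ s) * (∏ t, aeval (MvPolynomial.X t : MvPolynomial (Fin r) k) (f s (J t))) -
      MvPolynomial.C (w s)
  have hinj : Set.InjOn (fun x : Fin N → k => x ∘ J) T := by
    intro x hx y hy hxy
    funext j
    by_cases hj : j ∈ Set.range J
    · obtain ⟨t, rfl⟩ := hj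
      exact congrFun hxy t
    · rw [(hmem x hx).2 j hj, (hmem y hy).2 j hj]
  rw [← Finset.card_image_of_injOn hinj]
  refine hB k φ ?_ _ ?_ ?_
  · intro s
    refine (MvPolynomial.totalDegree_sub_C_le _ _).trans ((MvPolynomial.totalDegree_mul _ _).trans ?_)
    rw [MvPolynomial.totalDegree_C, zero_add]
    refine (MvPolynomial.totalDegree_finsetProd _ _).trans ?_
    refine (Finset.sum_le_sum fun t _ => (totalDegree_aeval_X_le t _).trans (hf s (J t))).trans ?_
    simp
  · intro p hp s
    obtain ⟨x, hx, rfl⟩ := Finset.mem_image.1 hp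
    have h1 := hsplit x hx s
    rw [hS x (hmem x hx).1 s] at h1
    simp only [φ, map_sub, map_mul, map_prod, MvPolynomial.eval_C, eval_aeval_X, Function.comp_apply]
    rw [h1, sub_self]
  · intro p hp
    obtain ⟨x, hx, rfl⟩ := Finset.mem_image.1 hp
    have hxS := (hmem x hx).1
    have e : (Matrix.of fun s t => MvPolynomial.eval (x ∘ J) (MvPolynomial.pderiv t (φ s))) =
        Matrix.of fun s t => w s * (Matrix.of fun s t => (derivative (f s (J t))).eval (x (J t)) /
          (f s (J t)).eval (x (J t))) s t := by
      ext s t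
      have h1 := hsplit x hx s
      rw [hS x hxS s] at h1
      have hne : (f s (J t)).eval (x (J t)) ≠ 0 := by
        have := hw s
        rw [← hS x hxS s] at this
        exact Finset.prod_ne_zero_iff.1 this (J t) (Finset.mem_univ _)
      rw [← Finset.mul_prod_erase Finset.univ _ (Finset.mem_univ t)] at h1
      simp only [Matrix.of_apply, φ, map_sub, Derivation.leibniz, MvPolynomial.pderiv_C, pderiv_prod_aeval_X]
      simp only [smul_eq_mul, mul_zero, add_zero, map_zero, sub_zero, map_mul, map_prod, MvPolynomial.eval_C, eval_aeval_X,
        Function.comp_apply]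
      rw [h1]
      field_simp
    rw [e, Matrix.det_mul_column]
    exact mul_ne_zero (Finset.prod_ne_zero_iff.2 fun s _ => hw s) (hdet x hxS)

theorem eval_map_logDerivNum {K ℓ : ℕ} [Fact ℓ.Prime] (F : Fin K → ℤ[X]) (c : Fin K → ℤ) (x : ZMod ℓ)
    (hx : ∀ i, ((F i).map (Int.castRingHom (ZMod ℓ))).eval x ≠ 0) :
    ((logDerivNum F c).map (Int.castRingHom (ZMod ℓ))).eval x =
      (∏ i, ((F i).map (Int.castRingHom (ZMod ℓ))).eval x) *
        ∑ i, (c i : ZMod ℓ) * ((derivative ((F i).map (Int.castRingHom (ZMod ℓ)))).eval x /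
          ((F i).map (Int.castRingHom (ZMod ℓ))).eval x) := by
  rw [logDerivNum, Polynomial.map_sum, eval_finsetSum, Finset.mul_sum]
  refine Finset.sum_congr rfl fun i _ => ?_
  rw [Polynomial.map_mul, Polynomial.map_mul, map_C, ← derivative_map, Polynomial.map_prod, eval_mul, eval_mul,
    eval_C, eval_prod, ← Finset.mul_prod_erase Finset.univ _ (Finset.mem_univ i), eq_intCast]
  have := hx i
  field_simp

theorem card_le_of_card_fiber_le {k : Type*} [Fintype k] [DecidableEq k] {N r B : ℕ} (J : Fin r → Fin N)
    (S : Finset (Fin N → k)) (h : ∀ x₀ ∈ S, (S.filter fun x => x ∘ J = x₀ ∘ J).card ≤ B) :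
    S.card ≤ B * Fintype.card k ^ r := by
  refine (Finset.card_le_mul_card_image (f := fun x : Fin N → k => x ∘ J) S B ?_).trans
    (Nat.mul_le_mul_left _ ((Finset.card_le_univ _).trans (by simp)))
  intro b hb
  obtain ⟨x₀, hx₀, rfl⟩ := Finset.mem_image.1 hb
  exact h x₀ hx₀

set_option maxHeartbeats 1000000 in
/-- The bound for the number of solutions modulo a prime. -/
theorem exists_card_solutions_prime_le {K N D : ℕ} (hK : 1 ≤ K) (hN : 1 ≤ N)
    {F : Fin K → Fin N → ℤ[X]} (hF : ∀ i j, 0 < (F i j).natDegree)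
    (hind : ∀ j, MultIndep (fun i => F i j)) (hFD : ∀ j, ∑ i, (F i j).natDegree ≤ D) :
    ∃ B : ℝ, 0 < B ∧ ∀ ℓ : ℕ, ℓ.Prime → ∀ w : Fin K → ZMod ℓ, (∀ i, w i ≠ 0) →
      (Nat.card {v : Fin N → ZMod ℓ // ∀ i, ∏ j, aeval (v j) (F i j) = w i} : ℝ) ≤
        B * (ℓ : ℝ) ^ ((N : ℝ) - min (K : ℝ) ((N : ℝ) / D)) := by
  have hΔ' : ∀ j, ∃ Δ : ℕ, Δ ≠ 0 ∧ ∀ (c : Fin K → ℤ) (m : ℤ),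
      (∀ k, m ∣ (logDerivNum (fun i => F i j) c).coeff k) → ∀ i, m ∣ Δ * c i := fun j =>
    exists_dvd_mul_of_dvd_coeff_logDerivNum (fun i => hF i j) (hind j)
  choose Δ hΔ0 hΔ using hΔ'
  have hB' := fun r => exists_card_le_of_det_ne_zero N r D
  choose B hB using hB'
  have hKD : K ≤ D := by
    refine le_trans ?_ (hFD ⟨0, hN⟩)
    calc K = ∑ i : Fin K, 1 := by simp
      _ ≤ _ := Finset.sum_le_sum fun i _ => hF i _
  have hD1 : 1 ≤ D := hK.trans hKD
  have hDr : (1 : ℝ) ≤ D := by exact_mod_cast hD1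
  have hNr : (1 : ℝ) ≤ N := by exact_mod_cast hN
  set P := ∏ j, Δ j with hP
  have hP0 : P ≠ 0 := Finset.prod_ne_zero_iff.2 fun j _ => hΔ0 j
  set e : ℝ := (N : ℝ) - min (K : ℝ) ((N : ℝ) / D) with he
  have heND : (N : ℝ) - N / D ≤ e := sub_le_sub_left (min_le_right _ _) _
  have heNK : (N : ℝ) - K ≤ e := sub_le_sub_left (min_le_left _ _) _
  have hNDN : (N : ℝ) / D ≤ N := div_le_self (by linarith) hDr
  obtain ⟨C, hC⟩ : ∃ C : ℕ → ℝ, ∀ r, C r = (B r : ℝ) + (D : ℝ) ^ N := ⟨_, fun _ => rfl⟩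
  have hC0 : ∀ r, 0 ≤ C r := fun r => by
    rw [hC]
    positivity
  obtain ⟨B₂, hB₂⟩ : ∃ B₂ : ℝ, B₂ = ∑ r ∈ Finset.range (K + 1),
      ∑ _IJ : (Fin r → Fin K) × (Fin r → Fin N), C r := ⟨_, rfl⟩
  have hB₂0 : 0 ≤ B₂ := by
    rw [hB₂]
    exact Finset.sum_nonneg fun r _ => Finset.sum_nonneg fun _ _ => hC0 r
  have hPr : (0 : ℝ) < P := Nat.cast_pos.2 (Nat.pos_of_ne_zero hP0)
  refine ⟨(P : ℝ) ^ N + B₂, by positivity, ?_⟩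
  intro ℓ hℓ w hw
  have : Fact ℓ.Prime := ⟨hℓ⟩
  have hℓp : Prime (ℓ : ℤ) := Nat.prime_iff_prime_int.1 hℓ
  have hℓr : (1 : ℝ) ≤ ℓ := by exact_mod_cast hℓ.one_le
  have he0 : (1 : ℝ) ≤ (ℓ : ℝ) ^ e := Real.one_le_rpow hℓr (by linarith)
  let f : Fin K → Fin N → (ZMod ℓ)[X] := fun i j => (F i j).map (Int.castRingHom (ZMod ℓ))
  have haf : ∀ (x : ZMod ℓ) i j, aeval x (F i j) = (f i j).eval x := fun x i j => by
    rw [aeval_def, eval₂_eq_eval_map]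
    rfl
  simp only [haf]
  rw [add_mul]
  by_cases hbig : ℓ ∣ P
  · refine le_trans ?_ (le_add_of_nonneg_right (by positivity))
    have h1 : Nat.card {v : Fin N → ZMod ℓ // ∀ i, ∏ j, (f i j).eval (v j) = w i} ≤ ℓ ^ N := by
      refine (Finite.card_subtype_le _).trans (le_of_eq ?_)
      rw [Nat.card_eq_fintype_card]
      simp [ZMod.card]
    have h2 : ℓ ^ N ≤ P ^ N := Nat.pow_le_pow_left (Nat.le_of_dvd (Nat.pos_of_ne_zero hP0) hbig) N
    have h3 : (Nat.card {v : Fin N → ZMod ℓ // ∀ i, ∏ j, (f i j).eval (v j) = w i} : ℝ) ≤ (P : ℝ) ^ N := by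
      exact_mod_cast h1.trans h2
    exact h3.trans (le_mul_of_one_le_right (by positivity) he0)
  refine le_trans ?_ (le_add_of_nonneg_left (by positivity))
  have hΔℓ : ∀ j, ¬ ℓ ∣ Δ j := fun j h => hbig (h.trans (Finset.dvd_prod_of_mem _ (Finset.mem_univ j)))
  let S : Finset (Fin N → ZMod ℓ) := Finset.univ.filter fun v => ∀ i, ∏ j, (f i j).eval (v j) = w i
  have hS : ∀ x ∈ S, ∀ i, ∏ j, (f i j).eval (x j) = w i := fun x hx => (Finset.mem_filter.1 hx).2
  have hne : ∀ x ∈ S, ∀ i j, (f i j).eval (x j) ≠ 0 := fun x hx i j => by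
    have := hw i
    rw [← hS x hx i] at this
    exact Finset.prod_ne_zero_iff.1 this j (Finset.mem_univ _)
  let H : (Fin N → ZMod ℓ) → Matrix (Fin K) (Fin N) (ZMod ℓ) := fun x =>
    Matrix.of fun i j => (derivative (f i j)).eval (x j) / (f i j).eval (x j)
  let T : ∀ r : ℕ, (Fin r → Fin K) × (Fin r → Fin N) → Finset (Fin N → ZMod ℓ) := fun r IJ =>
    S.filter fun x => ((H x).submatrix IJ.1 IJ.2).det ≠ 0 ∧
      ∀ c : Fin K → ZMod ℓ, (∀ t, ∑ i, c i * H x i (IJ.2 t) = 0) → ∀ j, ∑ i, c i * H x i j = 0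
  have hcover : S ⊆ (Finset.range (K + 1)).biUnion fun r => Finset.univ.biUnion fun IJ => T r IJ := by
    intro x hx
    obtain ⟨r, I, J, hdet, hc⟩ := exists_submatrix_det_ne_zero (H x)
    have hI : Function.Injective I := by
      intro s t hst
      by_contra hne
      exact hdet (Matrix.det_zero_of_row_eq hne (by funext u; simp [hst]))
    have hrK : r ≤ K := by simpa using Fintype.card_le_of_injective I hI
    simp only [Finset.mem_biUnion, Finset.mem_range]
    exact ⟨r, by omega, (I, J), Finset.mem_univ _, Finset.mem_filter.2 ⟨hx, hdet, hc⟩⟩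
  have hT : ∀ r IJ, r ≤ K → ((T r IJ).card : ℝ) ≤ C r * (ℓ : ℝ) ^ e := by
    rintro r ⟨I, J⟩ hrK
    rw [hC, add_mul]
    rcases (T r (I, J)).eq_empty_or_nonempty with h0 | ⟨x₁, hx₁⟩
    · rw [h0, Finset.card_empty, Nat.cast_zero]
      positivity
    have hJ : Function.Injective J := by
      intro s t hst
      by_contra hne
      refine (Finset.mem_filter.1 hx₁).2.1 (Matrix.det_zero_of_column_eq hne fun u => ?_)
      simp [hst]
    have hrN : r ≤ N := by simpa using Fintype.card_le_of_injective J hJ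
    by_cases hcase : r = K ∨ (N ≤ 2 * r ∧ 2 ≤ D)
    · refine le_trans ?_ (le_add_of_nonneg_right (by positivity))
      have h1 := hB r (ZMod ℓ) (fun s j => f (I s) j) (fun s j => natDegree_map_le.trans
        ((Finset.single_le_sum (f := fun i => (F i j).natDegree) (fun _ _ => Nat.zero_le _)
          (Finset.mem_univ _)).trans (hFD j))) (fun s => w (I s)) (fun s => hw _) J hJ (T r (I, J))
        (fun x hx s => hS x (Finset.mem_filter.1 hx).1 _) (fun x hx => (Finset.mem_filter.1 hx).2.1)
      rw [ZMod.card] at h1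
      have h2 : ((T r (I, J)).card : ℝ) ≤ B r * (ℓ : ℝ) ^ ((N - r : ℕ) : ℝ) := by
        rw [Real.rpow_natCast]; exact_mod_cast h1
      refine h2.trans (mul_le_mul_of_nonneg_left (Real.rpow_le_rpow_of_exponent_le hℓr ?_) (by positivity))
      rw [Nat.cast_sub hrN]
      rcases hcase with rfl | ⟨h3, h4⟩
      · exact heNK
      · have h3' : (N : ℝ) ≤ 2 * r := by exact_mod_cast h3
        have h4' : (2 : ℝ) ≤ D := by exact_mod_cast h4
        have : (N : ℝ) / D ≤ N / 2 := div_le_div_of_nonneg_left (by linarith) (by norm_num) h4'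
        linarith
    · refine le_trans ?_ (le_add_of_nonneg_left (by positivity))
      have hrK' : r < K := by omega
      have h1 : (T r (I, J)).card ≤ D ^ N * Fintype.card (ZMod ℓ) ^ r := by
        refine card_le_of_card_fiber_le J _ fun x₀ hx₀ => ?_
        let φ : (Fin K → ZMod ℓ) →ₗ[ZMod ℓ] (Fin r → ZMod ℓ) :=
          LinearMap.pi fun t => ∑ i, H x₀ i (J t) • LinearMap.proj i
        have hφ : ∀ c t, φ c t = ∑ i, c i * H x₀ i (J t) := fun c t => by simp [φ, mul_comm]
        obtain ⟨c, hcker, hc0⟩ := Submodule.exists_mem_ne_zero_of_ne_bot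
          (LinearMap.ker_ne_bot_of_finrank_lt (f := φ) (by simpa using hrK'))
        obtain ⟨i₀, hi₀⟩ : ∃ i, c i ≠ 0 := Function.ne_iff.1 hc0
        let c' : Fin K → ℤ := fun i => ((c i).val : ℤ)
        have hc' : ∀ i, ((c' i : ℤ) : ZMod ℓ) = c i := fun i => by simp [c']
        let R : Fin N → (ZMod ℓ)[X] := fun j =>
          (logDerivNum (fun i => F i j) c').map (Int.castRingHom (ZMod ℓ))
        have hR0 : ∀ j, R j ≠ 0 := by
          intro j h
          have h1 := hΔ j c' ℓ (fun k => by
            rw [← intCast_eq_zero_iff_dvd, ← eq_intCast (Int.castRingHom (ZMod ℓ)), ← coeff_map]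
            change (R j).coeff k = 0
            rw [h, coeff_zero]) i₀
          rcases hℓp.dvd_or_dvd h1 with h2 | h2
          · exact hΔℓ j (Int.natCast_dvd_natCast.1 h2)
          · rw [← intCast_eq_zero_iff_dvd, hc'] at h2
            exact hi₀ h2
        refine (Finset.card_le_card (t := Fintype.piFinset fun j => (R j).roots.toFinset)
          fun x hx => ?_).trans ?_
        · obtain ⟨hxT, hxJ⟩ := Finset.mem_filter.1 hx
          obtain ⟨hxS, -, hxc⟩ := Finset.mem_filter.1 hxT
          rw [Fintype.mem_piFinset]
          intro j
          rw [Multiset.mem_toFinset, mem_roots (hR0 j), IsRoot.def,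
            eval_map_logDerivNum (fun i => F i j) c' (x j) (fun i => hne x hxS i j)]
          simp only [hc']
          refine mul_eq_zero_of_right _ (hxc c (fun t => ?_) j)
          have h2 := congrFun (LinearMap.mem_ker.1 hcker) t
          rw [hφ] at h2
          have h3 : x (J t) = x₀ (J t) := congrFun hxJ t
          simp only [H, Matrix.of_apply] at h2 ⊢
          rw [h3]
          exact h2
        rw [Fintype.card_piFinset]
        refine (Finset.prod_le_pow_card _ _ D fun j _ => ?_).trans (by simp)
        refine (Multiset.toFinset_card_le _).trans ((card_roots' _).trans (natDegree_map_le.trans ?_))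
        exact (natDegree_logDerivNum_le (fun i => hF i j) c').trans ((Nat.sub_le _ _).trans (hFD j))
      rw [ZMod.card] at h1
      have h2 : ((T r (I, J)).card : ℝ) ≤ (D : ℝ) ^ N * (ℓ : ℝ) ^ (r : ℝ) := by
        rw [Real.rpow_natCast]; exact_mod_cast h1
      refine h2.trans (mul_le_mul_of_nonneg_left (Real.rpow_le_rpow_of_exponent_le hℓr ?_) (by positivity))
      by_cases hD2 : 2 ≤ D
      · have h3 : 2 * r ≤ N := by
          by_contra h
          exact hcase (Or.inr ⟨by omega, hD2⟩)
        have h3' : 2 * (r : ℝ) ≤ N := by exact_mod_cast h3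
        have h4' : (2 : ℝ) ≤ D := by exact_mod_cast hD2
        have : (N : ℝ) / D ≤ N / 2 := div_le_div_of_nonneg_left (by linarith) (by norm_num) h4'
        linarith
      · have : r = 0 := by omega
        rw [this, Nat.cast_zero]
        linarith
  have hcardS : Nat.card {v : Fin N → ZMod ℓ // ∀ i, ∏ j, (f i j).eval (v j) = w i} = S.card := by
    rw [Nat.card_eq_fintype_card, Fintype.card_subtype]
  rw [hcardS, hB₂, Finset.sum_mul]
  calc (S.card : ℝ) ≤ ((∑ r ∈ Finset.range (K + 1), ∑ IJ, (T r IJ).card : ℕ) : ℝ) := by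
        have := (Finset.card_le_card hcover).trans (Finset.card_biUnion_le.trans
          (Finset.sum_le_sum fun r _ => Finset.card_biUnion_le))
        exact_mod_cast this
    _ ≤ _ := by
        push_cast
        refine Finset.sum_le_sum fun r hr => ?_
        rw [Finset.sum_mul]
        exact Finset.sum_le_sum fun IJ _ => hT r IJ (by have := Finset.mem_range.1 hr; omega)

/-- The Fermat quotient of `u` modulo `ℓ ^ M`, a discrete logarithm on integers prime to `ℓ`. -/
def fermatLog (ℓ M : ℕ) (u : ℤ) : ℤ := (u ^ (ℓ ^ M).totient - 1) / (ℓ : ℤ) ^ M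

theorem pow_totient_eq {ℓ M : ℕ} (hℓ : ℓ.Prime) {u : ℤ} (hu : ¬ (ℓ : ℤ) ∣ u) :
    u ^ (ℓ ^ M).totient = 1 + (ℓ : ℤ) ^ M * fermatLog ℓ M u := by
  have h1 : (ℓ : ℤ) ^ M ∣ u ^ (ℓ ^ M).totient - 1 := by
    rcases Nat.eq_zero_or_pos M with rfl | hM
    · simp
    · have := map_dvd (evalRingHom 0) (C_pow_dvd_pow_totient_sub_one hℓ hM (G := C u) (g := u) (by simp) hu)
      simpa using this
  rw [fermatLog, Int.mul_ediv_cancel' h1]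
  ring

theorem dvd_fermatLog_mul_sub {ℓ M : ℕ} (hℓ : ℓ.Prime) {u v : ℤ} (hu : ¬ (ℓ : ℤ) ∣ u)
    (hv : ¬ (ℓ : ℤ) ∣ v) : (ℓ : ℤ) ^ M ∣ fermatLog ℓ M (u * v) - (fermatLog ℓ M u + fermatLog ℓ M v) := by
  have huv : ¬ (ℓ : ℤ) ∣ u * v := (Nat.prime_iff_prime_int.1 hℓ).not_dvd_mul hu hv
  have h := pow_totient_eq (M := M) hℓ huv
  rw [mul_pow, pow_totient_eq hℓ hu, pow_totient_eq hℓ hv] at h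
  have h0 : (ℓ : ℤ) ^ M ≠ 0 := pow_ne_zero _ (by exact_mod_cast hℓ.ne_zero)
  refine ⟨fermatLog ℓ M u * fermatLog ℓ M v, mul_left_cancel₀ h0 ?_⟩
  linear_combination -h

theorem dvd_fermatLog_sub {ℓ M E : ℕ} (hℓ : ℓ.Prime) (hM : 1 ≤ M) {u v : ℤ} (hu : ¬ (ℓ : ℤ) ∣ u)
    (h : (ℓ : ℤ) ^ (E + 1) ∣ v - u) : (ℓ : ℤ) ^ E ∣ fermatLog ℓ M v - fermatLog ℓ M u := by
  obtain ⟨z, hz⟩ := h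
  obtain ⟨Λ, hΛ, -⟩ := exists_unitLog_eq_eval hℓ hM le_rfl (fun _ : Fin 1 => (X : ℤ[X])) u
    (fun _ => by simpa using hu) (fun _ => 1)
  have h1 := hΛ (ℓ ^ E * z)
  have h2 := hΛ 0
  simp only [unitLog, Finset.univ_unique, Finset.sum_const, Finset.card_singleton, one_smul, one_mul,
    eval_X, mul_zero, add_zero] at h1 h2
  rw [show u + (ℓ : ℤ) ^ 1 * (ℓ ^ E * z) = v by linear_combination -hz] at h1
  rw [fermatLog, fermatLog, h1, h2]
  have := Polynomial.sub_dvd_eval_sub ((ℓ : ℤ) ^ E * z) 0 Λ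
  rw [sub_zero] at this
  exact (Dvd.intro _ rfl).trans this

theorem dvd_fermatLog_prod_sub {ι : Type*} {ℓ M : ℕ} (hℓ : ℓ.Prime) (s : Finset ι) (u : ι → ℤ)
    (hu : ∀ i ∈ s, ¬ (ℓ : ℤ) ∣ u i) :
    (ℓ : ℤ) ^ M ∣ fermatLog ℓ M (∏ i ∈ s, u i) - ∑ i ∈ s, fermatLog ℓ M (u i) := by
  induction s using Finset.induction_on with
  | empty => simp [fermatLog]
  | insert a s ha ih =>
    rw [Finset.prod_insert ha, Finset.sum_insert ha]
    have h1 := dvd_fermatLog_mul_sub (M := M) hℓ (hu a (Finset.mem_insert_self a s))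
      (v := ∏ i ∈ s, u i) (by
        rw [(Nat.prime_iff_prime_int.1 hℓ).dvd_finsetProd_iff]
        rintro ⟨i, hi, h⟩
        exact hu i (Finset.mem_insert_of_mem hi) h)
    have h2 := ih fun i hi => hu i (Finset.mem_insert_of_mem hi)
    obtain ⟨a, ha⟩ := h1
    obtain ⟨b, hb⟩ := h2
    exact ⟨a + b, by linear_combination ha + hb⟩

theorem dvd_sum_fermatLog_sub {ι : Type*} [Fintype ι] {ℓ M E : ℕ} (hℓ : ℓ.Prime) (hM : 1 ≤ M) (hEM : E ≤ M)
    {u : ι → ℤ} {w : ℤ} (hw : ¬ (ℓ : ℤ) ∣ w) (h : (ℓ : ℤ) ^ (E + 1) ∣ ∏ i, u i - w) :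
    (ℓ : ℤ) ^ E ∣ ∑ i, fermatLog ℓ M (u i) - fermatLog ℓ M w := by
  have hu : ∀ i ∈ Finset.univ, ¬ (ℓ : ℤ) ∣ u i := fun i _ hi => hw <| by
    have h1 : (ℓ : ℤ) ∣ ∏ i, u i := hi.trans (Finset.dvd_prod_of_mem u (Finset.mem_univ i))
    exact (dvd_sub_right h1).1 ((dvd_pow_self _ (Nat.succ_ne_zero E)).trans h)
  have h1 := (pow_dvd_pow (ℓ : ℤ) hEM).trans (dvd_fermatLog_prod_sub (M := M) hℓ Finset.univ u hu)
  have h2 := dvd_fermatLog_sub hℓ hM hw h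
  obtain ⟨a, ha⟩ := h1
  obtain ⟨b, hb⟩ := h2
  exact ⟨b - a, by linear_combination hb - ha⟩

theorem unitLog_eq_sum_fermatLog {K : ℕ} (ℓ M : ℕ) (F : Fin K → ℤ[X]) (c : Fin K → ℤ) (v : ℤ) :
    unitLog ℓ M F c v = ∑ i, c i * fermatLog ℓ M ((F i).eval v) := rfl

theorem addExp_sum {ι : Type*} (q : ℕ) (s : Finset ι) (x : ι → ℤ) :
    addExp q (∑ i ∈ s, x i) = ∏ i ∈ s, addExp q (x i) := by
  induction s using Finset.induction_on with
  | empty => simp [addExp]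
  | insert a s ha ih => rw [Finset.sum_insert ha, Finset.prod_insert ha, addExp_add, ih]

theorem sum_addExp_mul {q : ℕ} (hq : 0 < q) (x : ℤ) :
    ∑ c ∈ Finset.range q, addExp q (c * x) = if (q : ℤ) ∣ x then (q : ℂ) else 0 := by
  have : NeZero q := ⟨hq.ne'⟩
  have h1 : ∀ c : ℕ, addExp q (c * x) = ZMod.stdAddChar ((c : ZMod q) * (x : ZMod q)) := fun c => by
    rw [addExp_eq_stdAddChar]
    push_cast
    rfl
  simp only [h1]
  rw [sum_range_eq_sum_zmod q fun c => ZMod.stdAddChar (c * (x : ZMod q)),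
    AddChar.sum_mulShift _ (ZMod.isPrimitive_stdAddChar q), ZMod.card]
  simp only [ZMod.intCast_zmod_eq_zero_iff_dvd]
  push_cast
  rfl

theorem sum_piFinset_addExp {K q : ℕ} (hq : 0 < q) (x : Fin K → ℤ) :
    ∑ c ∈ Fintype.piFinset fun _ : Fin K => Finset.range q, addExp q (∑ i, (c i : ℤ) * x i) =
      if ∀ i, (q : ℤ) ∣ x i then (q : ℂ) ^ K else 0 := by
  simp only [addExp_sum]
  rw [← Finset.prod_univ_sum (fun _ => Finset.range q) fun i c => addExp q ((c : ℤ) * x i)]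
  simp only [sum_addExp_mul hq]
  split_ifs with h
  · simp [h]
  · push Not at h
    obtain ⟨i, hi⟩ := h
    exact Finset.prod_eq_zero (Finset.mem_univ i) (if_neg hi)

/-- The solutions modulo `q`, as tuples of least nonnegative residues. -/
def solBox {K N : ℕ} (q : ℕ) (F : Fin K → Fin N → ℤ[X]) (W : Fin K → ℤ) : Finset (Fin N → ℕ) :=
  (Fintype.piFinset fun _ => Finset.range q).filter fun v =>
    ∀ i, (q : ℤ) ∣ ∏ j, (F i j).eval (v j : ℤ) - W i

theorem mem_solBox {K N q : ℕ} {F : Fin K → Fin N → ℤ[X]} {W : Fin K → ℤ} {v : Fin N → ℕ} :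
    v ∈ solBox q F W ↔ (∀ j, v j < q) ∧ ∀ i, (q : ℤ) ∣ ∏ j, (F i j).eval (v j : ℤ) - W i := by
  simp [solBox]

theorem not_dvd_eval_of_mem_solBox {K N ℓ : ℕ} {F : Fin K → Fin N → ℤ[X]} {W : Fin K → ℤ}
    (hW : ∀ i, ¬ (ℓ : ℤ) ∣ W i) {v : Fin N → ℕ} (hv : v ∈ solBox ℓ F W) (i : Fin K) (j : Fin N) :
    ¬ (ℓ : ℤ) ∣ (F i j).eval (v j : ℤ) := fun h =>
  hW i <| (dvd_sub_right (h.trans (Finset.dvd_prod_of_mem (fun j => (F i j).eval (v j : ℤ))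
    (Finset.mem_univ j)))).1 ((mem_solBox.1 hv).2 i)

/-- Lifting solutions from `ℓ` to `ℓ ^ (E + 1)`: the nonlinear conditions imply linear conditions on
discrete logarithms. -/
theorem card_solBox_pow_le {K N ℓ E M : ℕ} (hℓ : ℓ.Prime) (hM : 1 ≤ M) (hEM : E ≤ M)
    (F : Fin K → Fin N → ℤ[X]) {W : Fin K → ℤ} (hW : ∀ i, ¬ (ℓ : ℤ) ∣ W i) :
    (solBox (ℓ ^ (E + 1)) F W).card ≤
      ((solBox ℓ F W ×ˢ Fintype.piFinset fun _ : Fin N => Finset.range (ℓ ^ E)).filter fun p =>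
        ∀ i, ((ℓ ^ E : ℕ) : ℤ) ∣ ∑ j, fermatLog ℓ M ((F i j).eval ((p.1 j : ℤ) + ℓ * p.2 j)) -
          fermatLog ℓ M (W i)).card := by
  refine Finset.card_le_card_of_injOn (fun v => (fun j => v j % ℓ, fun j => v j / ℓ)) ?_ ?_
  · intro v hv
    obtain ⟨hv1, hv2⟩ := mem_solBox.1 hv
    have hsplit : ∀ j, ((v j % ℓ : ℕ) : ℤ) + ℓ * ((v j / ℓ : ℕ) : ℤ) = v j := fun j => by
      exact_mod_cast Nat.mod_add_div (v j) ℓ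
    refine Finset.mem_coe.2 (Finset.mem_filter.2 ⟨Finset.mem_product.2 ⟨mem_solBox.2 ⟨fun j =>
      Nat.mod_lt _ hℓ.pos, fun i => ?_⟩, Fintype.mem_piFinset.2 fun j => Finset.mem_range.2 ?_⟩, ?_⟩)
    · have h1 : (ℓ : ℤ) ∣ ∏ j, (F i j).eval (v j : ℤ) - W i := by
        refine dvd_trans ?_ (hv2 i)
        push_cast
        exact dvd_pow_self _ (Nat.succ_ne_zero E)
      rw [← ZMod.intCast_zmod_eq_zero_iff_dvd] at h1 ⊢
      rw [← h1]
      push_cast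
      congr 1
      refine Finset.prod_congr rfl fun j _ => ?_
      have h2 : (ℓ : ℤ) ∣ (F i j).eval ((v j % ℓ : ℕ) : ℤ) - (F i j).eval (v j : ℤ) := by
        refine dvd_trans ?_ (Polynomial.sub_dvd_eval_sub _ _ _)
        exact ⟨-((v j / ℓ : ℕ) : ℤ), by linear_combination hsplit j⟩
      rw [← sub_eq_zero, ← Int.cast_sub]
      exact (ZMod.intCast_zmod_eq_zero_iff_dvd _ _).2 (by exact_mod_cast h2)
    · refine Nat.div_lt_of_lt_mul ?_
      rw [← pow_succ']
      exact hv1 j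
    · intro i
      simp only [hsplit]
      push_cast
      exact dvd_sum_fermatLog_sub hℓ hM hEM (hW i) (by exact_mod_cast hv2 i)
  · intro v _ v' _ h
    obtain ⟨h1, h2⟩ := Prod.mk.inj h
    funext j
    rw [← Nat.mod_add_div (v j) ℓ, ← Nat.mod_add_div (v' j) ℓ]
    have h1 : v j % ℓ = v' j % ℓ := congrFun h1 j
    have h2 : v j / ℓ = v' j / ℓ := congrFun h2 j
    rw [h1, h2]

theorem card_solBox_pow_mul_le {K N ℓ E M : ℕ} (hℓ : ℓ.Prime) (hM : 1 ≤ M) (hEM : E ≤ M)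
    (F : Fin K → Fin N → ℤ[X]) {W : Fin K → ℤ} (hW : ∀ i, ¬ (ℓ : ℤ) ∣ W i) :
    ((solBox (ℓ ^ (E + 1)) F W).card : ℝ) * ((ℓ : ℝ) ^ E) ^ K ≤
      ((solBox ℓ F W).card : ℝ) * ((ℓ : ℝ) ^ E) ^ N +
      ∑ c ∈ (Fintype.piFinset fun _ : Fin K => Finset.range (ℓ ^ E)).erase 0, ∏ j,
        ∑ a ∈ Finset.range ℓ, if ∀ i, ¬ (ℓ : ℤ) ∣ (F i j).eval (a : ℤ) then
          ‖∑ y ∈ Finset.range (ℓ ^ E), addExp (ℓ ^ E)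
            (unitLog ℓ M (fun i => F i j) (fun i => (c i : ℤ)) (a + ℓ * y))‖ else 0 := by
  have hq : 0 < ℓ ^ E := pow_pos hℓ.pos E
  let Sc : (Fin K → ℕ) → Fin N → ℕ → ℂ := fun c j a => ∑ y ∈ Finset.range (ℓ ^ E), addExp (ℓ ^ E)
    (unitLog ℓ M (fun i => F i j) (fun i => (c i : ℤ)) (a + ℓ * y))
  let x : (Fin N → ℕ) × (Fin N → ℕ) → Fin K → ℤ := fun p i =>
    ∑ j, fermatLog ℓ M ((F i j).eval ((p.1 j : ℤ) + ℓ * p.2 j)) - fermatLog ℓ M (W i)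
  let ω : (Fin K → ℕ) → ℤ := fun c => ∑ i, (c i : ℤ) * fermatLog ℓ M (W i)
  have h0 := card_solBox_pow_le hℓ hM hEM F hW
  have h1 : ((((solBox ℓ F W ×ˢ Fintype.piFinset fun _ : Fin N => Finset.range (ℓ ^ E)).filter
      fun p => ∀ i, ((ℓ ^ E : ℕ) : ℤ) ∣ x p i).card : ℕ) : ℂ) * ((ℓ ^ E : ℕ) : ℂ) ^ K =
      ∑ c ∈ Fintype.piFinset fun _ : Fin K => Finset.range (ℓ ^ E),
        addExp (ℓ ^ E) (-ω c) * ∑ a ∈ solBox ℓ F W, ∏ j, Sc c j (a j) := by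
    rw [Finset.card_filter, Nat.cast_sum, Finset.sum_mul]
    calc _ = ∑ p ∈ solBox ℓ F W ×ˢ Fintype.piFinset fun _ : Fin N => Finset.range (ℓ ^ E),
          ∑ c ∈ Fintype.piFinset fun _ : Fin K => Finset.range (ℓ ^ E),
            addExp (ℓ ^ E) (∑ i, (c i : ℤ) * x p i) := by
          refine Finset.sum_congr rfl fun p _ => ?_
          rw [sum_piFinset_addExp hq]
          split_ifs <;> simp
      _ = _ := by
          rw [Finset.sum_comm]
          refine Finset.sum_congr rfl fun c _ => ?_
          rw [Finset.sum_product, Finset.mul_sum]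
          refine Finset.sum_congr rfl fun a _ => ?_
          simp only [Sc]
          rw [Finset.prod_univ_sum, Finset.mul_sum]
          refine Finset.sum_congr rfl fun y _ => ?_
          rw [← addExp_sum, ← addExp_add]
          congr 1
          simp only [x, ω, unitLog_eq_sum_fermatLog, mul_sub, Finset.sum_sub_distrib, Finset.mul_sum]
          rw [Finset.sum_comm]
          ring
  have h2 : (((solBox (ℓ ^ (E + 1)) F W).card : ℝ) * ((ℓ : ℝ) ^ E) ^ K) ≤
      ∑ c ∈ Fintype.piFinset fun _ : Fin K => Finset.range (ℓ ^ E),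
        ∑ a ∈ solBox ℓ F W, ∏ j, ‖Sc c j (a j)‖ := by
    calc _ ≤ (((solBox ℓ F W ×ˢ Fintype.piFinset fun _ : Fin N => Finset.range (ℓ ^ E)).filter
          fun p => ∀ i, ((ℓ ^ E : ℕ) : ℤ) ∣ x p i).card : ℝ) * ((ℓ : ℝ) ^ E) ^ K :=
          mul_le_mul_of_nonneg_right (by exact_mod_cast h0) (by positivity)
      _ = ‖((((solBox ℓ F W ×ˢ Fintype.piFinset fun _ : Fin N => Finset.range (ℓ ^ E)).filter
          fun p => ∀ i, ((ℓ ^ E : ℕ) : ℤ) ∣ x p i).card : ℕ) : ℂ) * ((ℓ ^ E : ℕ) : ℂ) ^ K‖ := by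
          rw [norm_mul, norm_pow, Complex.norm_natCast, Complex.norm_natCast]
          push_cast
          rfl
      _ ≤ _ := by
          rw [h1]
          refine (norm_sum_le _ _).trans (Finset.sum_le_sum fun c _ => ?_)
          rw [norm_mul, norm_addExp, one_mul]
          refine (norm_sum_le _ _).trans (Finset.sum_le_sum fun a _ => ?_)
          rw [norm_prod]
  have hmem : (0 : Fin K → ℕ) ∈ Fintype.piFinset fun _ : Fin K => Finset.range (ℓ ^ E) := by
    simp [hℓ.pos]
  refine h2.trans ?_
  rw [← Finset.add_sum_erase _ _ hmem]
  refine add_le_add (le_of_eq ?_) (Finset.sum_le_sum fun c _ => ?_)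
  · rw [← nsmul_eq_mul]
    refine Finset.sum_eq_card_nsmul fun a _ => ?_
    rw [Finset.prod_eq_pow_card (b := (ℓ : ℝ) ^ E), Finset.card_univ, Fintype.card_fin]
    intro j _
    simp [Sc, unitLog, addExp]
  · rw [Finset.prod_univ_sum]
    calc _ = ∑ a ∈ solBox ℓ F W, ∏ j, (if ∀ i, ¬ (ℓ : ℤ) ∣ (F i j).eval (a j : ℤ) then
            ‖Sc c j (a j)‖ else 0) := by
          refine Finset.sum_congr rfl fun a ha => Finset.prod_congr rfl fun j _ => ?_
          rw [if_pos fun i => not_dvd_eval_of_mem_solBox hW ha i j]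
      _ ≤ _ := by
          refine Finset.sum_le_sum_of_subset_of_nonneg (Finset.filter_subset _ _) fun a _ _ =>
            Finset.prod_nonneg fun j _ => ?_
          split_ifs
          · exact norm_nonneg _
          · exact le_rfl

theorem sum_addExp_unitLog_pow_mul {K ℓ E t M : ℕ} (hℓ : ℓ.Prime) (hM : 1 ≤ M) (F : Fin K → ℤ[X])
    (c : Fin K → ℤ) {a : ℤ} (ha : ∀ i, ¬ (ℓ : ℤ) ∣ (F i).eval a) :
    ∑ y ∈ Finset.range (ℓ ^ (E + t)), addExp (ℓ ^ (E + t))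
        (unitLog ℓ M F (fun i => (ℓ : ℤ) ^ t * c i) (a + ℓ * y)) =
      (ℓ : ℂ) ^ t * ∑ y ∈ Finset.range (ℓ ^ E), addExp (ℓ ^ E) (unitLog ℓ M F c (a + ℓ * y)) := by
  have hne : NeZero (ℓ ^ E) := ⟨pow_ne_zero _ hℓ.ne_zero⟩
  obtain ⟨Λ, hΛ, -⟩ := exists_unitLog_eq_eval hℓ hM le_rfl F a ha c
  rw [pow_one] at hΛ
  have h1 : ∀ v, unitLog ℓ M F (fun i => (ℓ : ℤ) ^ t * c i) v =
      ((ℓ ^ t : ℕ) : ℤ) * unitLog ℓ M F c v := fun v => by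
    simp only [unitLog, mul_assoc, Finset.mul_sum]
    push_cast
    rfl
  have h2 : ∀ x : ℤ, addExp (ℓ ^ (E + t)) (((ℓ ^ t : ℕ) : ℤ) * x) = addExp (ℓ ^ E) x := fun x => by
    rw [pow_add, mul_comm (ℓ ^ E), addExp_mul_left (pow_ne_zero _ hℓ.ne_zero)]
  simp only [h1, h2, hΛ]
  rw [pow_add, sum_range_mul_eq, Finset.mul_sum]
  refine Finset.sum_congr rfl fun y _ => ?_
  have h3 : ∀ z ∈ Finset.range (ℓ ^ t), addExp (ℓ ^ E) (Λ.eval ((y + ℓ ^ E * z : ℕ) : ℤ)) =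
      addExp (ℓ ^ E) (Λ.eval (y : ℤ)) := fun z _ => by
    refine addExp_congr (dvd_trans ?_ (Polynomial.sub_dvd_eval_sub _ _ _))
    push_cast
    exact ⟨z, by ring⟩
  rw [Finset.sum_congr rfl h3, Finset.sum_const, Finset.card_range, nsmul_eq_mul]
  push_cast
  rfl

theorem exists_eq_pow_mul_of_ne_zero {K ℓ : ℕ} (E : ℕ) (c : Fin K → ℕ) (hc : c ≠ 0)
    (hcE : ∀ i, c i < ℓ ^ E) : ∃ (t : ℕ) (c' : Fin K → ℕ), t < E ∧ (∀ i, c' i < ℓ ^ (E - t)) ∧ (∃ j, ¬ ℓ ∣ c' j) ∧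
      c = fun i => ℓ ^ t * c' i := by
  induction E generalizing c with
  | zero => exact absurd (funext fun i => by simpa using hcE i) hc
  | succ E ih =>
    by_cases h : ∃ j, ¬ ℓ ∣ c j
    · exact ⟨0, c, Nat.succ_pos E, by simpa using hcE, h, by simp⟩
    · push Not at h
      choose d hd using h
      obtain ⟨t, c', h1, h2, h3, h4⟩ := ih d (by
        rintro rfl
        exact hc (funext fun i => by simp [hd])) fun i => by
          have := hcE i
          rw [hd, pow_succ'] at this
          exact Nat.lt_of_mul_lt_mul_left this
      refine ⟨t + 1, c', by omega, fun i => ?_, h3, funext fun i => ?_⟩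
      · rw [Nat.add_sub_add_right]
        exact h2 i
      · rw [hd, h4, pow_succ']
        ring

theorem sum_erase_zero_le {K ℓ : ℕ} (E : ℕ) (g : (Fin K → ℕ) → ℝ) (hg : ∀ c, 0 ≤ g c) :
    ∑ c ∈ (Fintype.piFinset fun _ : Fin K => Finset.range (ℓ ^ E)).erase 0, g c ≤
      ∑ t ∈ Finset.range E, ∑ c ∈ (Fintype.piFinset fun _ : Fin K => Finset.range (ℓ ^ (E - t))).filter
        (fun c => ∃ j, ¬ ℓ ∣ c j), g fun i => ℓ ^ t * c i := by
  rw [Finset.sum_sigma']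
  set T := (Finset.range E).sigma fun t =>
    (Fintype.piFinset fun _ : Fin K => Finset.range (ℓ ^ (E - t))).filter (fun c => ∃ j, ¬ ℓ ∣ c j) with hT
  let f : (Σ _ : ℕ, Fin K → ℕ) → Fin K → ℕ := fun p i => ℓ ^ p.1 * p.2 i
  have hsub : (Fintype.piFinset fun _ : Fin K => Finset.range (ℓ ^ E)).erase 0 ⊆ T.image f := by
    intro c hc
    rw [Finset.mem_erase, Fintype.mem_piFinset] at hc
    obtain ⟨t, c', h1, h2, h3, h4⟩ := exists_eq_pow_mul_of_ne_zero E c hc.1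
      fun i => Finset.mem_range.1 (hc.2 i)
    exact Finset.mem_image.2 ⟨⟨t, c'⟩, by simp [hT, h1, h2, h3], h4.symm⟩
  refine (Finset.sum_le_sum_of_subset_of_nonneg hsub fun _ _ _ => hg _).trans ?_
  exact Finset.sum_image_le_of_nonneg fun _ _ => hg _

theorem sum_range_pow_le_inv {r : ℝ} (h0 : 0 ≤ r) (h1 : r < 1) (n : ℕ) :
    ∑ i ∈ Finset.range n, r ^ i ≤ (1 - r)⁻¹ := by
  rw [← tsum_geometric_of_lt_one h0 h1]
  exact (summable_geometric_of_lt_one h0 h1).sum_le_tsum _ fun i _ => pow_nonneg h0 i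

theorem exists_sum_rpow_le (δ : ℝ) : ∃ C : ℝ, 0 < C ∧ ∀ ℓ : ℕ, 2 ≤ ℓ → ∀ E : ℕ,
    ∑ t ∈ Finset.range E, (ℓ : ℝ) ^ ((((E - t : ℕ) : ℝ) + 1) * δ) ≤
      C * ((E + 1 : ℕ) : ℝ) ^ (if δ = 0 then 1 else 0) * (ℓ : ℝ) ^ (((E : ℝ) + 1) * max 0 δ) := by
  rcases lt_trichotomy δ 0 with hδ | rfl | hδ
  · have hr1 : (2 : ℝ) ^ δ < 1 := Real.rpow_lt_one_of_one_lt_of_neg (by norm_num) hδ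
    have hr0 : (0 : ℝ) ≤ 2 ^ δ := by positivity
    refine ⟨(1 - (2 : ℝ) ^ δ)⁻¹, inv_pos.2 (by linarith), fun ℓ hℓ E => ?_⟩
    have hℓ' : (2 : ℝ) ≤ ℓ := by exact_mod_cast hℓ
    rw [if_neg hδ.ne, pow_zero, max_eq_left hδ.le, mul_zero, Real.rpow_zero, mul_one, mul_one]
    refine le_trans ?_ (sum_range_pow_le_inv hr0 hr1 E)
    rw [← Finset.sum_range_reflect]
    refine Finset.sum_le_sum fun t ht => ?_
    have ht := Finset.mem_range.1 ht
    rw [mul_comm, Real.rpow_mul (by positivity)]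
    have h1 : (ℓ : ℝ) ^ δ ≤ 2 ^ δ := Real.rpow_le_rpow_of_nonpos (by norm_num) hℓ' hδ.le
    have h2 : ((E - (E - 1 - t) : ℕ) : ℝ) + 1 = ((t + 2 : ℕ) : ℝ) := by
      rw [show E - (E - 1 - t) = t + 1 by omega]
      push_cast
      ring
    rw [h2, Real.rpow_natCast]
    exact (pow_le_pow_left₀ (by positivity) h1 _).trans (pow_le_pow_of_le_one hr0 hr1.le (by omega))
  · refine ⟨1, one_pos, fun ℓ hℓ E => ?_⟩
    simp
  · have hr1 : (2 : ℝ) ^ (-δ) < 1 := Real.rpow_lt_one_of_one_lt_of_neg (by norm_num) (by linarith)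
    have hr0 : (0 : ℝ) ≤ 2 ^ (-δ) := by positivity
    refine ⟨(1 - (2 : ℝ) ^ (-δ))⁻¹, inv_pos.2 (by linarith), fun ℓ hℓ E => ?_⟩
    have hℓ' : (2 : ℝ) ≤ ℓ := by exact_mod_cast hℓ
    rw [if_neg hδ.ne', pow_zero, max_eq_right hδ.le, mul_one]
    refine le_trans ?_ (mul_le_mul_of_nonneg_right (sum_range_pow_le_inv hr0 hr1 E) (by positivity))
    rw [Finset.sum_mul]
    refine Finset.sum_le_sum fun t ht => ?_
    have ht := Finset.mem_range.1 ht
    have h1 : (ℓ : ℝ) ^ (-δ) ≤ 2 ^ (-δ) :=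
      Real.rpow_le_rpow_of_nonpos (by norm_num) hℓ' (by linarith)
    have h2 : (((E - t : ℕ) : ℝ) + 1) * δ = (-δ) * t + ((E : ℝ) + 1) * δ := by
      rw [Nat.cast_sub ht.le]
      ring
    rw [h2, Real.rpow_add (by positivity), Real.rpow_mul (by positivity), Real.rpow_natCast]
    exact mul_le_mul_of_nonneg_right (pow_le_pow_left₀ (by positivity) h1 _) (by positivity)

theorem card_solBox {K N q : ℕ} [NeZero q] (F : Fin K → Fin N → ℤ[X]) (W : Fin K → ℤ) :
    (solBox q F W).card =
      Nat.card {v : Fin N → ZMod q // ∀ i, ∏ j, aeval (v j) (F i j) = (W i : ZMod q)} := by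
  have haev : ∀ (n : ℕ) (P : ℤ[X]), aeval (n : ZMod q) P = ((P.eval (n : ℤ) : ℤ) : ZMod q) := fun n P => by
    have := aeval_algebraMap_apply_eq_algebraMap_eval (A := ZMod q) (n : ℤ) P
    simpa using this
  rw [Nat.card_eq_fintype_card, Fintype.card_subtype]
  refine Finset.card_nbij' (fun v j => (v j : ZMod q)) (fun x j => (x j).val) ?_ ?_ ?_ ?_
  · intro v hv
    simp only [Finset.coe_filter, Finset.mem_univ, true_and, Set.mem_ofPred_eq, haev]
    intro i
    have := (mem_solBox.1 hv).2 i
    rw [← ZMod.intCast_zmod_eq_zero_iff_dvd, Int.cast_sub, sub_eq_zero] at this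
    rw [← this]
    push_cast
    rfl
  · intro x hx
    refine Finset.mem_coe.2 (mem_solBox.2 ⟨fun j => ZMod.val_lt _, fun i => ?_⟩)
    have hx := (Finset.mem_filter.1 hx).2 i
    rw [← ZMod.intCast_zmod_eq_zero_iff_dvd, Int.cast_sub, sub_eq_zero, ← hx]
    push_cast
    refine Finset.prod_congr rfl fun j _ => ?_
    rw [← haev, ZMod.natCast_zmod_val]
  · intro v hv
    funext j
    exact ZMod.val_cast_of_lt ((mem_solBox.1 hv).1 j)
  · intro x _
    funext j
    exact ZMod.natCast_zmod_val _

/-- The bound for the number of solutions modulo a prime power. -/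
theorem exists_card_solBox_prime_pow_le {K N D : ℕ} (hK : 1 ≤ K) (hN : 1 ≤ N)
    {F : Fin K → Fin N → ℤ[X]} (hF : ∀ i j, 0 < (F i j).natDegree)
    (hind : ∀ j, MultIndep (fun i => F i j)) (hFD : ∀ j, ∑ i, (F i j).natDegree ≤ D) :
    ∃ C : ℝ, 0 < C ∧ ∀ ℓ : ℕ, ℓ.Prime → ∀ E : ℕ, ∀ W : Fin K → ℤ, (∀ i, ¬ (ℓ : ℤ) ∣ W i) →
      ((solBox (ℓ ^ (E + 1)) F W).card : ℝ) ≤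
        C * ((E + 1 : ℕ) : ℝ) ^ (if N = K * D then 1 else 0) *
          (ℓ : ℝ) ^ (((E : ℝ) + 1) * ((N : ℝ) - min (K : ℝ) ((N : ℝ) / D))) := by
  obtain ⟨B₁, hB₁0, hB₁⟩ := exists_card_solutions_prime_le hK hN hF hind hFD
  have hB' := fun j => exists_sum_norm_sum_unitLog_le (fun i => hF i j) (hind j) (hFD j)
  choose B hB0 hB using hB'
  obtain ⟨C₂, hC₂0, hC₂⟩ := exists_sum_rpow_le ((K : ℝ) - N / D)
  have hD1 : 1 ≤ D := by
    refine le_trans ?_ (hFD ⟨0, hN⟩)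
    exact (hF ⟨0, hK⟩ _).trans_le (Finset.single_le_sum (f := fun i => (F i ⟨0, hN⟩).natDegree)
      (fun _ _ => Nat.zero_le _) (Finset.mem_univ _))
  have hD0 : (D : ℝ) ≠ 0 := by positivity
  have hδ : (K : ℝ) - N / D = 0 ↔ N = K * D := by
    rw [sub_eq_zero, eq_div_iff hD0]
    norm_cast
    exact eq_comm
  have hP0 : 0 < ∏ j, B j := Finset.prod_pos fun j _ => hB0 j
  refine ⟨B₁ + (∏ j, B j) * C₂, by positivity, fun ℓ hℓ E W hW => ?_⟩
  have hne : NeZero ℓ := ⟨hℓ.ne_zero⟩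
  have hℓ0 : (0 : ℝ) < ℓ := by exact_mod_cast hℓ.pos
  have hℓ1 : (1 : ℝ) ≤ ℓ := by exact_mod_cast hℓ.one_le
  set δ : ℝ := (K : ℝ) - N / D with hδdef
  set ε : ℕ := if N = K * D then 1 else 0 with hε
  have hmin : (K : ℝ) - min (K : ℝ) ((N : ℝ) / D) = max 0 δ := by
    rw [hδdef]
    rcases le_total (K : ℝ) ((N : ℝ) / D) with h | h
    · rw [min_eq_left h, max_eq_left (by linarith), sub_self]
    · rw [min_eq_right h, max_eq_right (by linarith)]
  have hm0 : 0 ≤ max 0 δ := le_max_left _ _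
  have hprime : ((solBox ℓ F W).card : ℝ) ≤ B₁ * (ℓ : ℝ) ^ ((N : ℝ) - min (K : ℝ) ((N : ℝ) / D)) := by
    rw [card_solBox]
    exact hB₁ ℓ hℓ _ fun i h => hW i ((ZMod.intCast_zmod_eq_zero_iff_dvd _ _).1 h)
  have hterm : ∀ t ∈ Finset.range E, ∀ c ∈ (Fintype.piFinset fun _ : Fin K =>
      Finset.range (ℓ ^ (E - t))).filter (fun c => ∃ j, ¬ ℓ ∣ c j),
      (∏ j, ∑ a ∈ Finset.range ℓ, if ∀ i, ¬ (ℓ : ℤ) ∣ (F i j).eval (a : ℤ) then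
          ‖∑ y ∈ Finset.range (ℓ ^ E), addExp (ℓ ^ E) (unitLog ℓ (E + 2) (fun i => F i j)
            (fun i => ((ℓ ^ t * c i : ℕ) : ℤ)) (a + ℓ * y))‖ else 0) ≤
        (∏ j, B j) * ((ℓ : ℝ) ^ t * (ℓ : ℝ) ^ ((((E - t : ℕ) : ℝ) + 1) * (1 - 1 / D))) ^ N := by
    intro t ht c hc
    have ht := Finset.mem_range.1 ht
    obtain ⟨j₀, hj₀⟩ := (Finset.mem_filter.1 hc).2
    have h1 : ∀ j ∈ Finset.univ, (∑ a ∈ Finset.range ℓ, if ∀ i, ¬ (ℓ : ℤ) ∣ (F i j).eval (a : ℤ) then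
          ‖∑ y ∈ Finset.range (ℓ ^ E), addExp (ℓ ^ E) (unitLog ℓ (E + 2) (fun i => F i j)
            (fun i => ((ℓ ^ t * c i : ℕ) : ℤ)) (a + ℓ * y))‖ else 0) ≤
        B j * ((ℓ : ℝ) ^ t * (ℓ : ℝ) ^ ((((E - t : ℕ) : ℝ) + 1) * (1 - 1 / D))) := by
      intro j _
      have h2 := hB j ℓ hℓ (E - t) (E + 2) (by omega) (by omega) (by omega) (fun i => (c i : ℤ))
        ⟨j₀, by exact_mod_cast hj₀⟩
      rw [mul_left_comm]
      refine le_trans (le_of_eq ?_) (mul_le_mul_of_nonneg_left h2 (by positivity))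
      rw [Finset.mul_sum]
      refine Finset.sum_congr rfl fun a _ => ?_
      split_ifs with h3
      · have h4 := sum_addExp_unitLog_pow_mul (E := E - t) (t := t) (M := E + 2) hℓ (by omega)
          (fun i => F i j) (fun i => (c i : ℤ)) h3
        rw [Nat.sub_add_cancel ht.le] at h4
        push_cast
        rw [h4, norm_mul, norm_pow, Complex.norm_natCast]
      · simp
    refine (Finset.prod_le_prod (fun j _ => Finset.sum_nonneg fun a _ => ?_) h1).trans (le_of_eq ?_)
    · split_ifs
      · exact norm_nonneg _
      · exact le_rfl
    · rw [Finset.prod_mul_distrib, Finset.prod_const, Finset.card_univ, Fintype.card_fin]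
  have hmain := (card_solBox_pow_mul_le (M := E + 2) hℓ (by omega) (by omega) F hW).trans
    (add_le_add (mul_le_mul_of_nonneg_right hprime (by positivity))
      ((sum_erase_zero_le E _ fun c => Finset.prod_nonneg fun j _ => Finset.sum_nonneg fun a _ => by
        split_ifs
        · exact norm_nonneg _
        · exact le_rfl).trans (Finset.sum_le_sum fun t ht => Finset.sum_le_card_nsmul _ _ _ (hterm t ht))))
  have hsum : ∑ t ∈ Finset.range E, ((Fintype.piFinset fun _ : Fin K =>
      Finset.range (ℓ ^ (E - t))).filter (fun c => ∃ j, ¬ ℓ ∣ c j)).card •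
        ((∏ j, B j) * ((ℓ : ℝ) ^ t * (ℓ : ℝ) ^ ((((E - t : ℕ) : ℝ) + 1) * (1 - 1 / D))) ^ N) ≤
      (∏ j, B j) * (ℓ : ℝ) ^ (((E : ℝ) + 1) * N - K) *
        (C₂ * ((E + 1 : ℕ) : ℝ) ^ ε * (ℓ : ℝ) ^ (((E : ℝ) + 1) * max 0 δ)) := by
    have h1 := hC₂ ℓ hℓ.two_le E
    simp only [hδ] at h1
    refine le_trans ?_ (mul_le_mul_of_nonneg_left h1 (by positivity))
    rw [Finset.mul_sum]
    refine Finset.sum_le_sum fun t ht => ?_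
    have ht := Finset.mem_range.1 ht
    have h2 : (((Fintype.piFinset fun _ : Fin K =>
        Finset.range (ℓ ^ (E - t))).filter (fun c => ∃ j, ¬ ℓ ∣ c j)).card : ℝ) ≤
        (ℓ : ℝ) ^ (((E - t : ℕ) : ℝ) * K) := by
      rw [Real.rpow_mul hℓ0.le, Real.rpow_natCast, Real.rpow_natCast]
      have := Finset.card_filter_le (Fintype.piFinset fun _ : Fin K => Finset.range (ℓ ^ (E - t)))
        (fun c => ∃ j, ¬ ℓ ∣ c j)
      rw [Fintype.card_piFinset_const, Finset.card_range] at this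
      exact_mod_cast this
    rw [nsmul_eq_mul]
    refine (mul_le_mul_of_nonneg_right h2 (by positivity)).trans (le_of_eq ?_)
    rw [mul_left_comm, mul_assoc]
    congr 1
    rw [← Real.rpow_natCast (ℓ : ℝ) t, ← Real.rpow_add hℓ0, ← Real.rpow_natCast _ N,
      ← Real.rpow_mul hℓ0.le, ← Real.rpow_add hℓ0, ← Real.rpow_add hℓ0]
    congr 1
    rw [hδdef, Nat.cast_sub ht.le]
    field_simp
    ring
  have hQ : (0 : ℝ) < ((ℓ : ℝ) ^ E) ^ K := by positivity
  have hε1 : (1 : ℝ) ≤ ((E + 1 : ℕ) : ℝ) ^ ε := one_le_pow₀ (by exact_mod_cast Nat.succ_pos E)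
  refine le_of_mul_le_mul_right (hmain.trans ((add_le_add le_rfl hsum).trans ?_)) hQ
  have hQ' : ((ℓ : ℝ) ^ E) ^ K = (ℓ : ℝ) ^ ((E : ℝ) * K) := by
    rw [Real.rpow_mul hℓ0.le, Real.rpow_natCast, Real.rpow_natCast]
  have hQN : ((ℓ : ℝ) ^ E) ^ N = (ℓ : ℝ) ^ ((E : ℝ) * N) := by
    rw [Real.rpow_mul hℓ0.le, Real.rpow_natCast, Real.rpow_natCast]
  have hmin' : min (K : ℝ) ((N : ℝ) / D) = K - max 0 δ := by linarith
  rw [hQ', hQN, hmin', mul_assoc (B₁ + _), mul_assoc (B₁ + _), add_mul B₁]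
  refine add_le_add ?_ (le_of_eq ?_)
  · rw [mul_assoc]
    refine mul_le_mul_of_nonneg_left ?_ hB₁0.le
    rw [mul_assoc, ← Real.rpow_add hℓ0, ← Real.rpow_add hℓ0]
    refine le_trans ?_ (le_mul_of_one_le_left (by positivity) hε1)
    refine Real.rpow_le_rpow_of_exponent_le hℓ1 ?_
    have : 0 ≤ (E : ℝ) * max 0 δ := by positivity
    nlinarith
  · have h3 : (ℓ : ℝ) ^ (((E : ℝ) + 1) * N - K) * (ℓ : ℝ) ^ (((E : ℝ) + 1) * max 0 δ) =
        (ℓ : ℝ) ^ (((E : ℝ) + 1) * (N - (K - max 0 δ))) * (ℓ : ℝ) ^ ((E : ℝ) * K) := by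
      rw [← Real.rpow_add hℓ0, ← Real.rpow_add hℓ0]
      congr 1
      ring
    linear_combination ((∏ j, B j) * C₂ * ((E + 1 : ℕ) : ℝ) ^ ε) * h3

theorem card_solBox_mul_le {K N m n : ℕ} (hm : 0 < m) (hn : 0 < n) (h : Nat.Coprime m n)
    (F : Fin K → Fin N → ℤ[X]) (W : Fin K → ℤ) :
    (solBox (m * n) F W).card ≤ (solBox m F W).card * (solBox n F W).card := by
  rw [← Finset.card_product]
  have key : ∀ d, 0 < d → d ∣ m * n → ∀ v ∈ solBox (m * n) F W, (fun j => v j % d) ∈ solBox d F W := by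
    intro d hd hdvd v hv
    refine mem_solBox.2 ⟨fun j => Nat.mod_lt _ hd, fun i => ?_⟩
    have h1 : (d : ℤ) ∣ ∏ j, (F i j).eval (v j : ℤ) - W i :=
      (Int.natCast_dvd_natCast.2 hdvd).trans ((mem_solBox.1 hv).2 i)
    rw [← ZMod.intCast_zmod_eq_zero_iff_dvd] at h1 ⊢
    rw [← h1]
    push_cast
    congr 1
    refine Finset.prod_congr rfl fun j _ => ?_
    rw [← sub_eq_zero, ← Int.cast_sub]
    refine (ZMod.intCast_zmod_eq_zero_iff_dvd _ _).2 (dvd_trans ?_ (Polynomial.sub_dvd_eval_sub _ _ _))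
    exact (Int.mod_modEq _ _).symm.dvd
  refine Finset.card_le_card_of_injOn (fun v => (fun j => v j % m, fun j => v j % n)) ?_ ?_
  · intro v hv
    exact Finset.mem_coe.2 (Finset.mem_product.2
      ⟨key m hm (Dvd.intro _ rfl) v hv, key n hn (Dvd.intro_left _ rfl) v hv⟩)
  · intro v hv v' hv' h'
    obtain ⟨h1, h2⟩ := Prod.mk.inj h'
    funext j
    have h3 : v j ≡ v' j [MOD m * n] :=
      (Nat.modEq_and_modEq_iff_modEq_mul h).1 ⟨congrFun h1 j, congrFun h2 j⟩
    exact h3.eq_of_lt_of_lt ((mem_solBox.1 hv).1 j) ((mem_solBox.1 hv').1 j)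

theorem card_solBox_prod_le {K N : ℕ} (F : Fin K → Fin N → ℤ[X]) (W : Fin K → ℤ) (s : Finset ℕ)
    (hs : ∀ ℓ ∈ s, ℓ.Prime) (e : ℕ → ℕ) :
    (solBox (∏ ℓ ∈ s, ℓ ^ e ℓ) F W).card ≤ ∏ ℓ ∈ s, (solBox (ℓ ^ e ℓ) F W).card := by
  induction s using Finset.induction_on with
  | empty =>
    refine (Finset.card_filter_le _ _).trans ?_
    simp
  | insert ℓ s hℓ ih =>
    have hs' : ∀ p ∈ s, p.Prime := fun p hp => hs p (Finset.mem_insert_of_mem hp)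
    have hp := hs ℓ (Finset.mem_insert_self _ _)
    rw [Finset.prod_insert hℓ, Finset.prod_insert hℓ]
    refine (card_solBox_mul_le (pow_pos hp.pos _)
      (Finset.prod_pos fun p h => pow_pos (hs' p h).pos _) ?_ F W).trans (Nat.mul_le_mul_left _ (ih hs'))
    refine Nat.Coprime.prod_right fun p h => Nat.Coprime.pow _ _ ?_
    exact (Nat.coprime_primes hp (hs' p h)).2 fun h' => hℓ (h' ▸ h)

theorem VNK_le_card_solBox {K N q : ℕ} [NeZero q] (F : Fin K → Fin N → ℤ[X]) (w : Fin K → ZMod q) :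
    VNK F q w ≤ (solBox q F fun i => ((w i).val : ℤ)).card := by
  rw [card_solBox, VNK]
  refine Nat.card_le_card_of_injective
    (fun v => ⟨fun j => (v.1 j : ZMod q), fun i => by simpa using v.2 i⟩) fun v v' h => ?_
  refine Subtype.ext (funext fun j => Units.ext ?_)
  exact congrFun (Subtype.mk.inj h) j

theorem le_totient_mul_two_pow {q : ℕ} (hq : 0 < q) : q ≤ q.totient * 2 ^ q.primeFactors.card := by
  have h := Nat.totient_eq_mul_prod_factors q
  have h1 : (1 : ℚ) ≤ (∏ p ∈ q.primeFactors, (1 - (p : ℚ)⁻¹)) * 2 ^ q.primeFactors.card := by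
    rw [← Finset.prod_const, ← Finset.prod_mul_distrib]
    refine Finset.prod_induction _ (fun x => 1 ≤ x) (fun a b ha hb => one_le_mul_of_one_le_of_one_le ha hb)
      le_rfl fun p hp => ?_
    have hp : (2 : ℚ) ≤ p := by exact_mod_cast (Nat.prime_of_mem_primeFactors hp).two_le
    have := inv_anti₀ (by norm_num) hp
    linarith
  have h2 : (q : ℚ) ≤ q.totient * 2 ^ q.primeFactors.card := by
    rw [h, mul_assoc]
    exact le_mul_of_one_le_right (by positivity) h1
  exact_mod_cast h2

theorem VNK_count_small_N
    (K L : ℕ) (hK : 1 ≤ K) (hL : 1 ≤ L)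
    (B₀ : ℝ) (hB₀ : 0 < B₀)
    (G : Fin K → Fin L → Polynomial ℤ)
    (hGnc : ∀ i r, 0 < (G i r).natDegree)
    (hGMI : ∀ r, MultIndep (fun i => G i r))
    (D₀ : ℕ) (hD₀ : D₀ = Finset.univ.sup fun r : Fin L => ∑ i, (G i r).natDegree)
    (N : ℕ) (hN : 1 ≤ N)
    (F : Fin K → Fin N → Polynomial ℤ)
    (hF : ∀ j : Fin N, ∃ j' : Fin L, ∀ i, F i j = G i j') :
    ∃ A : ℝ, 0 < A ∧
      ∀ q : ℕ, 0 < q → ∀ w : Fin K → ZMod q, (∀ i, IsUnit (w i)) →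
        (VNK F q w : ℝ) / (q.totient : ℝ) ^ N ≤
          (∏ ℓ ∈ q.primeFactors, (q.factorization ℓ : ℝ)) ^
              (if N = K * D₀ then 1 else 0) *
            (q : ℝ) ^ (-(min (K : ℝ) ((N : ℝ) / (D₀ : ℝ)))) *
            Real.exp (A * q.primeFactors.card) := by
  have hnat : ∀ i j, 0 < (F i j).natDegree := fun i j => by
    obtain ⟨j', hj'⟩ := hF j
    rw [hj' i]
    exact hGnc i j'
  have hind : ∀ j, MultIndep (fun i => F i j) := fun j => by
    obtain ⟨j', hj'⟩ := hF j
    rw [funext hj']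
    exact hGMI j'
  have hdeg : ∀ j, ∑ i, (F i j).natDegree ≤ D₀ := fun j => by
    obtain ⟨j', hj'⟩ := hF j
    rw [hD₀, Finset.sum_congr rfl fun i _ => congrArg natDegree (hj' i)]
    exact Finset.le_sup (f := fun r : Fin L => ∑ i, (G i r).natDegree) (Finset.mem_univ j')
  obtain ⟨C, hC0, hC⟩ := exists_card_solBox_prime_pow_le hK hN hnat hind hdeg
  refine ⟨C * 2 ^ N, by positivity, fun q hq w hw => ?_⟩
  have hne : NeZero q := ⟨hq.ne'⟩
  set m : ℝ := min (K : ℝ) ((N : ℝ) / (D₀ : ℝ)) with hm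
  set ε : ℕ := if N = K * D₀ then 1 else 0 with hε
  set ω := q.primeFactors.card with hω
  have hqprod : q = ∏ ℓ ∈ q.primeFactors, ℓ ^ q.factorization ℓ :=
    (Nat.prod_factorization_pow_eq_self hq.ne').symm
  have hq0 : (0 : ℝ) < q := by exact_mod_cast hq
  have hφ0 : (0 : ℝ) < q.totient := by exact_mod_cast Nat.totient_pos.2 hq
  have hW : ∀ ℓ ∈ q.primeFactors, ∀ i, ¬ (ℓ : ℤ) ∣ ((w i).val : ℤ) := fun ℓ hℓ i h => by
    have h1 : Nat.Coprime (w i).val q := by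
      obtain ⟨u, hu⟩ := hw i
      rw [← hu]
      exact ZMod.val_coe_unit_coprime u
    exact (Nat.prime_of_mem_primeFactors hℓ).one_lt.ne' (Nat.eq_one_of_dvd_coprimes h1
      (Int.natCast_dvd_natCast.1 h) (Nat.dvd_of_mem_primeFactors hℓ))
  have hcount : (VNK F q w : ℝ) ≤
      C ^ ω * (∏ ℓ ∈ q.primeFactors, (q.factorization ℓ : ℝ)) ^ ε * (q : ℝ) ^ ((N : ℝ) - m) := by
    have h1 : (VNK F q w : ℝ) ≤ ∏ ℓ ∈ q.primeFactors,
        ((solBox (ℓ ^ q.factorization ℓ) F fun i => ((w i).val : ℤ)).card : ℝ) := by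
      have h2 := VNK_le_card_solBox F w
      have h3 := card_solBox_prod_le F (fun i => ((w i).val : ℤ)) q.primeFactors
        (fun ℓ hℓ => Nat.prime_of_mem_primeFactors hℓ) q.factorization
      rw [← hqprod] at h3
      exact_mod_cast h2.trans h3
    have h4 : (q : ℝ) ^ ((N : ℝ) - m) =
        ∏ ℓ ∈ q.primeFactors, (ℓ : ℝ) ^ ((q.factorization ℓ : ℝ) * ((N : ℝ) - m)) := by
      conv_lhs => rw [hqprod]
      push_cast
      rw [← Real.finsetProd_rpow _ _ fun ℓ _ => by positivity]
      refine Finset.prod_congr rfl fun ℓ _ => ?_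
      rw [Real.rpow_mul (by positivity), Real.rpow_natCast]
    refine h1.trans ?_
    rw [h4, ← Finset.prod_pow, hω, ← Finset.prod_const, ← Finset.prod_mul_distrib,
      ← Finset.prod_mul_distrib]
    refine Finset.prod_le_prod (fun _ _ => Nat.cast_nonneg _) fun ℓ hℓ => ?_
    have hp := Nat.prime_of_mem_primeFactors hℓ
    obtain ⟨E, hE⟩ := Nat.exists_eq_succ_of_ne_zero
      (hp.factorization_pos_of_dvd hq.ne' (Nat.dvd_of_mem_primeFactors hℓ)).ne'
    have := hC ℓ hp E _ (hW ℓ hℓ)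
    rw [hE, Nat.succ_eq_add_one]
    refine this.trans (le_of_eq ?_)
    push_cast
    ring
  have hqφ : (q : ℝ) ^ N ≤ (q.totient : ℝ) ^ N * (2 ^ N) ^ ω := by
    have h1 : (q : ℝ) ≤ q.totient * 2 ^ ω := by exact_mod_cast le_totient_mul_two_pow hq
    refine (pow_le_pow_left₀ hq0.le h1 N).trans (le_of_eq ?_)
    rw [mul_pow, ← pow_mul, ← pow_mul, mul_comm ω]
  have hexp : (C * 2 ^ N) ^ ω ≤ Real.exp (C * 2 ^ N * ω) := by
    rw [mul_comm (C * 2 ^ N) (ω : ℝ), Real.exp_nat_mul]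
    refine pow_le_pow_left₀ (by positivity) ?_ ω
    have := Real.add_one_le_exp (C * 2 ^ N)
    linarith
  rw [div_le_iff₀ (by positivity)]
  set Pe := (∏ ℓ ∈ q.primeFactors, (q.factorization ℓ : ℝ)) ^ ε with hPe
  have hPe0 : 0 ≤ Pe := by positivity
  calc (VNK F q w : ℝ) ≤ C ^ ω * Pe * (q : ℝ) ^ ((N : ℝ) - m) := hcount
    _ = C ^ ω * Pe * (q : ℝ) ^ (-m) * (q : ℝ) ^ N := by
        rw [sub_eq_add_neg, Real.rpow_add hq0, Real.rpow_natCast]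
        ring
    _ ≤ C ^ ω * Pe * (q : ℝ) ^ (-m) * ((q.totient : ℝ) ^ N * (2 ^ N) ^ ω) :=
        mul_le_mul_of_nonneg_left hqφ (by positivity)
    _ = Pe * (q : ℝ) ^ (-m) * (C * 2 ^ N) ^ ω * (q.totient : ℝ) ^ N := by
        rw [mul_pow]
        ring
    _ ≤ _ := by gcongr
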